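/- Fix an integer d ≥ 3 and a finite set M. For any μ ∈ I_d(M) and any integer r ≥ 1, the upper entropy is bounded by the annealed entropy: h̄(μ,r) ≤ Σ_r(μ), and consequently h̄(μ) ≤ Σ(μ). -/

import Mathlib

open MeasureTheory Filter Topology
open scoped ENNReal Classical

noncomputable section

namespace TreeEntropy

@[ext]
structure RCG (M : Type*) where
  col : List ℕ → Option M
  adj : List ℕ × List ℕ → Bool

variable {M : Type*}

def resS (r : ℕ) (g : RCG M) : RCG M where
  col l := if l.length ≤ r then g.col l else none
  adj p := if p.1.length ≤ r ∧ p.2.length ≤ r then g.adj p else false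

def rcgDist (g g' : RCG M) : ℝ :=
  ∑' r : ℕ, if resS r g = resS r g' then 0 else (2:ℝ)⁻¹ ^ r

private lemma rcg_summable (a b : RCG M) : Summable
    (fun r : ℕ => if resS r a = resS r b then (0:ℝ) else (2:ℝ)⁻¹ ^ r) := by
  refine Summable.of_nonneg_of_le (fun r => ?_) (fun r => ?_)
    (summable_geometric_of_lt_one (by norm_num) (by norm_num : (2:ℝ)⁻¹ < 1))
  · split
    · exact le_rfl
    · positivity
  · split
    · positivity
    · exact le_rfl

private lemma rcg_nonneg (a b : RCG M) (r : ℕ) :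
    (0:ℝ) ≤ if resS r a = resS r b then (0:ℝ) else (2:ℝ)⁻¹ ^ r := by
  split
  · exact le_rfl
  · positivity

private lemma rcgDist_self (g : RCG M) : rcgDist g g = 0 := by simp [rcgDist]

private lemma rcgDist_comm (g g' : RCG M) : rcgDist g g' = rcgDist g' g :=
  tsum_congr fun r => if_congr eq_comm rfl rfl

private lemma rcgDist_triangle (g₁ g₂ g₃ : RCG M) :
    rcgDist g₁ g₃ ≤ rcgDist g₁ g₂ + rcgDist g₂ g₃ := by
  unfold rcgDist
  rw [← Summable.tsum_add (rcg_summable _ _) (rcg_summable _ _)]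
  refine Summable.tsum_le_tsum (fun r => ?_) (rcg_summable _ _)
    ((rcg_summable _ _).add (rcg_summable _ _))
  have hx : (0:ℝ) ≤ (2:ℝ)⁻¹ ^ r := by positivity
  by_cases h12 : resS r g₁ = resS r g₂
  · by_cases h23 : resS r g₂ = resS r g₃
    · rw [if_pos h12, if_pos h23, if_pos (h12.trans h23)]; linarith
    · rw [if_pos h12, if_neg h23, zero_add]
      split_ifs <;> linarith
  · by_cases h23 : resS r g₂ = resS r g₃
    · rw [if_neg h12, if_pos h23, add_zero]
      split_ifs <;> linarith
    · rw [if_neg h12, if_neg h23]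
      split_ifs <;> linarith

private lemma rcgDist_eq_zero (g g' : RCG M) (h : rcgDist g g' = 0) : g = g' := by
  unfold rcgDist at h
  have hr : ∀ r : ℕ, resS r g = resS r g' := by
    intro r
    by_contra hne
    have hpos : (0:ℝ) <
        ∑' r : ℕ, if resS r g = resS r g' then (0:ℝ) else (2:ℝ)⁻¹ ^ r :=
      Summable.tsum_pos (rcg_summable g g') (rcg_nonneg g g') r
        (by rw [if_neg hne]; positivity)
    exact absurd h hpos.ne'
  have hc : g.col = g'.col := by
    funext l
    have h1 := congrFun (congrArg RCG.col (hr l.length)) l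
    simpa [resS] using h1
  have ha : g.adj = g'.adj := by
    funext p
    have h1 := congrFun (congrArg RCG.adj (hr (max p.1.length p.2.length))) p
    simpa [resS, le_max_left, le_max_right] using h1
  exact RCG.ext hc ha

instance : MetricSpace (RCG M) where
  dist := rcgDist
  dist_self := rcgDist_self
  dist_comm := rcgDist_comm
  dist_triangle := rcgDist_triangle
  eq_of_dist_eq_zero := rcgDist_eq_zero _ _

instance : MeasurableSpace (RCG M) := borel _
instance : BorelSpace (RCG M) := ⟨rfl⟩


/-! ### The `d`-regular tree `T_d` -/

/-- A list `l = [i_k, …, i_1]` (deepest step first) is the breadth-first-search label of a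
vertex of the `d`-regular tree `T_d` iff its first (root-side) step lies in `{1, …, d}` and all
subsequent steps lie in `{1, …, d-1}`. -/
def ValidTd (d : ℕ) (l : List ℕ) : Prop :=
  (∀ i ∈ l.dropLast, 1 ≤ i ∧ i ≤ d - 1) ∧ (∀ i ∈ l.getLast?, 1 ≤ i ∧ i ≤ d)

/-- The vertex set of the `d`-regular tree `T_d`. -/
def TdVertex (d : ℕ) : Type := {l : List ℕ // ValidTd d l}

/-- The root `o` of `T_d`. -/
def rootTd (d : ℕ) : TdVertex d := ⟨[], by constructor <;> simp [List.getLast?]⟩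

/-- The first neighbor `1` of the root of `T_d` (defined as the root for the degenerate case
`d = 0`, which never occurs below). -/
def node1 (d : ℕ) : TdVertex d :=
  if h : 1 ≤ d then ⟨[1], by constructor <;> simp [List.getLast?, h]⟩ else rootTd d

/-- The graph structure of the `d`-regular tree: two vertices are adjacent iff one is obtained
from the other by adding one step. -/
def TdGraph (d : ℕ) : SimpleGraph (TdVertex d) where
  Adj v w := (∃ i, w.1 = i :: v.1) ∨ (∃ i, v.1 = i :: w.1)
  symm := by constructor; intro v w h; tauto
  loopless := by
    constructor
    rintro v (⟨i, h⟩ | ⟨i, h⟩) <;>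
      · have := congrArg List.length h
        simp at this

/-- Graph distance between two vertices of a tree encoded by their BFS labels: the nearest
common ancestor corresponds to the longest common suffix. -/
def treeDist (u w : List ℕ) : ℕ :=
  ((u.reverse.zip w.reverse).takeWhile (fun p => p.1 = p.2)).length |> fun c =>
    (u.length - c) + (w.length - c)

/-- The ball `S_r = B_r(o)` of radius `r` around the root of `T_d`. -/
def SrSet (d r : ℕ) : Set (TdVertex d) := {v | v.1.length ≤ r}

/-- The set `E_r = B_{r-1}({o,1})` of vertices at distance at most `r-1` from the edge `{o,1}`
of `T_d` (for `r ≥ 1`). -/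
def ErSet (d r : ℕ) : Set (TdVertex d) :=
  {v | v.1.length + 1 ≤ r ∨ (v.1.getLast? = some 1 ∧ v.1.length ≤ r)}

lemma ErSet_subset_SrSet (d r : ℕ) : ErSet d r ⊆ SrSet d r := by
  rintro v (h | ⟨-, h⟩) <;> simp only [SrSet, Set.mem_setOf_eq] <;> omega

/-! ### Invariant processes on `T_d` and their entropies -/

variable (d : ℕ) (M : Type*)

/-- `I_d(M)`: the set of probability measures on `M^{T_d}` invariant under all automorphisms
of the tree `T_d`. -/
def InvMeas [MeasurableSpace M] : Set (Measure (TdVertex d → M)) :=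
  {μ | IsProbabilityMeasure μ ∧
    ∀ φ : TdGraph d ≃g TdGraph d, μ.map (fun x => fun v => x (φ v)) = μ}

variable {d M}

/-- The Shannon entropy of (the distribution of) a random variable with law `μ`, a measure
with countable support on a discrete space. -/
def shannon {α : Type*} [MeasurableSpace α] (μ : Measure α) : ℝ :=
  ∑' a : α, Real.negMulLog (μ {a}).toReal

/-- The restriction `X_S` of a process `X` on `T_d` to a subset `S` of the vertices:
the pushforward of its law. -/
def restrictTo [MeasurableSpace M] (S : Set (TdVertex d))
    (μ : Measure (TdVertex d → M)) : Measure (↥S → M) :=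
  μ.map (fun x => fun v => x v.1)

/-- The annealed entropy `Σ_r(μ) = H(X_{S_r}) - (d/2) H(X_{E_r})`. -/
def SigmaR [MeasurableSpace M] (d : ℕ) (r : ℕ) (μ : Measure (TdVertex d → M)) : ℝ :=
  shannon (restrictTo (SrSet d r) μ) - (d / 2 : ℝ) * shannon (restrictTo (ErSet d r) μ)

/-- The annealed entropy `Σ(μ) = lim_r Σ_r(μ)`: the limit of the non-increasing sequence
`r ↦ Σ_r(μ)` (`r ≥ 1`), as an extended real (the limit may be `-∞`). -/
def SigmaInf [MeasurableSpace M] (d : ℕ) (μ : Measure (TdVertex d → M)) : EReal :=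
  ⨅ r : ℕ, ((SigmaR d (r + 1) μ : ℝ) : EReal)

/-- `Σ_e(X) = (d/2) H(X_{E_1}) - (d-1) H(X_o)`. -/
def SigmaE [MeasurableSpace M] (d : ℕ) (μ : Measure (TdVertex d → M)) : ℝ :=
  (d / 2 : ℝ) * shannon (restrictTo (ErSet d 1) μ)
    - ((d : ℝ) - 1) * shannon (restrictTo ({rootTd d} : Set (TdVertex d)) μ)

/-! ### Markov processes on `T_d` -/

/-- The elementary cylinder event: the coloring takes the values prescribed by `y` on `S`. -/
def cylEvent (S : Set (TdVertex d)) (y : TdVertex d → M) : Set (TdVertex d → M) :=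
  {x | ∀ v ∈ S, x v = y v}

/-- The side of the edge `{u,w}` containing `u`, in the tree `T_d`. -/
def sideOf (u w : TdVertex d) : Set (TdVertex d) :=
  {v | treeDist v.1 u.1 < treeDist v.1 w.1}

/-- `B_{r-1}({u,w})`: the set of vertices at distance at most `r-1` from the edge `{u,w}`. -/
def edgeBall (r : ℕ) (u w : TdVertex d) : Set (TdVertex d) :=
  {v | treeDist v.1 u.1 + 1 ≤ r ∨ treeDist v.1 w.1 + 1 ≤ r}

/-- A probability measure on `M^{T_d}` is `r`-Markov on a subset `A` of `T_d` if, for every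
edge `{u,w}` of `A`, conditioned on the value on the `(r-1)`-neighborhood of the edge
(within `A`), the processes on the two sides of the edge (within `A`) are independent;
equivalently, the corresponding products of cylinder probabilities agree.  For `A` the whole
tree and `r = 1` this is the edge-Markov property. -/
def rMarkovOn [MeasurableSpace M] (r : ℕ) (A : Set (TdVertex d))
    (μ : Measure (TdVertex d → M)) : Prop :=
  ∀ u w : TdVertex d, u ∈ A → w ∈ A → (TdGraph d).Adj u w →
    ∀ F₁ F₂ : Finset (TdVertex d), ↑F₁ ⊆ sideOf u w ∩ A → ↑F₂ ⊆ sideOf w u ∩ A →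
      ∀ y : TdVertex d → M,
        μ (cylEvent (↑F₁ ∪ ↑F₂ ∪ (edgeBall r u w ∩ A)) y)
            * μ (cylEvent (edgeBall r u w ∩ A) y)
          = μ (cylEvent (↑F₁ ∪ (edgeBall r u w ∩ A)) y)
            * μ (cylEvent (↑F₂ ∪ (edgeBall r u w ∩ A)) y)

/-- A probability measure on `M^{T_d}` is `r`-Markov if, conditioned on the value on the
`(r-1)`-neighborhood of any edge, the processes on the two sides of the edge are
independent. -/
def rMarkov [MeasurableSpace M] (r : ℕ) (μ : Measure (TdVertex d → M)) : Prop :=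
  rMarkovOn r Set.univ μ

/-- A probability measure on `M^{T_d}` is vertex-Markov if, conditioned on the value at a
vertex, the processes on the pending subtrees of that vertex are independent. -/
def vertexMarkov [MeasurableSpace M] (μ : Measure (TdVertex d → M)) : Prop :=
  ∀ v : TdVertex d, ∀ k : ℕ, ∀ u : Fin k → TdVertex d,
    Function.Injective u → (∀ i, (TdGraph d).Adj v (u i)) →
    ∀ F : Fin k → Finset (TdVertex d), (∀ i, ↑(F i) ⊆ sideOf (u i) v) →
      ∀ y : TdVertex d → M,
        μ (cylEvent ((⋃ i, ↑(F i)) ∪ {v}) y) * (μ (cylEvent {v} y)) ^ (k - 1)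
          = ∏ i : Fin k, μ (cylEvent (↑(F i) ∪ {v}) y)

/-- `X_{S_1}` is a vertex-Markov process on `S_1`: the values at the `d` neighbors of the
root are conditionally independent given the value at the root. -/
def vertexMarkovOnS1 [MeasurableSpace M] (d : ℕ) (μ : Measure (TdVertex d → M)) : Prop :=
  ∀ y : TdVertex d → M,
    μ (cylEvent (SrSet d 1) y) * (μ (cylEvent ({rootTd d} : Set (TdVertex d)) y)) ^ (d - 1)
      = ∏ i ∈ Finset.Icc 1 d,
          μ (cylEvent {v : TdVertex d | v = rootTd d ∨ v.1 = [i]} y)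


/-! ### The randomly labeled rooted colored graph associated to a finite colored graph

Given a finite colored graph `(G,f)` and a vertex `v`, the associated randomly labeled rooted
colored graph is obtained by a breadth-first search exploration of the connected component of
`v` started at `v`, ties between vertices being broken uniformly at random.  We implement the
uniformly random tie-breaking by a uniformly random priority permutation `σ`. -/

variable {M : Type*} {n : ℕ}

/-- The `k`-th layer of the breadth-first search of `G` started at `v`, ordered according to
the position of the parents in the previous layer, ties being broken by the priority `σ`. -/
def bfsLayer (G : SimpleGraph (Fin n)) (v : Fin n) (σ : Equiv.Perm (Fin n)) :
    ℕ → List (Fin n)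
  | 0 => [v]
  | (k + 1) =>
    let prev := bfsLayer G v σ k
    let key : Fin n → ℕ := fun w =>
      (prev.idxOf (((prev.find? (fun u => decide (G.Adj u w))).getD v))) * n + (σ w : ℕ)
    ((List.finRange n).filter
        (fun w => decide (G.Reachable v w ∧ G.dist v w = k + 1))).mergeSort
      (fun a b => key a ≤ key b)

/-- The breadth-first-search label of the vertex `w` lying in layer `k` of the exploration of
`G` started at `v` with tie-breaking priority `σ`. -/
def bfsPathAux (G : SimpleGraph (Fin n)) (v : Fin n) (σ : Equiv.Perm (Fin n)) :
    ℕ → Fin n → Option (List ℕ)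
  | 0, w => if w = v then some [] else none
  | (k + 1), w =>
    match (bfsLayer G v σ k).find? (fun u => decide (G.Adj u w)) with
    | none => none
    | some p =>
      let L := bfsLayer G v σ (k + 1)
      let j := 1 + ((L.takeWhile (fun w' => w' ≠ w)).filter
        (fun w' => (bfsLayer G v σ k).find? (fun u => decide (G.Adj u w')) = some p)).length
      (bfsPathAux G v σ k p).map (fun pl => j :: pl)

/-- The breadth-first-search label of the vertex `w` in the exploration of the connected
component of `v` in `G`, with tie-breaking priority `σ` (`none` if `w` is not in the component
of `v`). -/
def bfsPath (G : SimpleGraph (Fin n)) (v : Fin n) (σ : Equiv.Perm (Fin n)) (w : Fin n) :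
    Option (List ℕ) :=
  if G.Reachable v w then bfsPathAux G v σ (G.dist v w) w else none

/-- The rooted colored graph obtained from the colored graph `(G,f)` by the breadth-first
search exploration of the connected component of `v` rooted at `v`, with tie-breaking
priority `σ`. -/
def bfsRCG (G : SimpleGraph (Fin n)) (f : Fin n → M) (v : Fin n) (σ : Equiv.Perm (Fin n)) :
    RCG M where
  col l := if h : ∃ w, bfsPath G v σ w = some l then some (f h.choose) else none
  adj p :=
    if (∃ w₁ w₂, bfsPath G v σ w₁ = some p.1 ∧ bfsPath G v σ w₂ = some p.2 ∧ G.Adj w₁ w₂)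
    then true else false

/-- `distr_{G,v}(f)`: the law of the randomly labeled rooted colored graph obtained from the
connected component of `v` in the colored graph `(G,f)`, rooted at `v`. -/
def distrAt (G : SimpleGraph (Fin n)) (f : Fin n → M) (v : Fin n) : Measure (RCG M) :=
  ((Nat.factorial n : ℝ≥0∞))⁻¹ •
    ∑ σ : Equiv.Perm (Fin n), Measure.dirac (bfsRCG G f v σ)

/-- `distr_G(f) = (1/|V|) ∑_{v ∈ V} distr_{G,v}(f)`. -/
def distrG (G : SimpleGraph (Fin n)) (f : Fin n → M) : Measure (RCG M) :=
  ((n : ℝ≥0∞))⁻¹ • ∑ v : Fin n, distrAt G f v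

/-! ### Random regular graphs -/

/-- The set `𝓖_n(d)` of simple `d`-regular graphs on the vertex set `{1, …, n}`. -/
def regularGraphs (d n : ℕ) : Set (SimpleGraph (Fin n)) :=
  {G | ∀ v, (G.neighborSet v).ncard = d}

/-- The probability that a uniformly distributed random `d`-regular graph `G_n` on `n`
vertices belongs to `A`. -/
def PrG (d n : ℕ) (A : Set (SimpleGraph (Fin n))) : ℝ :=
  ((regularGraphs d n ∩ A).ncard : ℝ) / ((regularGraphs d n).ncard : ℝ)

/-- The expectation of `F(G_n)` for a uniformly distributed random `d`-regular graph `G_n`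
on `n` vertices. -/
def ExG (d n : ℕ) (F : SimpleGraph (Fin n) → ℝ) : ℝ :=
  (∑ᶠ G ∈ regularGraphs d n, F G) / ((regularGraphs d n).ncard : ℝ)

/-- The integers `n` for which the set of simple `d`-regular graphs on `n` vertices is
non-empty: `n ≥ d + 1` and `nd` even.  Limits `n → ∞` are taken along this set. -/
def goodN (d : ℕ) : Set ℕ := {n | d + 1 ≤ n ∧ Even (n * d)}

/-- The filter `n → ∞` along `{n : n ≥ d+1, nd even}`. -/
def goodFilter (d : ℕ) : Filter ℕ := Filter.atTop ⊓ Filter.principal (goodN d)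

/-! ### The embedding of invariant processes into rooted colored graphs -/

/-- The rooted colored graph `(T_d, x, o)` associated to a coloring `x` of `T_d` (the
canonical labeling of `T_d` is a breadth-first-search labeling; for an invariant process the
resulting law is that of the randomly labeled rooted colored graph). -/
def iotaTd (d : ℕ) (x : TdVertex d → M) : RCG M where
  col l := if h : ValidTd d l then some (x ⟨l, h⟩) else none
  adj p :=
    if (ValidTd d p.1 ∧ ValidTd d p.2 ∧ ((∃ i, p.2 = i :: p.1) ∨ (∃ i, p.1 = i :: p.2)))
    then true else false

/-- The law, as a probability measure on rooted colored graphs, of the randomly labeled rooted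
colored tree `(T_d, X, o)` where `X` has law `μ`. -/
def lawTd (d : ℕ) [MeasurableSpace M] (μ : Measure (TdVertex d → M)) : Measure (RCG M) :=
  μ.map (iotaTd d)

/-! ### Micro-state (sofic) entropy -/

/-- `𝓕_G(μ,r,ε)`: the set of colorings `f` of `G` whose radius-`r` local statistics are
`ε`-close (in the Lévy-Prokhorov distance, which generates the weak topology) to the
radius-`r` restriction of `μ`. -/
def FSet (d : ℕ) [MeasurableSpace M] (μ : Measure (TdVertex d → M)) (r : ℕ) (ε : ℝ)
    (G : SimpleGraph (Fin n)) : Set (Fin n → M) :=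
  {f | levyProkhorovDist ((distrG G f).map (resS r)) ((lawTd d μ).map (resS r)) ≤ ε}

/-- `H_{G}(μ,r,ε) = (1/n) log |𝓕_G(μ,r,ε)| ∈ {-∞} ∪ [0,∞)`. -/
def HG (d : ℕ) [MeasurableSpace M] (μ : Measure (TdVertex d → M)) (r : ℕ) (ε : ℝ)
    (G : SimpleGraph (Fin n)) : EReal :=
  if FSet d μ r ε G = ∅ then ⊥
  else ((Real.log ((FSet d μ r ε G).ncard) / n : ℝ) : EReal)

/-- `h_n(μ,r,ε,α)`: the `α`-quantile
`sup { h ∈ {-∞} ∪ [0,∞) : ℙ(H_{G_n}(μ,r,ε) ≥ h) ≥ α }`. -/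
def hquant (d : ℕ) [MeasurableSpace M] (μ : Measure (TdVertex d → M)) (r : ℕ) (ε : ℝ)
    (α : ℝ) (n : ℕ) : EReal :=
  sSup {h : EReal | (h = ⊥ ∨ 0 ≤ h) ∧
    α ≤ PrG d n {G : SimpleGraph (Fin n) | h ≤ HG d μ r ε G}}

/-- The upper entropy `h̄(μ,r,α) = lim_{ε → 0} limsup_n h_n(μ,r,ε,α)` (the limit over `ε`
of a quantity non-decreasing in `ε`, i.e. the infimum over `ε > 0`). -/
def hbarA (d : ℕ) [MeasurableSpace M] (μ : Measure (TdVertex d → M)) (r : ℕ) (α : ℝ) :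
    EReal :=
  ⨅ ε : {e : ℝ // 0 < e}, (goodFilter d).limsup (fun n => hquant d μ r ε.1 α n)

/-- The lower entropy `h̲(μ,r,α) = lim_{ε → 0} liminf_n h_n(μ,r,ε,α)`. -/
def hlowA (d : ℕ) [MeasurableSpace M] (μ : Measure (TdVertex d → M)) (r : ℕ) (α : ℝ) :
    EReal :=
  ⨅ ε : {e : ℝ // 0 < e}, (goodFilter d).liminf (fun n => hquant d μ r ε.1 α n)

/-- `h̄(μ,r)`: the common value of `h̄(μ,r,α)`, `0 < α < 1`. -/
def hbarR (d : ℕ) [MeasurableSpace M] (μ : Measure (TdVertex d → M)) (r : ℕ) : EReal :=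
  hbarA d μ r (1 / 2)

/-- `h̲(μ,r)`: the common value of `h̲(μ,r,α)`, `0 < α < 1`. -/
def hlowR (d : ℕ) [MeasurableSpace M] (μ : Measure (TdVertex d → M)) (r : ℕ) : EReal :=
  hlowA d μ r (1 / 2)

/-- The upper sofic entropy `h̄(μ) = lim_{r → ∞} h̄(μ,r)` (the limit of a non-increasing
sequence, i.e. the infimum over `r`). -/
def hbar (d : ℕ) [MeasurableSpace M] (μ : Measure (TdVertex d → M)) : EReal :=
  ⨅ r : ℕ, hbarR d μ r

/-- The lower sofic entropy `h̲(μ) = lim_{r → ∞} h̲(μ,r)`. -/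
def hlow (d : ℕ) [MeasurableSpace M] (μ : Measure (TdVertex d → M)) : EReal :=
  ⨅ r : ℕ, hlowR d μ r

/-! ### Typical processes -/

/-- The probability that the random `d`-regular graph `G_n` admits a coloring whose local
statistics are `ε`-close to `μ`. -/
def typicalPr (d : ℕ) [MeasurableSpace M] (μ : Measure (TdVertex d → M)) (ε : ℝ) (n : ℕ) :
    ℝ :=
  PrG d n {G : SimpleGraph (Fin n) |
    ∃ f : Fin n → M, levyProkhorovDist (distrG G f) (lawTd d μ) ≤ ε}

/-- `μ ∈ I_d(M)` is weakly typical if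
`lim_{ε → 0} limsup_{n → ∞} ℙ(∃ f : d(distr_{G_n}(f), μ) ≤ ε) = 1`. -/
def WeaklyTypical (d : ℕ) [MeasurableSpace M] (μ : Measure (TdVertex d → M)) : Prop :=
  Tendsto (fun ε => (goodFilter d).limsup (fun n => typicalPr d μ ε n))
    (nhdsWithin 0 (Set.Ioi 0)) (nhds 1)

/-- `μ ∈ I_d(M)` is strongly typical if
`lim_{ε → 0} lim_{n → ∞} ℙ(∃ f : d(distr_{G_n}(f), μ) ≤ ε) = 1` (in particular the inner
limits along `n → ∞` exist). -/
def StronglyTypical (d : ℕ) [MeasurableSpace M] (μ : Measure (TdVertex d → M)) : Prop :=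
  ∃ L : ℝ → ℝ,
    (∀ ε : ℝ, 0 < ε → Tendsto (fun n => typicalPr d μ ε n) (goodFilter d) (nhds (L ε))) ∧
    Tendsto L (nhdsWithin 0 (Set.Ioi 0)) (nhds 1)


/-! ### Processes on balls of `T_d` and the sets `I_{d,r}(M)`, `I_e(M)` -/

/-- The ball `S_r` of `T_d` as an induced subgraph. -/
def SrGraph (d r : ℕ) : SimpleGraph ↥(SrSet d r) := (TdGraph d).induce (SrSet d r)

/-- The set `E_r` of `T_d` as an induced subgraph. -/
def ErGraph (d r : ℕ) : SimpleGraph ↥(ErSet d r) := (TdGraph d).induce (ErSet d r)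

lemma root_mem_Er (d r : ℕ) (hr : 1 ≤ r) : rootTd d ∈ ErSet d r := by
  left; simpa [rootTd] using hr

lemma node1_mem_Er (d r : ℕ) (hr : 1 ≤ r) : node1 d ∈ ErSet d r := by
  by_cases h : 1 ≤ d
  · right
    constructor <;> simp [node1, h, List.getLast?, hr]
  · simpa [node1, h] using root_mem_Er d r hr

variable {M : Type*}

/-- The restriction to `E_r ⊆ S_r` of a probability measure on `M^{S_r}`. -/
def restrictErOfSr [MeasurableSpace M] (d r : ℕ) (p : Measure (↥(SrSet d r) → M)) :
    Measure (↥(ErSet d r) → M) :=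
  p.map (fun x => fun v : ↥(ErSet d r) => x ⟨v.1, ErSet_subset_SrSet d r v.2⟩)

/-- `I_{d,r}(M)`: the set of probability measures on `M^{S_r}` which are invariant under the
automorphisms of `S_r` and whose restriction to `E_r` is invariant under switching the two
sides of the edge `{o,1}`. -/
def IdrMeas (d r : ℕ) (M : Type*) [MeasurableSpace M] :
    Set (Measure (↥(SrSet d r) → M)) :=
  {p | IsProbabilityMeasure p ∧
    (∀ φ : SrGraph d r ≃g SrGraph d r, p.map (fun x => fun v => x (φ v)) = p) ∧
    (∀ ψ : ErGraph d r ≃g ErGraph d r,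
      (∀ hv : rootTd d ∈ ErSet d r, ((ψ ⟨rootTd d, hv⟩ : ↥(ErSet d r)) : TdVertex d) = node1 d) →
      (restrictErOfSr d r p).map (fun x => fun v => x (ψ v)) = restrictErOfSr d r p)}

/-- The annealed entropy `Σ(p) = H(X_{S_r}) - (d/2) H(X_{E_r})` of `p ∈ I_{d,r}(M)`. -/
def SigmaP [MeasurableSpace M] (d r : ℕ) (p : Measure (↥(SrSet d r) → M)) : ℝ :=
  shannon p - (d / 2 : ℝ) * shannon (restrictErOfSr d r p)

/-- The involution of `E_1 = {o, 1}` switching the two sides of the edge `{o,1}`. -/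
def swapE1 (d : ℕ) : ↥(ErSet d 1) → ↥(ErSet d 1) := fun v =>
  if (v : TdVertex d) = rootTd d then ⟨node1 d, node1_mem_Er d 1 le_rfl⟩
  else ⟨rootTd d, root_mem_Er d 1 le_rfl⟩

/-- `I_e(M)`: the set of probability measures on `M^{E_1}` invariant under switching the two
sides of the edge `{o,1}`. -/
def IeMeas (d : ℕ) (M : Type*) [MeasurableSpace M] : Set (Measure (↥(ErSet d 1) → M)) :=
  {p | IsProbabilityMeasure p ∧ p.map (fun x => fun v => x (swapE1 d v)) = p}

/-- The annealed entropy `Σ(p) = (d/2) H(X_{E_1}) - (d-1) H(X_o)` of `p ∈ I_e(M)`. -/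
def SigmaPe [MeasurableSpace M] (d : ℕ) (p : Measure (↥(ErSet d 1) → M)) : ℝ :=
  (d / 2 : ℝ) * shannon p
    - ((d : ℝ) - 1) * shannon (p.map (fun x => x ⟨rootTd d, root_mem_Er d 1 le_rfl⟩))

/-! ### Factor graphs: functions of rooted unlabeled colored graphs of radius `r` -/

/-- The vertex set of a rooted colored graph. -/
def vertsOf (g : RCG M) : Set (List ℕ) := {l | g.col l ≠ none}

/-- An isomorphism of rooted colored graphs (a color- and adjacency-preserving bijection of
the vertex sets mapping root to root). -/
def RCGRootedIso (g g' : RCG M) : Prop :=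
  ∃ e : ↥(vertsOf g) ≃ ↥(vertsOf g'),
    (∀ v, g'.col ((e v) : List ℕ) = g.col (v : List ℕ)) ∧
    (∀ v w, g'.adj (((e v) : List ℕ), ((e w) : List ℕ)) = g.adj ((v : List ℕ), (w : List ℕ))) ∧
    (∀ h : [] ∈ vertsOf g, ∀ _ : [] ∈ vertsOf g', ((e ⟨[], h⟩) : List ℕ) = [])

/-- A function on rooted unlabeled colored graphs of radius `r`: a function of rooted colored
graphs which only depends on the isomorphism class of the ball of radius `r` around the
root. -/
def IsRadiusRFn (r : ℕ) (ψ : RCG M → ℝ) : Prop :=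
  ∀ g g' : RCG M, RCGRootedIso (resS r g) (resS r g') → ψ g = ψ g'

/-- The value `ψ((G,f,v)_r)` of `ψ` at the rooted unlabeled colored graph given by the ball of
radius `r` around `v` in `(G,f)` (computed as the average over the random labelings, which is
the constant value of `ψ` on them when `ψ` is a function of the unlabeled graph). -/
def psiAt {n : ℕ} (G : SimpleGraph (Fin n)) (f : Fin n → M) (v : Fin n) (ψ : RCG M → ℝ) :
    ℝ :=
  ∫ g, ψ g ∂(distrAt G f v)

/-- The partition function `Z_G = ∑_f ∏_v exp(ψ((G,f,v)_r))` of the factor model `ψ`. -/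
def ZG {n : ℕ} [Fintype M] (G : SimpleGraph (Fin n)) (ψ : RCG M → ℝ) : ℝ :=
  ∑ f : Fin n → M, Real.exp (∑ v : Fin n, psiAt G f v ψ)

/-- The ground-state energy `L_G = max_f ∑_v ψ((G,f,v)_r)`. -/
def LG {n : ℕ} (G : SimpleGraph (Fin n)) (ψ : RCG M → ℝ) : ℝ :=
  sSup {x : ℝ | ∃ f : Fin n → M, x = ∑ v : Fin n, psiAt G f v ψ}

/-- The canonical rooted colored graph associated to a coloring of the ball `S_r` of `T_d`. -/
def iotaSr (d r : ℕ) (x : ↥(SrSet d r) → M) : RCG M where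
  col l := if h : ValidTd d l ∧ l.length ≤ r then some (x ⟨⟨l, h.1⟩, h.2⟩) else none
  adj p := if (ValidTd d p.1 ∧ ValidTd d p.2 ∧ p.1.length ≤ r ∧ p.2.length ≤ r ∧
      ((∃ i, p.2 = i :: p.1) ∨ (∃ i, p.1 = i :: p.2))) then true else false

/-- `⟨p, ψ⟩ = E[ψ(X)]` where `X` has law `p ∈ I_{d,r}(M)`. -/
def pairing [MeasurableSpace M] (d r : ℕ) (p : Measure (↥(SrSet d r) → M))
    (ψ : RCG M → ℝ) : ℝ :=
  ∫ x, ψ (iotaSr d r x) ∂p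

/-! ### Annealed quantities for random regular graphs -/

/-- `log` with the convention `log 0 = -∞`, with values in the extended reals. -/
def elog (x : ℝ) : EReal := if x ≤ 0 then ⊥ else ((Real.log x : ℝ) : EReal)

/-- The set `𝓖_n(μ,r,ε)` of pairs `(G,f)` of a `d`-regular graph together with a coloring
whose radius-`r` local statistics are `ε`-close to `μ_r`. -/
def GnPairs (d : ℕ) [MeasurableSpace M] (μ : Measure (TdVertex d → M)) (r : ℕ) (ε : ℝ)
    (n : ℕ) : Set (SimpleGraph (Fin n) × (Fin n → M)) :=
  {Gf | Gf.1 ∈ regularGraphs d n ∧ Gf.2 ∈ FSet d μ r ε Gf.1}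

/-- The annealed entropy
`Σ_n(μ,r,ε) = (1/n) (log |𝓖_n(μ,r,ε)| - log |𝓖_n(d)|) = (1/n) log E |𝓕_{G_n}(μ,r,ε)|`. -/
def SigmaN (d : ℕ) [MeasurableSpace M] (μ : Measure (TdVertex d → M)) (r : ℕ) (ε : ℝ)
    (n : ℕ) : EReal :=
  (((n : ℝ)⁻¹ : ℝ) : EReal) *
    elog (((GnPairs d μ r ε n).ncard : ℝ) / ((regularGraphs d n).ncard : ℝ))

/-- The relaxed partition function `Z_G(β) = ∑_f exp(-nβ d(distr_G(f)_r, μ_r))`. -/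
def ZGbeta (d : ℕ) [MeasurableSpace M] {n : ℕ} [Fintype M] (μ : Measure (TdVertex d → M))
    (r : ℕ) (β : ℝ) (G : SimpleGraph (Fin n)) : ℝ :=
  ∑ f : Fin n → M, Real.exp (-(n : ℝ) * β *
    levyProkhorovDist ((distrG G f).map (resS r)) ((lawTd d μ).map (resS r)))


/-! ### Processes on unimodular Galton-Watson trees

A colored rooted tree `(T, X, o)` with `T` a subtree of the label set, rooted at `[]` and
with the children of a vertex `v` labeled `1 :: v, …, N_v :: v`, is encoded as a rooted
colored graph in `RCG M`. -/

/-- `g` is a canonically labeled colored rooted tree. -/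
def IsCanonTree (g : RCG M) : Prop :=
  g.col [] ≠ none ∧
  (∀ l : List ℕ, g.col l ≠ none → g.col l.tail ≠ none) ∧
  (∀ (v : List ℕ) (i : ℕ), 1 ≤ i → g.col ((i + 1) :: v) ≠ none → g.col (i :: v) ≠ none) ∧
  (∀ v : List ℕ, g.col (0 :: v) = none) ∧
  (∀ p : List ℕ × List ℕ, g.adj p = true ↔
    (g.col p.1 ≠ none ∧ g.col p.2 ≠ none ∧
      ((∃ i, p.2 = i :: p.1) ∨ (∃ i, p.1 = i :: p.2))))

/-- A finite canonically labeled tree. -/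
def IsFinTree (t : Finset (List ℕ)) : Prop :=
  [] ∈ t ∧ (∀ l ∈ t, l.tail ∈ t) ∧
  (∀ (v : List ℕ) (i : ℕ), 1 ≤ i → ((i + 1) :: v) ∈ t → (i :: v) ∈ t) ∧
  (∀ v : List ℕ, (0 :: v) ∉ t)

/-- The number of children of the vertex `v` in the finite tree `t`. -/
def childCountF (t : Finset (List ℕ)) (v : List ℕ) : ℕ :=
  (t.filter (fun w => w ≠ [] ∧ w.tail = v)).card

/-- The size-biased version `π̂(k) = (k+1) π(k+1) / d` of the offspring distribution `π`. -/
def sizeBiased (π : ℕ → ℝ) (dd : ℝ) (k : ℕ) : ℝ := (k + 1 : ℝ) * π (k + 1) / dd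

/-- The probability that the unimodular Galton-Watson tree with degree distribution `π`,
truncated at depth `k`, equals the finite tree `t`. -/
def treeWeight (π : ℕ → ℝ) (dd : ℝ) (k : ℕ) (t : Finset (List ℕ)) : ℝ :=
  π (childCountF t []) *
    ∏ v ∈ t.filter (fun v => v ≠ [] ∧ v.length < k), sizeBiased π dd (childCountF t v)

/-- The law of the underlying tree is the unimodular Galton-Watson law `UGW(π)`:
all finite-depth truncations have the prescribed distribution. -/
def IsUGWTreeLaw (π : ℕ → ℝ) (dd : ℝ) (μ : Measure (RCG M)) : Prop :=
  ∀ (k : ℕ) (t : Finset (List ℕ)), IsFinTree t → (∀ v ∈ t, v.length ≤ k) →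
    (μ {g | ∀ l : List ℕ, l.length ≤ k → (g.col l ≠ none ↔ l ∈ t)}).toReal
      = treeWeight π dd k t

/-- `e` realizes an isomorphism (not necessarily root-preserving) of the colored graphs `g`
and `g'`. -/
def IsIsoVia (g g' : RCG M) (e : List ℕ → List ℕ) : Prop :=
  Set.BijOn e (vertsOf g) (vertsOf g') ∧
  (∀ l ∈ vertsOf g, g'.col (e l) = g.col l) ∧
  (∀ l ∈ vertsOf g, ∀ l' ∈ vertsOf g, g'.adj (e l, e l') = g.adj (l, l'))

/-- A function on doubly rooted colored graphs, invariant under isomorphisms. -/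
def PairInvariant (F : RCG M → List ℕ → List ℕ → ℝ≥0∞) : Prop :=
  ∀ g g' e, IsIsoVia g g' e → ∀ u ∈ vertsOf g, ∀ v ∈ vertsOf g, F g' (e u) (e v) = F g u v

/-- Unimodularity (the mass-transport principle):
`E ∑_v F(G,o,v) = E ∑_v F(G,v,o)` for all isomorphism-invariant `F ≥ 0`. -/
def Unimodular (μ : Measure (RCG M)) : Prop :=
  ∀ F : RCG M → List ℕ → List ℕ → ℝ≥0∞, PairInvariant F →
    ∫⁻ g, (∑' v : ↥(vertsOf g), F g [] (v : List ℕ)) ∂μ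
      = ∫⁻ g, (∑' v : ↥(vertsOf g), F g (v : List ℕ) []) ∂μ

/-- `I_π(M)`: the laws of invariant (unimodular) processes `(T,X)` with colors in `M` over
the unimodular Galton-Watson tree with degree distribution `π` (of mean `dd`). -/
def IPiMeas (π : ℕ → ℝ) (dd : ℝ) (M : Type*) [MeasurableSpace M] :
    Set (Measure (RCG M)) :=
  {μ | IsProbabilityMeasure μ ∧ μ {g | IsCanonTree g} = 1 ∧ Unimodular μ ∧
    IsUGWTreeLaw π dd μ}

/-- The root degree `deg(o)` of a canonically labeled tree (the number of children of the
root). -/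
def rootDeg (g : RCG M) : ℕ := {i : ℕ | g.col [i] ≠ none}.ncard

/-- The edge-biased law `→μ(⬝) = (1/d) E[deg(o) 1{(T,X,(o,1)) ∈ ⬝}]` on colored edge-rooted
trees (the root edge being `([], [1])`). -/
def vecLaw (dd : ℝ) [MeasurableSpace M] (μ : Measure (RCG M)) : Measure (RCG M) :=
  (ENNReal.ofReal dd)⁻¹ • μ.withDensity (fun g => (rootDeg g : ℝ≥0∞))

/-- Membership in `E_r = B_{r-1}({o,1})` for a vertex of a canonically labeled tree. -/
def inErL (r : ℕ) (l : List ℕ) : Prop :=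
  l.length + 1 ≤ r ∨ (l.getLast? = some 1 ∧ l.length ≤ r)

/-- The restriction of a colored edge-rooted tree to `E_r = B_{r-1}({o,1})`. -/
def resE (r : ℕ) (g : RCG M) : RCG M where
  col l := if inErL r l then g.col l else none
  adj p := if inErL r p.1 ∧ inErL r p.2 then g.adj p else false

/-- The Shannon entropy `H(π)` of the probability mass function `π`. -/
def Hpmf (π : ℕ → ℝ) : ℝ := ∑' k : ℕ, Real.negMulLog (π k)

/-- The annealed entropy `Σ_r(μ) = H(X_{S_r}) - (d/2) H(→X_{E_r}) - H(π)` of an invariant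
process over the unimodular Galton-Watson tree. -/
def SigmaUGW (π : ℕ → ℝ) (dd : ℝ) [MeasurableSpace M] (r : ℕ) (μ : Measure (RCG M)) : ℝ :=
  shannon (μ.map (resS r)) - (dd / 2) * shannon ((vecLaw dd μ).map (resE r)) - Hpmf π

/-- `Σ(μ) = lim_{r → ∞} Σ_r(μ)` (the limit of a non-increasing sequence). -/
def SigmaUGWInf (π : ℕ → ℝ) (dd : ℝ) [MeasurableSpace M] (μ : Measure (RCG M)) : EReal :=
  ⨅ r : ℕ, ((SigmaUGW π dd (r + 1) μ : ℝ) : EReal)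

/-- `Σ_e(X) = (d/2) H(→X_{E_1}) - d H(→X_o) + H(X_o) - H(π)`. -/
def SigmaEUGW (π : ℕ → ℝ) (dd : ℝ) [MeasurableSpace M] (μ : Measure (RCG M)) : ℝ :=
  (dd / 2) * shannon ((vecLaw dd μ).map (resE 1))
    - dd * shannon ((vecLaw dd μ).map (resS 0))
    + shannon (μ.map (resS 0)) - Hpmf π

/-! ### Markov processes on random trees -/

/-- The side of the (potential) edge `{u,w}` containing `u`, among the labels. -/
def sideL (u w : List ℕ) : Set (List ℕ) := {v | treeDist v u < treeDist v w}

/-- `B_{r-1}({u,w})` among the labels. -/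
def edgeBallL (r : ℕ) (u w : List ℕ) : Set (List ℕ) :=
  {v | treeDist v u + 1 ≤ r ∨ treeDist v w + 1 ≤ r}

/-- The event that the tree structure agrees with that of `y` on `S` and that the colored
tree agrees with `y` on `B`. -/
def treeCylEvent (S B : Set (List ℕ)) (y : RCG M) : Set (RCG M) :=
  {g | (∀ l ∈ S, (g.col l ≠ none ↔ y.col l ≠ none)) ∧ (∀ l ∈ B, g.col l = y.col l)}

/-- A random colored tree is `r`-Markov on the ambient set `A` if, conditioned on the tree
and on the value on the `(r-1)`-neighborhood of an edge, the processes on the two sides of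
the edge are independent (conditioning on the tree is expressed through arbitrary finite
windows `S`). -/
def rMarkovTreeOn [MeasurableSpace M] (r : ℕ) (A : Set (List ℕ)) (μ : Measure (RCG M)) :
    Prop :=
  ∀ (u : List ℕ) (i : ℕ), 1 ≤ i → u ∈ A → (i :: u) ∈ A →
    ∀ F₁ F₂ : Finset (List ℕ), ↑F₁ ⊆ sideL u (i :: u) ∩ A → ↑F₂ ⊆ sideL (i :: u) u ∩ A →
    ∀ S : Finset (List ℕ), ↑S ⊆ A → ∀ y : RCG M,
      μ (treeCylEvent ↑S (edgeBallL r u (i :: u) ∩ A) y ∩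
          treeCylEvent ∅ ↑F₁ y ∩ treeCylEvent ∅ ↑F₂ y)
        * μ (treeCylEvent ↑S (edgeBallL r u (i :: u) ∩ A) y)
      = μ (treeCylEvent ↑S (edgeBallL r u (i :: u) ∩ A) y ∩ treeCylEvent ∅ ↑F₁ y)
        * μ (treeCylEvent ↑S (edgeBallL r u (i :: u) ∩ A) y ∩ treeCylEvent ∅ ↑F₂ y)

/-- A random colored tree is `r`-Markov if the above holds with ambient set everything. -/
def rMarkovTree [MeasurableSpace M] (r : ℕ) (μ : Measure (RCG M)) : Prop :=
  rMarkovTreeOn r Set.univ μ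

/-- A random colored tree is vertex-Markov on the ambient set `A` if, conditioned on the tree
and on the value at a vertex, the processes on the pending subtrees of that vertex are
independent. -/
def vertexMarkovTreeOn [MeasurableSpace M] (A : Set (List ℕ)) (μ : Measure (RCG M)) :
    Prop :=
  ∀ v ∈ A, ∀ (k : ℕ) (u : Fin k → List ℕ), Function.Injective u →
    (∀ j, u j ∈ A ∧ ((∃ i, 1 ≤ i ∧ u j = i :: v) ∨ (v ≠ [] ∧ u j = v.tail))) →
    ∀ F : Fin k → Finset (List ℕ), (∀ j, ↑(F j) ⊆ sideL (u j) v ∩ A) →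
    ∀ S : Finset (List ℕ), ↑S ⊆ A → ∀ y : RCG M,
      μ (treeCylEvent ↑S {v} y ∩ ⋂ j, treeCylEvent ∅ ↑(F j) y)
          * (μ (treeCylEvent ↑S {v} y)) ^ (k - 1)
        = ∏ j : Fin k, μ (treeCylEvent ↑S {v} y ∩ treeCylEvent ∅ ↑(F j) y)

/-- A random colored tree is vertex-Markov if the above holds with ambient set everything. -/
def vertexMarkovTree [MeasurableSpace M] (μ : Measure (RCG M)) : Prop :=
  vertexMarkovTreeOn Set.univ μ

/-! ### Random graphs with given degree sequences -/

/-- The set of simple graphs on `{1,…,n}` with degree sequence `dn`. -/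
def degSeqGraphs (n : ℕ) (dn : Fin n → ℕ) : Set (SimpleGraph (Fin n)) :=
  {G | ∀ v, (G.neighborSet v).ncard = dn v}

/-- The probability that a uniform random graph with degree sequence `dn` lies in `A`. -/
def PrD (n : ℕ) (dn : Fin n → ℕ) (A : Set (SimpleGraph (Fin n))) : ℝ :=
  ((degSeqGraphs n dn ∩ A).ncard : ℝ) / ((degSeqGraphs n dn).ncard : ℝ)

/-- `𝓕_G(μ,r,ε)` for a process `μ` over a unimodular Galton-Watson tree. -/
def FSetD [MeasurableSpace M] (μ : Measure (RCG M)) (r : ℕ) (ε : ℝ) {n : ℕ}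
    (G : SimpleGraph (Fin n)) : Set (Fin n → M) :=
  {f | levyProkhorovDist ((distrG G f).map (resS r)) (μ.map (resS r)) ≤ ε}

/-- `H_G(μ,r,ε) = (1/n) log |𝓕_G(μ,r,ε)|`. -/
def HGD [MeasurableSpace M] (μ : Measure (RCG M)) (r : ℕ) (ε : ℝ) {n : ℕ}
    (G : SimpleGraph (Fin n)) : EReal :=
  if FSetD μ r ε G = ∅ then ⊥
  else ((Real.log ((FSetD μ r ε G).ncard) / n : ℝ) : EReal)

/-- The `α`-quantile of `H_{G_n}(μ,r,ε)` for the uniform random graph with degree sequence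
`DN n`. -/
def hquantD [MeasurableSpace M] (DN : (n : ℕ) → Fin n → ℕ) (μ : Measure (RCG M)) (r : ℕ)
    (ε : ℝ) (α : ℝ) (n : ℕ) : EReal :=
  sSup {h : EReal | (h = ⊥ ∨ 0 ≤ h) ∧
    α ≤ PrD n (DN n) {G : SimpleGraph (Fin n) | h ≤ HGD μ r ε G}}

/-- `h̄(μ,r,α)` for the degree-sequence ensemble. -/
def hbarAD [MeasurableSpace M] (DN : (n : ℕ) → Fin n → ℕ) (μ : Measure (RCG M)) (r : ℕ)
    (α : ℝ) : EReal :=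
  ⨅ ε : {e : ℝ // 0 < e}, Filter.atTop.limsup (fun n => hquantD DN μ r ε.1 α n)

/-- `h̲(μ,r,α)` for the degree-sequence ensemble. -/
def hlowAD [MeasurableSpace M] (DN : (n : ℕ) → Fin n → ℕ) (μ : Measure (RCG M)) (r : ℕ)
    (α : ℝ) : EReal :=
  ⨅ ε : {e : ℝ // 0 < e}, Filter.atTop.liminf (fun n => hquantD DN μ r ε.1 α n)

/-- `h̄(μ,r)`: the common value of `h̄(μ,r,α)`, `0 < α < 1`. -/
def hbarRD [MeasurableSpace M] (DN : (n : ℕ) → Fin n → ℕ) (μ : Measure (RCG M)) (r : ℕ) :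
    EReal :=
  hbarAD DN μ r (1 / 2)

/-- `h̲(μ,r)`. -/
def hlowRD [MeasurableSpace M] (DN : (n : ℕ) → Fin n → ℕ) (μ : Measure (RCG M)) (r : ℕ) :
    EReal :=
  hlowAD DN μ r (1 / 2)

/-- The upper sofic entropy `h̄(μ) = lim_{r → ∞} h̄(μ,r)`. -/
def hbarD [MeasurableSpace M] (DN : (n : ℕ) → Fin n → ℕ) (μ : Measure (RCG M)) : EReal :=
  ⨅ r : ℕ, hbarRD DN μ r

/-- The lower sofic entropy `h̲(μ) = lim_{r → ∞} h̲(μ,r)`. -/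
def hlowD [MeasurableSpace M] (DN : (n : ℕ) → Fin n → ℕ) (μ : Measure (RCG M)) : EReal :=
  ⨅ r : ℕ, hlowRD DN μ r

/-- The hypotheses on the degree sequences: uniformly bounded by `Δ`, even sums, and
empirical distributions converging (weakly) to `π`. -/
def GoodDegSeq (π : ℕ → ℝ) (Δ : ℝ) (DN : (n : ℕ) → Fin n → ℕ) : Prop :=
  (∀ n v, (DN n v : ℝ) ≤ Δ) ∧ (∀ n, Even (∑ v : Fin n, DN n v)) ∧
  (∀ k : ℕ, Tendsto (fun n => (((Finset.univ.filter (fun v : Fin n => DN n v = k)).card : ℝ) / n))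
    atTop (nhds (π k)))

/-- The hypotheses on the degree distribution `π`: a probability mass function supported in
`{0,…,Δ}` with mean `dd > 0`. -/
def GoodPmf (π : ℕ → ℝ) (Δ : ℝ) (dd : ℝ) : Prop :=
  (∀ k, 0 ≤ π k) ∧ (∑' k : ℕ, π k) = 1 ∧ (∀ k : ℕ, (Δ : ℝ) < k → π k = 0) ∧
  (∑' k : ℕ, (k : ℝ) * π k) = dd ∧ 0 < dd


/-! ### Couplings -/

/-- `ν ∈ I_d(M × M)` is an invariant coupling of `μ` with itself: both coordinate marginal
processes of `ν` have law `μ`. -/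
def IsInvCoupling (d : ℕ) {M : Type*} [MeasurableSpace M] (μ : Measure (TdVertex d → M))
    (ν : Measure (TdVertex d → M × M)) : Prop :=
  ν ∈ InvMeas d (M × M) ∧ ν.map (fun x => fun v => (x v).1) = μ ∧
    ν.map (fun x => fun v => (x v).2) = μ

/-- The first coordinate marginal of a colored graph with colors in a product set. -/
def rcgFst {M₁ M₂ : Type*} (g : RCG (M₁ × M₂)) : RCG M₁ :=
  ⟨fun l => (g.col l).map Prod.fst, g.adj⟩

/-- The second coordinate marginal of a colored graph with colors in a product set. -/
def rcgSnd {M₁ M₂ : Type*} (g : RCG (M₁ × M₂)) : RCG M₂ :=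
  ⟨fun l => (g.col l).map Prod.snd, g.adj⟩

/-- `ν ∈ I_π(M × M)` is an invariant coupling of `μ ∈ I_π(M)` with itself. -/
def IsInvCouplingUGW (π : ℕ → ℝ) (dd : ℝ) {M : Type*} [MeasurableSpace M]
    (μ : Measure (RCG M)) (ν : Measure (RCG (M × M))) : Prop :=
  ν ∈ IPiMeas π dd (M × M) ∧ ν.map rcgFst = μ ∧ ν.map rcgSnd = μ


section

/-! ### Multisets indexed by `Fin m` -/

/-- The multiset of values of a tuple. -/
def symOf {α : Type*} {m : ℕ} (g : Fin m → α) : Sym α m :=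
  ⟨Finset.univ.val.map g, by simp⟩

lemma symOf_comp_perm {α : Type*} {m : ℕ} (g : Fin m → α) (s : Equiv.Perm (Fin m)) :
    symOf (g ∘ s) = symOf g := by
  apply Subtype.ext
  simp only [symOf]
  rw [← Multiset.map_map]
  congr 1
  exact (congrArg Finset.val (Finset.map_univ_equiv s) :)

lemma exists_perm_of_symOf_eq {α : Type*} {m : ℕ} {g g' : Fin m → α} (h : symOf g = symOf g') :
    ∃ s : Equiv.Perm (Fin m), ∀ i, g (s i) = g' i := by
  have h1 : Finset.univ.val.map g = Finset.univ.val.map g' := congrArg Subtype.val h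
  have h2 : ∀ a, Fintype.card {i // g' i = a} = Fintype.card {i // g i = a} := by
    intro a
    have := congrArg (Multiset.count a) h1
    rw [Multiset.count_map, Multiset.count_map] at this
    rw [Fintype.card_subtype, Fintype.card_subtype, Finset.card_def, Finset.card_def,
      Finset.filter_val, Finset.filter_val]
    simpa [eq_comm] using this.symm
  have e := fun a => (Fintype.card_eq.1 (h2 a)).some
  refine ⟨(Equiv.sigmaFiberEquiv g').symm.trans
    ((Equiv.sigmaCongrRight e).trans (Equiv.sigmaFiberEquiv g)), fun i => ?_⟩
  simp only [Equiv.trans_apply]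
  exact (e (g' i) ⟨i, rfl⟩).2

lemma symOf_surjective {α : Type*} {m : ℕ} : Function.Surjective (symOf (α := α) (m := m)) := by
  rintro ⟨s, hs⟩
  subst hs
  refine Quotient.inductionOn s fun l => ?_
  refine ⟨fun i => l.get (i.cast (by simp)), Subtype.ext ?_⟩
  simp only [symOf]
  have : (Finset.univ : Finset (Fin l.length)).val.map l.get = (l : Multiset α) := by
    rw [show (Finset.univ : Finset (Fin l.length)).val = (List.finRange l.length : Multiset _)
      from rfl, Multiset.map_coe]
    congr 1
    rw [← List.ofFn_eq_map]
    exact List.ofFn_get l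
  exact this

lemma exists_perm_comp {V : Type*} {m : ℕ} {f g : Fin m → V} (hf : Function.Injective f)
    (h : ∀ i, ∃ j, f i = g j) : ∃ s : Equiv.Perm (Fin m), ∀ i, f i = g (s i) := by
  choose s hs using h
  have hi : Function.Injective s := fun a b hab => hf (by rw [hs, hs, hab])
  exact ⟨Equiv.ofBijective s (Finite.injective_iff_bijective.1 hi), hs⟩

/-! ### Finite labelled trees and their unlabelled types -/

/-- Colored `D`-ary labelled trees of depth `k`. -/
def LTree (M : Type) (D : ℕ) : ℕ → Type
  | 0 => M
  | (k + 1) => M × (Fin D → LTree M D k)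

/-- Colored `D`-ary unlabelled trees of depth `k`. -/
def UTree (M : Type) (D : ℕ) : ℕ → Type
  | 0 => M
  | (k + 1) => M × Sym (UTree M D k) D

instance LTree.fintype (M : Type) [Fintype M] (D : ℕ) : ∀ k, Fintype (LTree M D k)
  | 0 => inferInstanceAs (Fintype M)
  | (k + 1) =>
    haveI := LTree.fintype M D k
    inferInstanceAs (Fintype (M × (Fin D → LTree M D k)))

instance UTree.fintype (M : Type) [Fintype M] (D : ℕ) : ∀ k, Fintype (UTree M D k)
  | 0 => inferInstanceAs (Fintype M)
  | (k + 1) =>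
    haveI := UTree.fintype M D k
    inferInstanceAs (Fintype (M × Sym (UTree M D k) D))

variable {M : Type} {D : ℕ}

/-- Forgetting the labels. -/
def cl : ∀ k, LTree M D k → UTree M D k
  | 0, m => m
  | (k + 1), t => (t.1, symOf fun i => cl k (t.2 i))

/-- Truncation of labelled trees. -/
def trL : ∀ k, LTree M D (k + 1) → LTree M D k
  | 0, t => t.1
  | (k + 1), t => (t.1, fun i => trL k (t.2 i))

/-- Truncation of unlabelled trees. -/
def trU : ∀ k, UTree M D (k + 1) → UTree M D k
  | 0, t => t.1
  | (k + 1), t => (t.1, t.2.map (trU k))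

lemma map_symOf {α β : Type*} {m : ℕ} (f : α → β) (g : Fin m → α) :
    (symOf g).map f = symOf (f ∘ g) := by
  apply Subtype.ext
  simp only [symOf, Sym.map, Multiset.map_map]

lemma trU_cl : ∀ k (t : LTree M D (k + 1)), trU k (cl (k + 1) t) = cl k (trL k t)
  | 0, _ => rfl
  | (k + 1), t => by
    change (t.1, (symOf fun i => cl (k + 1) (t.2 i)).map (trU k)) =
      (t.1, symOf fun i => cl k (trL k (t.2 i)))
    rw [map_symOf]
    congr 2
    funext i
    exact trU_cl k (t.2 i)

lemma cl_surjective : ∀ k, Function.Surjective (cl (M := M) (D := D) k)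
  | 0 => fun m => ⟨m, rfl⟩
  | (k + 1) => by
    rintro ⟨m, s⟩
    obtain ⟨g, rfl⟩ := symOf_surjective s
    choose f hf using (cl_surjective k : Function.Surjective (cl (M := M) (D := D) k))
    refine ⟨(m, fun i => f (g i)), ?_⟩
    change (m, symOf fun i => cl k (f (g i))) = (m, symOf g)
    simp [hf]

variable (M D) in
/-- Colorings of the ball of radius `k + 1` in the `(D+1)`-regular tree. -/
abbrev LStar (k : ℕ) : Type := M × (Fin (D + 1) → LTree M D k)

variable (M D) in
/-- Colorings of the ball of radius `k + 1` up to relabelling of the branches. -/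
abbrev UStar (k : ℕ) : Type := M × (Fin (D + 1) → UTree M D k)

variable (M D) in
/-- Colorings of the ball of radius `k + 1` up to isomorphism. -/
abbrev TStar (k : ℕ) : Type := M × Sym (UTree M D k) (D + 1)

/-- The tree hanging from the root when the `i`-th branch is removed. -/
def rootSideL : ∀ k, LStar M D k → Fin (D + 1) → LTree M D k
  | 0, z, _ => z.1
  | (k + 1), z, i => (z.1, fun j => trL k (z.2 (i.succAbove j)))

/-- The unlabelled tree hanging from the root when the `i`-th branch is removed. -/
def rootSideU : ∀ k, UStar M D k → Fin (D + 1) → UTree M D k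
  | 0, z, _ => z.1
  | (k + 1), z, i => (z.1, symOf fun j => trU k (z.2 (i.succAbove j)))

/-- Forgetting the labels inside the branches. -/
def clStar {k : ℕ} (z : LStar M D k) : UStar M D k := (z.1, fun i => cl k (z.2 i))

/-- Forgetting the order of the branches. -/
def tyStar {k : ℕ} (s : UStar M D k) : TStar M D k := (s.1, symOf s.2)

lemma rootSideU_clStar : ∀ k (z : LStar M D k) (i : Fin (D + 1)),
    rootSideU k (clStar z) i = cl k (rootSideL k z i)
  | 0, _, _ => rfl
  | (k + 1), z, i => by
    change (z.1, symOf fun j => trU k (cl (k + 1) (z.2 (i.succAbove j)))) =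
      (z.1, symOf fun j => cl k (trL k (z.2 (i.succAbove j))))
    simp only [trU_cl]

/-- The type of the edge from the root to its `i`-th neighbor. -/
def edgeU {k : ℕ} (s : UStar M D k) (i : Fin (D + 1)) : UTree M D k × UTree M D k :=
  (rootSideU k s i, s.2 i)

/-- The number of edges of a given type at the root. -/
def edgeCount {k : ℕ} (s : UStar M D k) (e : UTree M D k × UTree M D k) : ℕ :=
  (Finset.univ.filter fun i => edgeU s i = e).card

lemma rootSideU_comp_perm : ∀ k (m : M) (g : Fin (D + 1) → UTree M D k)
    (s : Equiv.Perm (Fin (D + 1))) (i : Fin (D + 1)),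
    rootSideU k (m, g ∘ s) i = rootSideU k (m, g) (s i)
  | 0, _, _, _, _ => rfl
  | (k + 1), m, g, s, i => by
    obtain ⟨ρ, hρ⟩ := exists_perm_comp (f := fun j => s (i.succAbove j))
      (g := (s i).succAbove) (s.injective.comp Fin.succAbove_right_injective) (fun j => by
        obtain ⟨j', hj⟩ := Fin.exists_succAbove_eq (x := s (i.succAbove j)) (y := s i)
          (fun h => Fin.succAbove_ne i j (s.injective h))
        exact ⟨j', hj.symm⟩)
    change (m, symOf fun j => trU k (g (s (i.succAbove j)))) =
      (m, symOf fun j => trU k (g ((s i).succAbove j)))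
    rw [← symOf_comp_perm (fun j => trU k (g ((s i).succAbove j))) ρ]
    congr 2
    funext j
    simp only [Function.comp]
    rw [← hρ]

lemma edgeU_comp_perm {k : ℕ} (m : M) (g : Fin (D + 1) → UTree M D k)
    (s : Equiv.Perm (Fin (D + 1))) (i : Fin (D + 1)) :
    edgeU (m, g ∘ s) i = edgeU (m, g) (s i) :=
  Prod.ext (rootSideU_comp_perm k m g s i) rfl

lemma edgeCount_eq_of_tyStar_eq {k : ℕ} {s s' : UStar M D k} (h : tyStar s = tyStar s')
    (e : UTree M D k × UTree M D k) : edgeCount s e = edgeCount s' e := by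
  obtain ⟨m, g⟩ := s
  obtain ⟨m', g'⟩ := s'
  simp only [tyStar, Prod.mk.injEq] at h
  obtain ⟨rfl, h⟩ := h
  obtain ⟨ρ, hρ⟩ := exists_perm_of_symOf_eq h
  have hg : g' = g ∘ ρ := funext fun i => (hρ i).symm
  subst hg
  symm
  refine Finset.card_bij (fun i _ => ρ i) (fun i hi => ?_) (fun a _ b _ hab => ρ.injective hab)
    (fun i hi => ⟨ρ.symm i, ?_, by simp⟩)
  · rw [Finset.mem_filter] at hi ⊢
    exact ⟨Finset.mem_univ _, by rw [← hi.2, edgeU_comp_perm]⟩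
  · rw [Finset.mem_filter] at hi ⊢
    exact ⟨Finset.mem_univ _, by rw [← hi.2, edgeU_comp_perm, Equiv.apply_symm_apply]⟩

/-- The number of labelled representatives of an unlabelled tree. -/
def mult {k : ℕ} [Fintype M] (a : UTree M D k) : ℕ :=
  (Finset.univ.filter fun t : LTree M D k => cl k t = a).card

lemma mult_pos {k : ℕ} [Fintype M] (a : UTree M D k) : 0 < mult a := by
  obtain ⟨t, ht⟩ := cl_surjective k a
  exact Finset.card_pos.2 ⟨t, by simp [ht]⟩

end

/-! ### Counting colored perfect matchings -/

/-- The number of elements of `S` with color `e`. -/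
def fibCard {H E : Type*} (κ : H → E) (S : Finset H) (e : E) : ℕ :=
  (S.filter fun h => κ h = e).card

/-- The product of the factorials of the sizes of the color classes of `S`. -/
def fibProd {H E : Type*} [Fintype E] (κ : H → E) (S : Finset H) : ℕ :=
  ∏ e, (fibCard κ S e).factorial

lemma fibProd_erase {H E : Type*} [Fintype E] (κ : H → E) {S : Finset H} {h : H} (hh : h ∈ S) :
    fibProd κ S = fibCard κ S (κ h) * fibProd κ (S.erase h) := by
  have h1 : fibCard κ S (κ h) = fibCard κ (S.erase h) (κ h) + 1 := by
    unfold fibCard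
    rw [Finset.filter_erase, Finset.card_erase_add_one]
    simp [hh]
  have h2 : ∀ e, e ≠ κ h → fibCard κ S e = fibCard κ (S.erase h) e := by
    intro e he
    unfold fibCard
    rw [Finset.filter_erase, Finset.erase_eq_of_notMem]
    simp only [Finset.mem_filter, not_and]
    exact fun _ h => he h.symm
  unfold fibProd
  rw [← Finset.mul_prod_erase _ _ (Finset.mem_univ (κ h)),
    ← Finset.mul_prod_erase _ (fun e => (fibCard κ (S.erase h) e).factorial)
      (Finset.mem_univ (κ h)), h1, Nat.factorial_succ, ← mul_assoc]
  congr 1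
  exact Finset.prod_congr rfl fun e he => by rw [h2 e (Finset.ne_of_mem_erase he)]

/-- The perfect matchings of `S` that are compatible with the coloring `κ`. -/
def matchingsOn {H E : Type*} [Fintype H] (κ : H → E) (bar : E → E) (S : Finset H) :
    Finset (H → H) :=
  Finset.univ.filter fun π => (∀ h, π (π h) = h) ∧
    (∀ h ∈ S, π h ∈ S ∧ π h ≠ h ∧ κ (π h) = bar (κ h)) ∧ ∀ h, h ∉ S → π h = h

lemma mem_matchingsOn {H E : Type*} [Fintype H] {κ : H → E} {bar : E → E} {S : Finset H}
    {π : H → H} : π ∈ matchingsOn κ bar S ↔ (∀ h, π (π h) = h) ∧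
    (∀ h ∈ S, π h ∈ S ∧ π h ≠ h ∧ κ (π h) = bar (κ h)) ∧ ∀ h, h ∉ S → π h = h := by
  simp [matchingsOn]

lemma card_matchingsOn_fiber_le {H E : Type*} [Fintype H] (κ : H → E)
    (bar : E → E) (S : Finset H) (h h' : H) :
    ((matchingsOn κ bar S).filter fun π => π h = h').card ≤
      (matchingsOn κ bar ((S.erase h).erase h')).card := by
  refine Finset.card_le_card_of_injOn (fun π x => if x = h ∨ x = h' then x else π x) ?_ ?_
  · intro π hπ
    obtain ⟨hπ, hh⟩ := Finset.mem_filter.1 (Finset.mem_coe.1 hπ)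
    obtain ⟨h1, h2, h3⟩ := mem_matchingsOn.1 hπ
    have hh' : π h' = h := by rw [← hh, h1]
    refine Finset.mem_coe.2 (mem_matchingsOn.2 ⟨fun x => ?_, fun x hx => ?_, fun x hx => ?_⟩)
    · by_cases hx : x = h ∨ x = h'
      · simp [hx]
      · have : ¬ (π x = h ∨ π x = h') := by
          rintro (h4 | h4)
          · exact hx (Or.inr (by rw [← h1 x, h4, hh]))
          · exact hx (Or.inl (by rw [← h1 x, h4, hh']))
        simp [hx, this, h1]
    · simp only [Finset.mem_erase] at hx ⊢
      have hx' : ¬ (x = h ∨ x = h') := by tauto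
      have : ¬ (π x = h ∨ π x = h') := by
        rintro (h4 | h4)
        · exact hx' (Or.inr (by rw [← h1 x, h4, hh]))
        · exact hx' (Or.inl (by rw [← h1 x, h4, hh']))
      have := h2 x hx.2.2
      simp only [if_neg hx']
      tauto
    · by_cases hx' : x = h ∨ x = h'
      · simp [hx']
      · simp only [if_neg hx']
        apply h3
        simp only [Finset.mem_erase] at hx
        tauto
  · intro π hπ ρ hρ heq
    obtain ⟨hπ, hh⟩ := Finset.mem_filter.1 (Finset.mem_coe.1 hπ)
    obtain ⟨hρ, hh2⟩ := Finset.mem_filter.1 (Finset.mem_coe.1 hρ)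
    have h1 := (mem_matchingsOn.1 hπ).1
    have h2 := (mem_matchingsOn.1 hρ).1
    funext x
    have := congrFun heq x
    by_cases hx : x = h
    · rw [hx, hh, hh2]
    by_cases hx' : x = h'
    · rw [hx', ← hh, h1, hh, ← hh2, h2]
    simpa [hx, hx'] using this

lemma sq_card_matchingsOn_le {H E : Type*} [Fintype H] [Fintype E] (κ : H → E) (bar : E → E)
    (hbar : ∀ e, bar (bar e) = e) (S : Finset H) :
    (matchingsOn κ bar S).card ^ 2 ≤ fibProd κ S := by
  induction hm : S.card using Nat.strong_induction_on generalizing S with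
  | _ m ih =>
  rcases S.eq_empty_or_nonempty with rfl | ⟨h, hh⟩
  · have h1 : (matchingsOn κ bar ∅).card ≤ 1 := by
      refine Finset.card_le_one.2 fun π hπ ρ hρ => ?_
      funext x
      rw [(mem_matchingsOn.1 hπ).2.2 x (by simp), (mem_matchingsOn.1 hρ).2.2 x (by simp)]
    have h2 : fibProd κ ∅ = 1 := by simp [fibProd, fibCard]
    rw [h2]
    nlinarith
  rcases (matchingsOn κ bar S).eq_empty_or_nonempty with h0 | ⟨π₀, hπ₀⟩
  · simp [h0]
  set C := (S.erase h).filter fun h' => κ h' = bar (κ h) with hC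
  have hCe : ∀ h' ∈ C, C.card = fibCard κ (S.erase h) (κ h') := by
    intro h' hh'
    rw [(Finset.mem_filter.1 hh').2]
    rfl
  have hCle : C.card ≤ fibCard κ S (κ h) := by
    obtain ⟨h1, h2, -⟩ := mem_matchingsOn.1 hπ₀
    refine Finset.card_le_card_of_injOn π₀ (fun x hx => ?_) (fun x _ y _ hxy => ?_)
    · obtain ⟨hx1, hx2⟩ := Finset.mem_filter.1 (Finset.mem_coe.1 hx)
      have := h2 x (Finset.mem_of_mem_erase hx1)
      refine Finset.mem_coe.2 (Finset.mem_filter.2 ⟨this.1, ?_⟩)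
      rw [this.2.2, hx2, hbar]
    · rw [← h1 x, hxy, h1]
  have hsum : (matchingsOn κ bar S).card ≤
      ∑ h' ∈ C, (matchingsOn κ bar ((S.erase h).erase h')).card := by
    rw [Finset.card_eq_sum_card_fiberwise (f := fun π => π h) (t := C)]
    · exact Finset.sum_le_sum fun h' _ => card_matchingsOn_fiber_le κ bar S h h'
    · intro π hπ
      have := (mem_matchingsOn.1 (Finset.mem_coe.1 hπ)).2.1 h hh
      refine Finset.mem_coe.2 (Finset.mem_filter.2 ⟨Finset.mem_erase.2 ⟨this.2.1, this.1⟩, ?_⟩)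
      exact this.2.2
  have hterm : ∀ h' ∈ C, C.card * (matchingsOn κ bar ((S.erase h).erase h')).card ^ 2 ≤
      fibProd κ (S.erase h) := by
    intro h' hh'
    have hmem : h' ∈ S.erase h := (Finset.mem_filter.1 hh').1
    rw [fibProd_erase κ hmem, hCe h' hh']
    refine Nat.mul_le_mul_left _ (ih _ ?_ _ rfl)
    rw [← hm]
    exact (Finset.card_erase_lt_of_mem hmem).trans (Finset.card_erase_lt_of_mem hh)
  calc (matchingsOn κ bar S).card ^ 2
      ≤ (∑ h' ∈ C, (matchingsOn κ bar ((S.erase h).erase h')).card) ^ 2 := by gcongr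
    _ ≤ C.card * ∑ h' ∈ C, (matchingsOn κ bar ((S.erase h).erase h')).card ^ 2 :=
        sq_sum_le_card_mul_sum_sq
    _ = ∑ h' ∈ C, C.card * (matchingsOn κ bar ((S.erase h).erase h')).card ^ 2 :=
        Finset.mul_sum _ _ _
    _ ≤ ∑ _h' ∈ C, fibProd κ (S.erase h) := Finset.sum_le_sum hterm
    _ = C.card * fibProd κ (S.erase h) := by simp
    _ ≤ fibCard κ S (κ h) * fibProd κ (S.erase h) := Nat.mul_le_mul_right _ hCle
    _ = fibProd κ S := (fibProd_erase κ hh).symm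

lemma log_factorial_le {n : ℕ} (hn : 1 ≤ n) :
    Real.log n.factorial ≤ n * Real.log n - n + Real.log n + 1 := by
  induction n, hn using Nat.le_induction with
  | base => simp
  | succ n hn ih =>
    have h0 : (0:ℝ) < n := by exact_mod_cast hn
    have h1 : Real.log (n / (n + 1)) ≤ n / (n + 1) - 1 := Real.log_le_sub_one_of_pos (by positivity)
    rw [Real.log_div (by positivity) (by positivity)] at h1
    have h2 : (n / (n + 1) - 1 : ℝ) * (n + 1) = -1 := by field_simp; ring
    rw [Nat.factorial_succ, Nat.cast_mul, Real.log_mul (by positivity) (by positivity)]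
    push_cast
    nlinarith

lemma le_log_factorial {n : ℕ} (hn : 1 ≤ n) :
    n * Real.log n - n ≤ Real.log n.factorial := by
  induction n, hn using Nat.le_induction with
  | base => simp
  | succ n hn ih =>
    have h0 : (0:ℝ) < n := by exact_mod_cast hn
    have h1 : Real.log ((n + 1) / n) ≤ (n + 1) / n - 1 := Real.log_le_sub_one_of_pos (by positivity)
    rw [Real.log_div (by positivity) (by positivity)] at h1
    have h2 : ((n + 1) / n - 1 : ℝ) * n = 1 := by field_simp; ring
    rw [Nat.factorial_succ, Nat.cast_mul, Real.log_mul (by positivity) (by positivity)]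
    push_cast
    nlinarith

lemma log_card_matchingsOn_le {H E : Type*} [Fintype H] [Fintype E] (κ : H → E) (bar : E → E)
    (hbar : ∀ e, bar (bar e) = e) (hpos : 0 < (matchingsOn κ bar Finset.univ).card)
    (m : ℕ) (hm : Fintype.card H = m) (hm1 : 1 ≤ m) :
    Real.log (matchingsOn κ bar Finset.univ).card ≤ (m * Real.log m - m) / 2
      - m / 2 * ∑ e, Real.negMulLog (fibCard κ Finset.univ e / m)
      + Fintype.card E * (Real.log m + 1) / 2 := by
  have hm0 : (0:ℝ) < m := by exact_mod_cast hm1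
  have hlogm : 0 ≤ Real.log m := Real.log_natCast_nonneg m
  have hsum : ∑ e, (fibCard κ Finset.univ e : ℝ) = m := by
    rw [← hm, ← Finset.card_univ, Finset.card_eq_sum_card_fiberwise (f := κ) (t := Finset.univ)
      (by simp)]
    push_cast
    rfl
  have hle : ∀ e, fibCard κ Finset.univ e ≤ m := fun e => by
    rw [← hm]; exact Finset.card_le_univ _
  have h1 : 2 * Real.log (matchingsOn κ bar Finset.univ).card ≤
      ∑ e, Real.log ((fibCard κ Finset.univ e).factorial) := by
    have h := sq_card_matchingsOn_le κ bar hbar Finset.univ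
    have h' : ((matchingsOn κ bar Finset.univ).card : ℝ) ^ 2 ≤
        ∏ e, ((fibCard κ Finset.univ e).factorial : ℝ) := by
      unfold fibProd at h
      exact_mod_cast h
    have h3 := Real.log_le_log (by positivity) h'
    rw [Real.log_pow, Real.log_prod (fun e _ => by positivity)] at h3
    exact_mod_cast h3
  have h2 : ∀ e, Real.log ((fibCard κ Finset.univ e).factorial) ≤
      fibCard κ Finset.univ e * Real.log m - m * Real.negMulLog (fibCard κ Finset.univ e / m)
        - fibCard κ Finset.univ e + (Real.log m + 1) := by
    intro e
    rcases Nat.eq_zero_or_pos (fibCard κ Finset.univ e) with h0 | h0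
    · simp [h0]; linarith
    · have h3 := log_factorial_le h0
      have h5 : (0:ℝ) < fibCard κ Finset.univ e := by exact_mod_cast h0
      have h4 : Real.log (fibCard κ Finset.univ e) ≤ Real.log m :=
        Real.log_le_log h5 (by exact_mod_cast hle e)
      rw [Real.negMulLog, Real.log_div h5.ne' hm0.ne']
      have : (m:ℝ) * (-(fibCard κ Finset.univ e / m) *
          (Real.log (fibCard κ Finset.univ e) - Real.log m)) =
          - fibCard κ Finset.univ e * (Real.log (fibCard κ Finset.univ e) - Real.log m) := by
        field_simp
      rw [this]
      linarith
  have h3 := Finset.sum_le_sum fun e (_ : e ∈ Finset.univ) => h2 e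
  rw [Finset.sum_add_distrib, Finset.sum_sub_distrib, Finset.sum_sub_distrib, ← Finset.sum_mul,
    ← Finset.mul_sum, hsum, Finset.sum_const, Finset.card_univ, nsmul_eq_mul] at h3
  linarith

/-! ### A lower bound for the number of regular graphs -/

/-- The degree of a vertex. -/
def dg {n : ℕ} (G : SimpleGraph (Fin n)) (v : Fin n) : ℕ := (G.neighborSet v).ncard

lemma dg_eq_sum {n : ℕ} (G : SimpleGraph (Fin n)) (v : Fin n) :
    dg G v = ∑ w, if G.Adj v w then 1 else 0 := by
  rw [dg, Finset.sum_boole, Set.ncard_eq_toFinset_card']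
  simp only [Nat.cast_id]
  congr 1
  ext w
  simp

/-- Adding an edge to a graph. -/
def addE {n : ℕ} (G : SimpleGraph (Fin n)) (u v : Fin n) : SimpleGraph (Fin n) :=
  G ⊔ SimpleGraph.edge u v

lemma addE_adj {n : ℕ} (G : SimpleGraph (Fin n)) (u v a b : Fin n) :
    (addE G u v).Adj a b ↔ G.Adj a b ∨ ((a = u ∧ b = v ∨ a = v ∧ b = u) ∧ a ≠ b) := by
  simp only [addE, SimpleGraph.sup_adj, SimpleGraph.edge_adj]

lemma dg_addE {n : ℕ} {G : SimpleGraph (Fin n)} {u v : Fin n} (huv : u ≠ v)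
    (h : ¬ G.Adj u v) (w : Fin n) :
    dg (addE G u v) w = dg G w + (if w = u then 1 else 0) + (if w = v then 1 else 0) := by
  have key : ∀ b, (if (addE G u v).Adj w b then 1 else 0 : ℕ) =
      (if G.Adj w b then 1 else 0) + (if w = u then (if b = v then 1 else 0) else 0) +
        (if w = v then (if b = u then 1 else 0) else 0) := by
    intro b
    have h' : ¬ G.Adj v u := fun h2 => h h2.symm
    rw [if_congr (addE_adj G u v w b) rfl rfl]
    by_cases h1 : w = u
    · subst h1
      by_cases h2 : b = v
      · subst h2; simp [h, huv]
      · simp [h2, huv]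
    · by_cases h2 : w = v
      · subst h2
        by_cases h3 : b = u
        · subst h3; simp [h', huv.symm]
        · simp [h3, h1]
      · simp [h1, h2]
  rw [dg_eq_sum, dg_eq_sum, Finset.sum_congr rfl fun b _ => key b, Finset.sum_add_distrib,
    Finset.sum_add_distrib]
  congr 2
  · split_ifs <;> simp
  · split_ifs <;> simp

lemma addE_cancel {n : ℕ} {G G' : SimpleGraph (Fin n)} {u v : Fin n} (h : ¬ G.Adj u v)
    (h' : ¬ G'.Adj u v) (he : addE G u v = addE G' u v) : G = G' := by
  ext a b
  have h1 := congrArg (fun H : SimpleGraph (Fin n) => H.Adj a b) he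
  simp only [addE_adj, eq_iff_iff] at h1
  by_cases h2 : (a = u ∧ b = v ∨ a = v ∧ b = u)
  · rcases h2 with ⟨rfl, rfl⟩ | ⟨rfl, rfl⟩
    · simp [h, h']
    · have := fun h3 : G.Adj a b => h h3.symm
      have := fun h3 : G'.Adj a b => h' h3.symm
      tauto
  · tauto

lemma exists_addE {n : ℕ} {G : SimpleGraph (Fin n)} {x y : Fin n} (h : G.Adj x y) :
    ∃ G₀, ¬ G₀.Adj x y ∧ addE G₀ x y = G := by
  refine ⟨G.deleteEdges {s(x, y)}, by simp, ?_⟩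
  ext a b
  rw [addE_adj, SimpleGraph.deleteEdges_adj]
  simp only [Set.mem_singleton_iff, Sym2.eq, Sym2.rel_iff', Prod.mk.injEq, Prod.swap_prod_mk]
  constructor
  · rintro (h1 | ⟨⟨rfl, rfl⟩ | ⟨rfl, rfl⟩, -⟩)
    · exact h1.1
    · exact h
    · exact h.symm
  · intro h1
    have := h1.ne
    tauto

/-- The number of ways of assigning to each vertex distinct half-edges out of `d`
to its incident edges. -/
def wt {n : ℕ} (d : ℕ) (G : SimpleGraph (Fin n)) : ℕ := ∏ v, d.descFactorial (dg G v)

lemma wt_addE {n d : ℕ} {G : SimpleGraph (Fin n)} {u v : Fin n} (huv : u ≠ v)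
    (h : ¬ G.Adj u v) : wt d (addE G u v) = wt d G * ((d - dg G u) * (d - dg G v)) := by
  have h1 : ∀ w, d.descFactorial (dg (addE G u v) w) = d.descFactorial (dg G w) *
      ((if w = u then d - dg G u else 1) * (if w = v then d - dg G v else 1)) := by
    intro w
    rw [dg_addE huv h]
    by_cases h1 : w = u
    · subst h1; simp [huv, Nat.descFactorial_succ, mul_comm]
    · by_cases h2 : w = v
      · subst h2; simp [h1, Nat.descFactorial_succ, mul_comm]
      · simp [h1, h2]
  unfold wt
  rw [Finset.prod_congr rfl fun w _ => h1 w, Finset.prod_mul_distrib, Finset.prod_mul_distrib]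
  simp

lemma dg_le_of_wt {n d : ℕ} {G : SimpleGraph (Fin n)} (h : wt d G ≠ 0) (v : Fin n) :
    dg G v ≤ d := by
  by_contra hlt
  exact h (Finset.prod_eq_zero (Finset.mem_univ v)
    (Nat.descFactorial_eq_zero_iff_lt.2 (not_le.1 hlt)))

/-- The graphs with `i` edges. -/
def levelG (n i : ℕ) : Finset (SimpleGraph (Fin n)) :=
  Finset.univ.filter fun G => ∑ v, dg G v = 2 * i

lemma mem_levelG {n i : ℕ} {G : SimpleGraph (Fin n)} :
    G ∈ levelG n i ↔ ∑ v, dg G v = 2 * i := by simp [levelG]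

/-- The weighted number of graphs with `i` edges. -/
def zG (d n i : ℕ) : ℕ := ∑ G ∈ levelG n i, wt d G

lemma addE_mem_levelG {n i : ℕ} {G : SimpleGraph (Fin n)} {u v : Fin n} (huv : u ≠ v)
    (h : ¬ G.Adj u v) (hG : G ∈ levelG n i) : addE G u v ∈ levelG n (i + 1) := by
  rw [mem_levelG] at hG ⊢
  rw [Finset.sum_congr rfl fun w _ => dg_addE huv h w, Finset.sum_add_distrib,
    Finset.sum_add_distrib, hG]
  simp
  ring

lemma sum_free_eq {n d i N : ℕ} (hN : n * d = 2 * N) {G : SimpleGraph (Fin n)}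
    (hG : G ∈ levelG n i) (hw : wt d G ≠ 0) : ∑ v, (d - dg G v) + 2 * i = 2 * N := by
  rw [← mem_levelG.1 hG, ← Finset.sum_add_distrib, ← hN,
    Finset.sum_congr rfl fun v _ => Nat.sub_add_cancel (dg_le_of_wt hw v)]
  simp

lemma sum_free_pairs {n d : ℕ} {G : SimpleGraph (Fin n)} (hw : wt d G ≠ 0) :
    (∑ v, (d - dg G v)) * (∑ v, (d - dg G v) - d * (d + 1)) ≤
      ∑ p : Fin n × Fin n, if p.1 ≠ p.2 ∧ ¬ G.Adj p.1 p.2 then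
        (d - dg G p.1) * (d - dg G p.2) else 0 := by
  set F := ∑ v, (d - dg G v) with hF
  have h1 : ∀ u, F - d * (d + 1) ≤ ∑ v, if u ≠ v ∧ ¬ G.Adj u v then d - dg G v else 0 := by
    intro u
    rw [Nat.sub_le_iff_le_add, hF]
    calc ∑ v, (d - dg G v) ≤ ∑ v, ((if u ≠ v ∧ ¬ G.Adj u v then d - dg G v else 0) +
          d * ((if G.Adj u v then 1 else 0) + (if u = v then 1 else 0))) := by
          refine Finset.sum_le_sum fun v _ => ?_
          by_cases ha : G.Adj u v
          · simp only [ha, not_true_eq_false, and_false, if_false, if_true, zero_add]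
            refine le_trans (Nat.sub_le _ _) (Nat.le_mul_of_pos_right _ ?_)
            split_ifs <;> simp
          · by_cases hb : u = v
            · simp [hb]
            · simp [ha, hb]
      _ = (∑ v, if u ≠ v ∧ ¬ G.Adj u v then d - dg G v else 0) + d * (dg G u + 1) := by
          rw [Finset.sum_add_distrib, ← Finset.mul_sum, Finset.sum_add_distrib, ← dg_eq_sum]
          simp
      _ ≤ _ := by
          have := dg_le_of_wt hw u
          gcongr
  rw [Fintype.sum_prod_type, hF, Finset.sum_mul]
  refine Finset.sum_le_sum fun u _ => ?_
  refine (Nat.mul_le_mul_left _ (h1 u)).trans ?_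
  rw [Finset.mul_sum]
  refine Finset.sum_le_sum fun v _ => ?_
  split_ifs <;> simp

lemma zG_step {n d N : ℕ} (hN : n * d = 2 * N) (i : ℕ) :
    zG d n i * ((2 * N - 2 * i) * (2 * N - 2 * i - d * (d + 1))) ≤
      2 * (i + 1) * zG d n (i + 1) := by
  calc zG d n i * ((2 * N - 2 * i) * (2 * N - 2 * i - d * (d + 1)))
      ≤ ∑ G ∈ levelG n i, ∑ p : Fin n × Fin n, if p.1 ≠ p.2 ∧ ¬ G.Adj p.1 p.2 then
          wt d (addE G p.1 p.2) else 0 := by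
        rw [zG, Finset.sum_mul]
        refine Finset.sum_le_sum fun G hG => ?_
        by_cases hw : wt d G = 0
        · simp [hw]
        have hs := sum_free_eq hN hG hw
        have hs' : 2 * N - 2 * i = ∑ v, (d - dg G v) := by omega
        rw [hs']
        refine (Nat.mul_le_mul_left _ (sum_free_pairs hw)).trans ?_
        rw [Finset.mul_sum]
        refine Finset.sum_le_sum fun p _ => ?_
        by_cases hp : p.1 ≠ p.2 ∧ ¬ G.Adj p.1 p.2
        · rw [if_pos hp, if_pos hp, wt_addE hp.1 hp.2]
        · simp [if_neg hp]
    _ = ∑ p : Fin n × Fin n, ∑ G ∈ (levelG n i).filter fun G => p.1 ≠ p.2 ∧ ¬ G.Adj p.1 p.2,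
          wt d (addE G p.1 p.2) := by
        rw [Finset.sum_comm]
        exact Finset.sum_congr rfl fun p _ => (Finset.sum_filter _ _).symm
    _ ≤ ∑ p : Fin n × Fin n, ∑ G ∈ (levelG n (i + 1)).filter fun G => G.Adj p.1 p.2,
          wt d G := by
        refine Finset.sum_le_sum fun p _ => ?_
        rw [← Finset.sum_image (f := fun G => wt d G) (g := fun G => addE G p.1 p.2)]
        · refine Finset.sum_le_sum_of_subset fun G' hG' => ?_
          obtain ⟨G, hG, rfl⟩ := Finset.mem_image.1 hG'
          obtain ⟨hG, h1, h2⟩ := Finset.mem_filter.1 hG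
          refine Finset.mem_filter.2 ⟨addE_mem_levelG h1 h2 hG, ?_⟩
          rw [addE_adj]
          exact Or.inr ⟨Or.inl ⟨rfl, rfl⟩, h1⟩
        · intro G hG G' hG' he
          exact addE_cancel (Finset.mem_filter.1 (Finset.mem_coe.1 hG)).2.2
            (Finset.mem_filter.1 (Finset.mem_coe.1 hG')).2.2 he
    _ = ∑ G ∈ levelG n (i + 1), wt d G * ∑ v, dg G v := by
        simp_rw [Finset.sum_filter]
        rw [Finset.sum_comm]
        refine Finset.sum_congr rfl fun G _ => ?_
        rw [Fintype.sum_prod_type, Finset.mul_sum]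
        refine Finset.sum_congr rfl fun u _ => ?_
        rw [dg_eq_sum, Finset.mul_sum]
        simp
    _ = 2 * (i + 1) * zG d n (i + 1) := by
        rw [zG, Finset.mul_sum]
        refine Finset.sum_congr rfl fun G hG => ?_
        rw [mem_levelG.1 hG, mul_comm]

lemma exists_free_pair {n d i N : ℕ} (hN : n * d = 2 * N) (hi : i < N)
    {G : SimpleGraph (Fin n)} (hG : G ∈ levelG n i) (hw : wt d G ≠ 0) :
    ∃ u v, 1 ≤ d - dg G u ∧ 1 ≤ d - dg G v ∧ (u = v → 2 ≤ d - dg G u) := by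
  have hs := sum_free_eq hN hG hw
  have h0 : ∑ v, (d - dg G v) ≠ 0 := by omega
  obtain ⟨u, -, hu⟩ := Finset.exists_ne_zero_of_sum_ne_zero h0
  by_cases h2 : 2 ≤ d - dg G u
  · exact ⟨u, u, by omega, by omega, fun _ => h2⟩
  have h3 : ∑ v ∈ Finset.univ.erase u, (d - dg G v) ≠ 0 := by
    have := Finset.add_sum_erase Finset.univ (fun v => d - dg G v) (Finset.mem_univ u)
    omega
  obtain ⟨v, hv, hv0⟩ := Finset.exists_ne_zero_of_sum_ne_zero h3
  exact ⟨u, v, by omega, by omega, fun h => absurd h (Finset.ne_of_mem_erase hv).symm⟩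

lemma exists_far_edge {n d i : ℕ} (hi : d * (d + 2) < i)
    {G : SimpleGraph (Fin n)} (hG : G ∈ levelG n i) (hw : wt d G ≠ 0) (u v : Fin n) :
    ∃ x y, G.Adj x y ∧ x ≠ u ∧ x ≠ v ∧ y ≠ u ∧ y ≠ v ∧ ¬ G.Adj u x ∧ ¬ G.Adj v y := by
  by_contra! hcon
  set B : Fin n → Fin n → ℕ := fun w x =>
    (if x = u then 1 else 0) + (if x = v then 1 else 0) + (if G.Adj w x then 1 else 0) with hB
  have hBs : ∀ w, ∑ x, B w x ≤ d + 2 := by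
    intro w
    simp only [hB, Finset.sum_add_distrib, ← dg_eq_sum]
    have := dg_le_of_wt hw w
    simp
    omega
  have h1 : ∀ x y, (if G.Adj x y then 1 else 0 : ℕ) ≤
      B u x * (if G.Adj x y then 1 else 0) + B v y * (if G.Adj y x then 1 else 0) := by
    intro x y
    by_cases ha : G.Adj x y
    · have ha' := ha.symm
      have := hcon x y ha
      simp only [ha, ha', if_true, mul_one, hB]
      by_cases e1 : x = u
      · simp [e1]; omega
      by_cases e2 : x = v
      · simp [e2]; omega
      by_cases e3 : y = u
      · simp [e3]; omega
      by_cases e4 : y = v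
      · simp [e4]; omega
      by_cases e5 : G.Adj u x
      · simp [e5]; omega
      · simp [this e1 e2 e3 e4 e5]; omega
    · simp [ha]
  have h2 : ∀ w, ∑ x, B w x * dg G x ≤ (d + 2) * d := by
    intro w
    calc ∑ x, B w x * dg G x ≤ ∑ x, B w x * d :=
          Finset.sum_le_sum fun x _ => Nat.mul_le_mul_left _ (dg_le_of_wt hw x)
      _ = (∑ x, B w x) * d := (Finset.sum_mul _ _ _).symm
      _ ≤ _ := Nat.mul_le_mul_right _ (hBs w)
  have h3 : ∑ x, dg G x ≤ ∑ x, B u x * dg G x + ∑ y, B v y * dg G y := by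
    calc ∑ x, dg G x = ∑ x, ∑ y, (if G.Adj x y then 1 else 0) :=
          Finset.sum_congr rfl fun x _ => dg_eq_sum G x
      _ ≤ ∑ x, ∑ y, (B u x * (if G.Adj x y then 1 else 0) +
            B v y * (if G.Adj y x then 1 else 0)) :=
          Finset.sum_le_sum fun x _ => Finset.sum_le_sum fun y _ => h1 x y
      _ = _ := by
          simp_rw [Finset.sum_add_distrib]
          congr 1
          · exact Finset.sum_congr rfl fun x _ => by rw [dg_eq_sum, Finset.mul_sum]
          · rw [Finset.sum_comm]
            exact Finset.sum_congr rfl fun x _ => by rw [dg_eq_sum, Finset.mul_sum]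
  rw [mem_levelG.1 hG] at h3
  have := h2 u
  have := h2 v
  nlinarith

/-- `G'` arises from `G` by replacing the edge `xy` with `ux` and `vy`. -/
def IsSwitch {n : ℕ} (G G' : SimpleGraph (Fin n)) (x y u v : Fin n) : Prop :=
  ∃ G₀, ¬ G₀.Adj x y ∧ addE G₀ x y = G ∧ ¬ G₀.Adj u x ∧ ¬ (addE G₀ u x).Adj v y ∧
    addE (addE G₀ u x) v y = G'

lemma IsSwitch.eq {n : ℕ} {G₁ G₂ G' : SimpleGraph (Fin n)} {x y u v : Fin n}
    (h₁ : IsSwitch G₁ G' x y u v) (h₂ : IsSwitch G₂ G' x y u v) : G₁ = G₂ := by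
  obtain ⟨H₁, -, rfl, h1, h2, rfl⟩ := h₁
  obtain ⟨H₂, -, rfl, h3, h4, h5⟩ := h₂
  rw [addE_cancel h1 h3 (addE_cancel h2 h4 h5.symm)]

lemma exists_isSwitch {n d i N : ℕ} (hN : n * d = 2 * N) (hi : i < N) (hi' : d * (d + 2) < i)
    {G : SimpleGraph (Fin n)} (hG : G ∈ levelG n i) (hw : wt d G ≠ 0) :
    ∃ G' ∈ levelG n (i + 1), wt d G ≤ wt d G' ∧ ∃ x y u v, IsSwitch G G' x y u v := by
  obtain ⟨u, v, hu, hv, huv⟩ := exists_free_pair hN hi hG hw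
  obtain ⟨x, y, hxy, hxu, hxv, hyu, hyv, hux, hvy⟩ := exists_far_edge hi' hG hw u v
  obtain ⟨G₀, h0, rfl⟩ := exists_addE hxy
  have hne := hxy.ne
  have h1 : ¬ G₀.Adj u x := fun h => hux ((addE_adj _ _ _ _ _).2 (Or.inl h))
  have h2 : ¬ G₀.Adj v y := fun h => hvy ((addE_adj _ _ _ _ _).2 (Or.inl h))
  have h3 : ¬ (addE G₀ u x).Adj v y := by
    rw [addE_adj]
    rintro (h | ⟨⟨-, h⟩ | ⟨-, h⟩, -⟩)
    · exact h2 h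
    · exact hne h.symm
    · exact hyu h
  have hdeg : ∀ w, dg (addE (addE G₀ u x) v y) w = dg (addE G₀ x y) w +
      ((if w = u then 1 else 0) + (if w = v then 1 else 0)) := by
    intro w
    rw [dg_addE hyv.symm h3, dg_addE hxu.symm h1, dg_addE hne h0]
    omega
  refine ⟨addE (addE G₀ u x) v y, ?_, ?_, x, y, u, v, G₀, h0, rfl, h1, h3, rfl⟩
  · rw [mem_levelG] at hG ⊢
    rw [Finset.sum_congr rfl fun w _ => hdeg w, Finset.sum_add_distrib, hG,
      Finset.sum_add_distrib]
    simp
    ring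
  · refine Finset.prod_le_prod' fun w _ => ?_
    rw [hdeg]
    by_cases e1 : w = u
    · subst e1
      by_cases e2 : w = v
      · have := huv e2
        simp only [if_true, if_pos e2, ← add_assoc, Nat.descFactorial_succ]
        rw [← mul_assoc]
        refine Nat.le_mul_of_pos_left _ (Nat.mul_pos ?_ ?_) <;> omega
      · simp only [if_true, if_neg e2, add_zero, Nat.descFactorial_succ]
        exact Nat.le_mul_of_pos_left _ (by omega)
    · by_cases e2 : w = v
      · subst e2
        simp only [if_true, if_neg e1, zero_add, Nat.descFactorial_succ]
        exact Nat.le_mul_of_pos_left _ (by omega)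
      · simp [e1, e2]

lemma zG_switch {n d i N : ℕ} (hN : n * d = 2 * N) (hi : i < N) (hi' : d * (d + 2) < i) :
    zG d n i ≤ n ^ 4 * zG d n (i + 1) := by
  have hex : ∀ G : SimpleGraph (Fin n), ∃ q : SimpleGraph (Fin n) × (Fin n × Fin n × Fin n × Fin n),
      G ∈ levelG n i → wt d G ≠ 0 → q.1 ∈ levelG n (i + 1) ∧ wt d G ≤ wt d q.1 ∧
        IsSwitch G q.1 q.2.1 q.2.2.1 q.2.2.2.1 q.2.2.2.2 := by
    intro G
    by_cases h : G ∈ levelG n i ∧ wt d G ≠ 0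
    · obtain ⟨G', h1, h2, x, y, u, v, h3⟩ := exists_isSwitch hN hi hi' h.1 h.2
      exact ⟨⟨G', x, y, u, v⟩, fun _ _ => ⟨h1, h2, h3⟩⟩
    · by_cases h0 : Nonempty (Fin n)
      · exact ⟨⟨⊥, Classical.arbitrary _, Classical.arbitrary _, Classical.arbitrary _,
          Classical.arbitrary _⟩, fun h1 h2 => absurd ⟨h1, h2⟩ h⟩
      · exfalso
        have : n = 0 := by
          by_contra hn
          exact h0 ⟨⟨0, Nat.pos_of_ne_zero hn⟩⟩
        subst this
        simp at hN
        omega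
  choose Q hQ using hex
  calc zG d n i = ∑ G ∈ (levelG n i).filter fun G => wt d G ≠ 0, wt d G :=
        (Finset.sum_filter_ne_zero _).symm
    _ ≤ ∑ G ∈ (levelG n i).filter fun G => wt d G ≠ 0, wt d (Q G).1 := by
        refine Finset.sum_le_sum fun G hG => ?_
        obtain ⟨h1, h2⟩ := Finset.mem_filter.1 hG
        exact (hQ G h1 h2).2.1
    _ = ∑ q ∈ ((levelG n i).filter fun G => wt d G ≠ 0).image Q, wt d q.1 := by
        rw [Finset.sum_image]
        intro G hG G' hG' he
        obtain ⟨h1, h2⟩ := Finset.mem_filter.1 (Finset.mem_coe.1 hG)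
        obtain ⟨h3, h4⟩ := Finset.mem_filter.1 (Finset.mem_coe.1 hG')
        have h5 := (hQ G h1 h2).2.2
        have h6 := (hQ G' h3 h4).2.2
        rw [← he] at h6
        exact h5.eq h6
    _ ≤ ∑ q ∈ levelG n (i + 1) ×ˢ Finset.univ, wt d q.1 := by
        refine Finset.sum_le_sum_of_subset fun q hq => ?_
        obtain ⟨G, hG, rfl⟩ := Finset.mem_image.1 hq
        obtain ⟨h1, h2⟩ := Finset.mem_filter.1 hG
        exact Finset.mem_product.2 ⟨(hQ G h1 h2).1, Finset.mem_univ _⟩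
    _ = n ^ 4 * zG d n (i + 1) := by
        rw [Finset.sum_product]
        simp only [Finset.sum_const, Finset.card_univ, Fintype.card_prod, Fintype.card_fin,
          smul_eq_mul]
        rw [zG, Finset.mul_sum]
        exact Finset.sum_congr rfl fun G _ => by ring

lemma zG_top {n d N : ℕ} (hN : n * d = 2 * N) :
    zG d n N = (regularGraphs d n).ncard * d.factorial ^ n := by
  have h1 : (regularGraphs d n).ncard =
      ((levelG n N).filter fun G => wt d G ≠ 0).card := by
    rw [← Set.ncard_coe_finset]
    congr 1
    ext G
    simp only [Finset.coe_filter, mem_levelG]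
    constructor
    · intro (h : ∀ v, dg G v = d)
      refine ⟨by simp [h, hN], ?_⟩
      unfold wt
      simp [h, Nat.descFactorial_self, Nat.factorial_ne_zero]
    · rintro ⟨h2, h3⟩ v
      have h4 := sum_free_eq hN (mem_levelG.2 h2) h3
      have h5 : ∑ v, (d - dg G v) = 0 := by omega
      have h6 := Finset.sum_eq_zero_iff.1 h5 v (Finset.mem_univ v)
      have h7 := dg_le_of_wt h3 v
      change dg G v = d
      omega
  rw [h1, zG, ← Finset.sum_filter_ne_zero, Finset.card_eq_sum_ones, Finset.sum_mul]
  refine Finset.sum_congr rfl fun G hG => ?_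
  obtain ⟨h2, h3⟩ := Finset.mem_filter.1 hG
  have h4 := sum_free_eq hN h2 h3
  have h5 : ∑ v, (d - dg G v) = 0 := by omega
  unfold wt
  rw [one_mul, Finset.prod_congr rfl (g := fun _ => d.factorial)]
  · simp
  · intro v _
    have h6 := Finset.sum_eq_zero_iff.1 h5 v (Finset.mem_univ v)
    have h7 := dg_le_of_wt h3 v
    rw [show dg G v = d by omega, Nat.descFactorial_self]

lemma zG_zero (d n : ℕ) : 1 ≤ zG d n 0 := by
  have h : ∀ v, dg (⊥ : SimpleGraph (Fin n)) v = 0 := fun v => by simp [dg_eq_sum]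
  have hw : wt d (⊥ : SimpleGraph (Fin n)) = 1 := by simp [wt, h]
  rw [← hw]
  exact Finset.single_le_sum (f := fun G => wt d G) (fun _ _ => Nat.zero_le _)
    (mem_levelG.2 (by simp [h]))

lemma zG_lower {n d N c : ℕ} (hN : n * d = 2 * N) (hc : d * (d + 1) = 2 * c) (i : ℕ)
    (hi : i ≤ N - c) : 2 ^ i * N.descFactorial i * (N - c).descFactorial i ≤
      i.factorial * zG d n i := by
  induction i with
  | zero => simpa using zG_zero d n
  | succ i ih =>
    have h1 := zG_step hN i
    rw [hc] at h1
    have e1 : 2 * N - 2 * i = 2 * (N - i) := by omega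
    have e2 : 2 * (N - i) - 2 * c = 2 * (N - c - i) := by omega
    rw [e1, e2] at h1
    have h2 := ih (by omega)
    rw [Nat.descFactorial_succ, Nat.descFactorial_succ, Nat.factorial_succ, pow_succ]
    have h3 : 2 * (N - i) * (N - c - i) * zG d n i ≤ (i + 1) * zG d n (i + 1) := by
      nlinarith
    calc 2 ^ i * 2 * ((N - i) * N.descFactorial i) * ((N - c - i) * (N - c).descFactorial i)
        = (2 ^ i * N.descFactorial i * (N - c).descFactorial i) *
            (2 * (N - i) * (N - c - i)) := by ring
      _ ≤ (i.factorial * zG d n i) * (2 * (N - i) * (N - c - i)) := Nat.mul_le_mul_right _ h2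
      _ = i.factorial * (2 * (N - i) * (N - c - i) * zG d n i) := by ring
      _ ≤ i.factorial * ((i + 1) * zG d n (i + 1)) := Nat.mul_le_mul_left _ h3
      _ = (i + 1) * i.factorial * zG d n (i + 1) := by ring

lemma zG_switch_iterate {n d N : ℕ} (hN : n * d = 2 * N) (i : ℕ) (hi' : d * (d + 2) < i)
    (j : ℕ) (hj : i + j ≤ N) : zG d n i ≤ (n ^ 4) ^ j * zG d n (i + j) := by
  induction j with
  | zero => simp
  | succ j ih =>
    refine (ih (by omega)).trans ?_
    rw [pow_succ (n ^ 4), mul_assoc]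
    exact Nat.mul_le_mul_left _ (zG_switch hN (by omega) (by omega))

lemma zG_top_lower {n d N c : ℕ} (hN : n * d = 2 * N) (hc : d * (d + 1) = 2 * c)
    (hNc : d * (d + 2) + c < N) :
    2 ^ N * N.factorial ≤ 2 ^ c * c.factorial * (n ^ 4) ^ c * zG d n N := by
  have h1 := zG_lower hN hc (N - c) le_rfl
  rw [Nat.descFactorial_self, mul_comm] at h1
  have h2 := Nat.le_of_mul_le_mul_left h1 (Nat.factorial_pos _)
  have h3 := zG_switch_iterate hN (N - c) (by omega) c (by omega)
  rw [show N - c + c = N by omega] at h3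
  have h4 := Nat.factorial_mul_descFactorial (show N - c ≤ N by omega)
  rw [show N - (N - c) = c by omega] at h4
  have h5 : 2 ^ N = 2 ^ c * 2 ^ (N - c) := by rw [← pow_add]; congr 1; omega
  calc 2 ^ N * N.factorial = 2 ^ c * c.factorial * (2 ^ (N - c) * N.descFactorial (N - c)) := by
        rw [h5, ← h4]; ring
    _ ≤ 2 ^ c * c.factorial * ((n ^ 4) ^ c * zG d n N) :=
        Nat.mul_le_mul_left _ (h2.trans h3)
    _ = _ := by ring

lemma log_card_regularGraphs_ge {d : ℕ} (hd : 1 ≤ d) : ∃ K : ℝ, ∀ᶠ n in goodFilter d,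
    0 < (regularGraphs d n).ncard ∧
    (((n * d : ℕ) : ℝ) * Real.log ((n * d : ℕ) : ℝ) - ((n * d : ℕ) : ℝ)) / 2 - K - K * Real.log n ≤
      Real.log ((regularGraphs d n).ncard * d.factorial ^ n) := by
  obtain ⟨c, hc⟩ : ∃ c, d * (d + 1) = 2 * c := by
    obtain ⟨c, hc⟩ := Nat.even_mul_succ_self d
    exact ⟨c, by omega⟩
  have hc0 : 0 ≤ Real.log (c.factorial) := Real.log_natCast_nonneg _
  have hc1 : 0 ≤ Real.log 2 := Real.log_nonneg (by norm_num)
  refine ⟨c * Real.log 2 + Real.log c.factorial + 4 * c, ?_⟩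
  rw [goodFilter, eventually_inf_principal]
  filter_upwards [eventually_gt_atTop (2 * (d * (d + 2) + c))] with n hn hgood
  obtain ⟨N, hN⟩ := hgood.2
  have hN2 : n * d = 2 * N := by omega
  have hNn : d * (d + 2) + c < N := by nlinarith
  have hN1 : 1 ≤ N := by omega
  have hn1 : 1 ≤ n := by omega
  have key := zG_top_lower hN2 hc hNn
  rw [zG_top hN2] at key
  have hpos : 0 < (regularGraphs d n).ncard := by
    by_contra h0
    rw [Nat.eq_zero_of_not_pos h0] at key
    simp [Nat.factorial_ne_zero] at key
  refine ⟨hpos, ?_⟩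
  have key' : (2:ℝ) ^ N * N.factorial ≤ 2 ^ c * c.factorial * ((n:ℝ) ^ 4) ^ c *
      ((regularGraphs d n).ncard * d.factorial ^ n) := by exact_mod_cast key
  have hpos' : (0:ℝ) < (regularGraphs d n).ncard := by exact_mod_cast hpos
  have hn0 : (0:ℝ) < n := by exact_mod_cast hn1
  have hN0 : (0:ℝ) < N := by exact_mod_cast hN1
  have h1 := Real.log_le_log (by positivity) key'
  rw [Real.log_mul (by positivity) (by positivity), Real.log_mul (by positivity) (by positivity),
    Real.log_mul (by positivity) (by positivity), Real.log_mul (by positivity) (by positivity),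
    Real.log_pow, Real.log_pow, Real.log_pow, Real.log_pow] at h1
  have h2 := le_log_factorial hN1
  have h3 : 0 ≤ Real.log n := Real.log_natCast_nonneg _
  rw [hN2]
  push_cast
  rw [Real.log_mul (by norm_num) hN0.ne']
  have h4 : 0 ≤ (c * Real.log 2 + Real.log c.factorial) * Real.log n := by positivity
  push_cast at h1
  have h5 : (0:ℝ) ≤ c := by positivity
  linarith

/-! ### Breadth-first-search labels determine vertices -/

lemma takeWhile_filter_length_inj {α : Type*} {P P' q : α → Bool} {w w' : α}
    (hP : ∀ x, P x = false ↔ x = w) (hP' : ∀ x, P' x = false ↔ x = w')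
    (hq : q w = true) (hq' : q w' = true) (L : List α) (hw : w ∈ L) (hw' : w' ∈ L)
    (h : ((L.takeWhile P).filter q).length = ((L.takeWhile P').filter q).length) : w = w' := by
  induction L with
  | nil => simp at hw
  | cons a t ih =>
    by_cases h1 : a = w
    · by_cases h2 : a = w'
      · rw [← h1, h2]
      · have e1 : P a = false := (hP a).2 h1
        have e2 : P' a = true := by
          rw [← Bool.not_eq_false]
          exact fun h3 => h2 ((hP' a).1 h3)
        have e3 : q a = true := by rw [h1, hq]
        simp [e1, e2, e3] at h
    · have e1 : P a = true := by
        rw [← Bool.not_eq_false]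
        exact fun h3 => h1 ((hP a).1 h3)
      by_cases h2 : a = w'
      · have e2 : P' a = false := (hP' a).2 h2
        have e3 : q a = true := by rw [h2, hq']
        simp [e1, e2, e3] at h
      · have e2 : P' a = true := by
          rw [← Bool.not_eq_false]
          exact fun h3 => h2 ((hP' a).1 h3)
        refine ih ((List.mem_cons.1 hw).resolve_left fun h3 => h1 h3.symm)
          ((List.mem_cons.1 hw').resolve_left fun h3 => h2 h3.symm) ?_
        by_cases e3 : q a = true
        · simpa [List.takeWhile_cons, e1, e2, e3] using h
        · simpa [List.takeWhile_cons, e1, e2, e3] using h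

lemma bfsPathAux_length {n : ℕ} (G : SimpleGraph (Fin n)) (v : Fin n)
    (σ : Equiv.Perm (Fin n)) (k : ℕ) (w : Fin n) (l : List ℕ)
    (h : bfsPathAux G v σ k w = some l) : l.length = k := by
  induction k generalizing w l with
  | zero =>
    simp only [bfsPathAux] at h
    split_ifs at h
    simp at h
    simp [← h]
  | succ k ih =>
    simp only [bfsPathAux] at h
    split at h
    · simp at h
    · rw [Option.map_eq_some_iff] at h
      obtain ⟨pl, h1, rfl⟩ := h
      simp [ih _ _ h1]

lemma bfsPathAux_inj {n : ℕ} (G : SimpleGraph (Fin n)) (v : Fin n)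
    (σ : Equiv.Perm (Fin n)) (k : ℕ) (w w' : Fin n) (l : List ℕ)
    (hw : w ∈ bfsLayer G v σ k) (hw' : w' ∈ bfsLayer G v σ k)
    (h : bfsPathAux G v σ k w = some l) (h' : bfsPathAux G v σ k w' = some l) : w = w' := by
  induction k generalizing w w' l with
  | zero =>
    simp only [bfsLayer, List.mem_singleton] at hw hw'
    rw [hw, hw']
  | succ k ih =>
    simp only [bfsPathAux] at h h'
    split at h
    · simp at h
    rename_i p hp
    split at h'
    · simp at h'
    rename_i p' hp'
    rw [Option.map_eq_some_iff] at h h'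
    obtain ⟨pl, h1, rfl⟩ := h
    obtain ⟨pl', h1', h2⟩ := h'
    rw [List.cons.injEq] at h2
    obtain ⟨h2, rfl⟩ := h2
    obtain rfl := ih p p' _ (List.mem_of_find?_eq_some hp) (List.mem_of_find?_eq_some hp') h1 h1'
    refine takeWhile_filter_length_inj ?_ ?_ ?_ ?_ _ hw hw' (Nat.add_left_cancel h2.symm)
    · intro x; simp
    · intro x; simp
    · simpa using hp
    · simpa using hp'

lemma bfsPath_inj {n : ℕ} (G : SimpleGraph (Fin n)) (v : Fin n)
    (σ : Equiv.Perm (Fin n)) (w w' : Fin n) (l : List ℕ)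
    (h : bfsPath G v σ w = some l) (h' : bfsPath G v σ w' = some l) : w = w' := by
  unfold bfsPath at h h'
  split_ifs at h h' with h1 h2
  have e1 := bfsPathAux_length _ _ _ _ _ _ h
  have e2 := bfsPathAux_length _ _ _ _ _ _ h'
  have key : ∀ (k : ℕ) (u : Fin n), G.Reachable v u → G.dist v u = k → u ∈ bfsLayer G v σ k := by
    intro k u hu hd
    cases k with
    | zero =>
      rw [hu.dist_eq_zero_iff] at hd
      simp [bfsLayer, hd]
    | succ k =>
      simp only [bfsLayer, List.mem_mergeSort]
      simp [hu, hd]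
  rw [← e1] at h
  rw [← e2] at h'
  exact bfsPathAux_inj G v σ l.length w w' l (key _ _ h1 e1.symm) (key _ _ h2 e2.symm) h h'

lemma bfsPath_root {n : ℕ} (G : SimpleGraph (Fin n)) (v : Fin n)
    (σ : Equiv.Perm (Fin n)) : bfsPath G v σ v = some [] := by
  simp [bfsPath, bfsPathAux]

/-! ### Reading trees off colorings -/

lemma validTd_singleton {d i : ℕ} : ValidTd d [i] ↔ 1 ≤ i ∧ i ≤ d := by
  simp [ValidTd]

lemma validTd_cons_cons {d i j : ℕ} {l : List ℕ} :
    ValidTd d (i :: j :: l) ↔ (1 ≤ i ∧ i ≤ d - 1) ∧ ValidTd d (j :: l) := by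
  simp [ValidTd, List.dropLast_cons_of_ne_nil, List.getLast?_cons_cons, and_assoc]

lemma validTd_cons {d i : ℕ} {l : List ℕ} (hl : l ≠ []) :
    ValidTd d (i :: l) ↔ (1 ≤ i ∧ i ≤ d - 1) ∧ ValidTd d l := by
  obtain ⟨j, l, rfl⟩ := List.exists_cons_of_ne_nil hl
  exact validTd_cons_cons

lemma validTd_tail {d i : ℕ} {l : List ℕ} (h : ValidTd d (i :: l)) : ValidTd d l := by
  by_cases hl : l = []
  · subst hl
    exact (rootTd d).2
  · exact ((validTd_cons hl).1 h).2

/-- The labelled tree of depth `k` hanging from `l` in the coloring `X`. -/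
def lab {M : Type} {D : ℕ} : ∀ k, (List ℕ → M) → List ℕ → LTree M D k
  | 0, X, l => X l
  | (k + 1), X, l => (X l, fun i : Fin D => lab k X ((i.1 + 1) :: l))

/-- The coloring of the ball of radius `k + 1` around the root in the coloring `X`. -/
def labStar {M : Type} {D : ℕ} (k : ℕ) (X : List ℕ → M) : LStar M D k :=
  (X [], fun i : Fin (D + 1) => lab k X [i.1 + 1])

/-- Extension of a coloring of `T_d` to all labels. -/
def extTd {M : Type} {d : ℕ} (x : TdVertex d → M) (l : List ℕ) : M :=
  if h : ValidTd d l then x ⟨l, h⟩ else x (rootTd d)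

/-- The labelled tree hanging from the half-edge `h` away from its partner. -/
def cfgTree {M : Type} {D : ℕ} {V : Type*} (f : V → M)
    (π : V × Fin (D + 1) → V × Fin (D + 1)) : ∀ k, V × Fin (D + 1) → LTree M D k
  | 0, h => f h.1
  | (k + 1), h => (f h.1, fun j => cfgTree f π k (π (h.1, h.2.succAbove j)))

/-- The labelled ball of radius `k + 1` around a vertex of a configuration. -/
def cfgStar {M : Type} {D : ℕ} {V : Type*} (f : V → M)
    (π : V × Fin (D + 1) → V × Fin (D + 1)) (k : ℕ) (v : V) : LStar M D k :=
  (f v, fun i => cfgTree f π k (π (v, i)))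

lemma trL_cfgTree {M : Type} {D : ℕ} {V : Type*} (f : V → M)
    (π : V × Fin (D + 1) → V × Fin (D + 1)) : ∀ k (h : V × Fin (D + 1)),
    trL k (cfgTree f π (k + 1) h) = cfgTree f π k h
  | 0, _ => rfl
  | (k + 1), h => by
    change (f h.1, fun j => trL k (cfgTree f π (k + 1) (π (h.1, h.2.succAbove j)))) =
      (f h.1, fun j => cfgTree f π k (π (h.1, h.2.succAbove j)))
    simp only [trL_cfgTree f π k]

lemma rootSideL_cfgStar {M : Type} {D : ℕ} {V : Type*} (f : V → M)
    (π : V × Fin (D + 1) → V × Fin (D + 1)) : ∀ k (v : V) (i : Fin (D + 1)),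
    rootSideL k (cfgStar f π k v) i = cfgTree f π k (v, i)
  | 0, _, _ => rfl
  | (k + 1), v, i => by
    change (f v, fun j => trL k (cfgTree f π (k + 1) (π (v, i.succAbove j)))) =
      (f v, fun j => cfgTree f π k (π (v, i.succAbove j)))
    simp only [trL_cfgTree f π k]

lemma edgeU_cfgStar {M : Type} {D : ℕ} {V : Type*} (f : V → M)
    (π : V × Fin (D + 1) → V × Fin (D + 1)) (k : ℕ) (h : V × Fin (D + 1)) :
    edgeU (clStar (cfgStar f π k h.1)) h.2 =
      (cl k (cfgTree f π k h), cl k (cfgTree f π k (π h))) := by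
  refine Prod.ext ?_ rfl
  change rootSideU k (clStar (cfgStar f π k h.1)) h.2 = _
  rw [rootSideU_clStar, rootSideL_cfgStar]

lemma cl_cfgTree_eq {M : Type} {D : ℕ} {V : Type*} {f : V → M}
    {π : V × Fin (D + 1) → V × Fin (D + 1)} (hπ : ∀ h, π (π h) = h) {X : List ℕ → M}
    {W : List ℕ → V} {r : ℕ}
    (hf : ∀ l, ValidTd (D + 1) l → l.length ≤ r → f (W l) = X l)
    (hinj : ∀ l l', ValidTd (D + 1) l → ValidTd (D + 1) l' → l.length ≤ r → l'.length ≤ r →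
      W l = W l' → l = l')
    (hadj : ∀ i l, ValidTd (D + 1) (i :: l) → l.length + 1 ≤ r →
      ∃ j, (π (W l, j)).1 = W (i :: l)) (k : ℕ) :
    ∀ (a : ℕ) (l : List ℕ) (h : V × Fin (D + 1)), ValidTd (D + 1) (a :: l) →
      l.length + 1 + k ≤ r → h.1 = W (a :: l) → (π h).1 = W l →
      cl k (cfgTree f π k h) = cl k (lab k X (a :: l)) := by
  induction k with
  | zero =>
    intro a l h hv hr h1 _
    change f h.1 = X (a :: l)
    rw [h1, hf _ hv (by simpa using hr)]
  | succ k ih =>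
    intro a l h hv hr h1 h2
    have hval : ∀ i : Fin D, ValidTd (D + 1) ((i.1 + 1) :: a :: l) := fun i =>
      validTd_cons_cons.2 ⟨⟨by omega, by have := i.2; omega⟩, hv⟩
    obtain ⟨s, hs⟩ := exists_perm_comp (f := fun i : Fin D => W ((i.1 + 1) :: a :: l))
      (g := fun j => (π (h.1, h.2.succAbove j)).1)
      (fun i i' hi => by
        have := hinj _ _ (hval i) (hval i') (by simp; omega) (by simp; omega) hi
        simp only [List.cons.injEq, add_left_inj, and_true] at this
        exact Fin.ext this)
      (fun i => by
        obtain ⟨j, hj⟩ := hadj (i.1 + 1) (a :: l) (hval i) (by simp; omega)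
        rw [← h1] at hj
        have hne : j ≠ h.2 := by
          rintro rfl
          have := hinj _ _ (validTd_tail hv) (hval i) (by omega) (by simp; omega)
            (h2.symm.trans hj)
          have := congrArg List.length this
          simp at this
          omega
        obtain ⟨j', rfl⟩ := Fin.exists_succAbove_eq hne
        exact ⟨j', hj.symm⟩)
    change (f h.1, symOf fun j => cl k (cfgTree f π k (π (h.1, h.2.succAbove j)))) =
      (X (a :: l), symOf fun i : Fin D => cl k (lab k X ((i.1 + 1) :: a :: l)))
    rw [h1, hf _ hv (by simp; omega), ← h1,
      ← symOf_comp_perm (fun j => cl k (cfgTree f π k (π (h.1, h.2.succAbove j)))) s]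
    congr 2
    funext i
    exact ih _ _ _ (hval i) (by simp; omega) (hs i).symm (by rw [hπ]; exact h1)

lemma tyStar_cfgStar_eq {M : Type} {D : ℕ} {V : Type*} {f : V → M}
    {π : V × Fin (D + 1) → V × Fin (D + 1)} (hπ : ∀ h, π (π h) = h) {X : List ℕ → M}
    {W : List ℕ → V} {k : ℕ}
    (hf : ∀ l, ValidTd (D + 1) l → l.length ≤ k + 1 → f (W l) = X l)
    (hinj : ∀ l l', ValidTd (D + 1) l → ValidTd (D + 1) l' → l.length ≤ k + 1 →
      l'.length ≤ k + 1 → W l = W l' → l = l')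
    (hadj : ∀ i l, ValidTd (D + 1) (i :: l) → l.length + 1 ≤ k + 1 →
      ∃ j, (π (W l, j)).1 = W (i :: l)) :
    tyStar (clStar (cfgStar f π k (W []))) = tyStar (clStar (labStar k X)) := by
  have hval : ∀ i : Fin (D + 1), ValidTd (D + 1) [i.1 + 1] := fun i =>
    validTd_singleton.2 ⟨by omega, by have := i.2; omega⟩
  obtain ⟨s, hs⟩ := exists_perm_comp (f := fun i : Fin (D + 1) => W [i.1 + 1])
    (g := fun j => (π (W [], j)).1)
    (fun i i' hi => by
      have := hinj _ _ (hval i) (hval i') (by simp) (by simp) hi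
      simp only [List.cons.injEq, add_left_inj, and_true] at this
      exact Fin.ext this)
    (fun i => by
      obtain ⟨j, hj⟩ := hadj (i.1 + 1) [] (hval i) (by simp)
      exact ⟨j, hj.symm⟩)
  change (f (W []), symOf fun j => cl k (cfgTree f π k (π (W [], j)))) =
    (X [], symOf fun i : Fin (D + 1) => cl k (lab k X [i.1 + 1]))
  rw [hf [] (rootTd (D + 1)).2 (by simp),
    ← symOf_comp_perm (fun j => cl k (cfgTree f π k (π (W [], j)))) s]
  congr 2
  funext i
  exact cl_cfgTree_eq hπ hf hinj hadj k _ _ _ (hval i) (by simp; omega) (hs i).symm (by rw [hπ])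

/-- The neighborhoods seen in a graph agree with those of the tree coloring. -/
lemma tyStar_of_resS_eq {M : Type} {D n k : ℕ} {G : SimpleGraph (Fin n)} {f : Fin n → M}
    {v : Fin n} {σ : Equiv.Perm (Fin n)} {x : TdVertex (D + 1) → M}
    {π : Fin n × Fin (D + 1) → Fin n × Fin (D + 1)} (hπ : ∀ h, π (π h) = h)
    (hG : ∀ u w, G.Adj u w → ∃ j, (π (u, j)).1 = w)
    (h : resS (k + 1) (bfsRCG G f v σ) = resS (k + 1) (iotaTd (D + 1) x)) :
    tyStar (clStar (cfgStar f π k v)) = tyStar (clStar (labStar k (extTd x))) := by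
  have hcol : ∀ l, ValidTd (D + 1) l → l.length ≤ k + 1 →
      ∃ w, bfsPath G v σ w = some l ∧ f w = extTd x l := by
    intro l hl hr
    have h1 := congrFun (congrArg RCG.col h) l
    simp only [resS, if_pos hr, bfsRCG, iotaTd, dif_pos hl] at h1
    split_ifs at h1 with h2
    refine ⟨h2.choose, h2.choose_spec, ?_⟩
    rw [extTd, dif_pos hl]
    simpa using h1
  have hW : ∀ l, ∃ w, ValidTd (D + 1) l → l.length ≤ k + 1 →
      bfsPath G v σ w = some l ∧ f w = extTd x l := by
    intro l
    by_cases hl : ValidTd (D + 1) l ∧ l.length ≤ k + 1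
    · obtain ⟨w, hw⟩ := hcol l hl.1 hl.2
      exact ⟨w, fun _ _ => hw⟩
    · exact ⟨v, fun h1 h2 => absurd ⟨h1, h2⟩ hl⟩
  choose W hW using hW
  have hroot : W [] = v := bfsPath_inj G v σ _ _ [] (hW [] (rootTd (D + 1)).2 (by simp)).1
    (bfsPath_root G v σ)
  rw [← hroot]
  refine tyStar_cfgStar_eq hπ (fun l hl hr => (hW l hl hr).2) (fun l l' hl hl' hr hr' he => ?_)
    (fun i l hl hr => ?_)
  · have h1 := (hW l hl hr).1
    rw [he, (hW l' hl' hr').1] at h1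
    exact (Option.some.inj h1).symm
  · apply hG
    have h1 := congrFun (congrArg RCG.adj h) (l, i :: l)
    have hl' := validTd_tail hl
    have hr1 : l.length ≤ k + 1 := by omega
    have hr2 : (i :: l).length ≤ k + 1 := by simpa using hr
    have h2 : ∃ i', i :: l = i' :: l := ⟨i, rfl⟩
    simp only [resS, hr1, hr2, and_self, if_true, bfsRCG, iotaTd, hl, hl', h2, true_or] at h1
    split_ifs at h1 with h3
    obtain ⟨w₁, w₂, h4, h5, h6⟩ := h3
    rwa [bfsPath_inj G v σ _ _ _ (hW l hl' hr1).1 h4, bfsPath_inj G v σ _ _ _ (hW _ hl hr2).1 h5]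

/-- The configuration of half-edges given by a graph with labelled neighborhoods. -/
def cfgOf {n d : ℕ} (G : SimpleGraph (Fin n)) (e : ∀ v, Fin d ≃ {w // G.Adj v w})
    (h : Fin n × Fin d) : Fin n × Fin d :=
  ((e h.1 h.2).1, (e (e h.1 h.2).1).symm ⟨h.1, (e h.1 h.2).2.symm⟩)

lemma cfgOf_cfgOf {n d : ℕ} (G : SimpleGraph (Fin n)) (e : ∀ v, Fin d ≃ {w // G.Adj v w})
    (h : Fin n × Fin d) : cfgOf G e (cfgOf G e h) = h := by
  obtain ⟨v, i⟩ := h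
  have key : ∀ (w : Fin n) (q : {x // G.Adj w x}), q.1 = v → w = (e v i).1 →
      (q.1, (e q.1).symm ⟨w, q.2.symm⟩) = (v, i) := by
    rintro w ⟨q, hq⟩ (h1 : q = v) h2
    subst h1 h2
    exact Prod.ext rfl ((e q).symm_apply_apply i)
  exact key _ (e (e v i).1 ((e (e v i).1).symm ⟨v, (e v i).2.symm⟩))
    (by rw [Equiv.apply_symm_apply]) rfl

lemma cfgOf_ne {n d : ℕ} (G : SimpleGraph (Fin n)) (e : ∀ v, Fin d ≃ {w // G.Adj v w})
    (h : Fin n × Fin d) : cfgOf G e h ≠ h := fun h1 =>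
  (e h.1 h.2).2.ne (congrArg Prod.fst h1).symm

lemma cfgOf_adj {n d : ℕ} (G : SimpleGraph (Fin n)) (e : ∀ v, Fin d ≃ {w // G.Adj v w})
    (u w : Fin n) : G.Adj u w ↔ ∃ j, (cfgOf G e (u, j)).1 = w := by
  constructor
  · intro h
    exact ⟨(e u).symm ⟨w, h⟩, by simp [cfgOf]⟩
  · rintro ⟨j, rfl⟩
    exact (e u j).2

lemma cfgOf_injective {n d : ℕ} : Function.Injective
    (fun q : Σ G : SimpleGraph (Fin n), ∀ v, Fin d ≃ {w // G.Adj v w} => cfgOf q.1 q.2) := by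
  rintro ⟨G, e⟩ ⟨G', e'⟩ h
  simp only at h
  have hG : G = G' := by
    ext u w
    rw [cfgOf_adj G e, cfgOf_adj G' e', h]
  subst hG
  congr
  funext v
  ext i
  exact congrArg Fin.val (congrArg Prod.fst (congrFun h (v, i)))

lemma card_labellings {n d : ℕ} {G : SimpleGraph (Fin n)} (hG : G ∈ regularGraphs d n) :
    Fintype.card (∀ v, Fin d ≃ {w // G.Adj v w}) = d.factorial ^ n := by
  have h1 : ∀ v, Fintype.card (Fin d ≃ {w // G.Adj v w}) = d.factorial := by
    intro v
    have h2 : Fintype.card {w // G.Adj v w} = d := by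
      rw [← hG v, ← Nat.card_coe_set_eq, Nat.card_eq_fintype_card]
      exact Fintype.card_congr (Equiv.refl _)
    rw [Fintype.card_equiv (Fintype.equivOfCardEq (by simp [h2])), Fintype.card_fin]
  rw [Fintype.card_pi, Finset.prod_congr rfl fun v _ => h1 v]
  simp

/-! ### Entropy estimates for types -/

/-- The isomorphism type of a colored ball. -/
def typ {M : Type} {D k : ℕ} (z : LStar M D k) : TStar M D k := tyStar (clStar z)

/-- The law of the labelled edge at the root in the direction of the first branch. -/
def edgeLaw {M : Type} [Fintype M] {D k : ℕ} (P : LStar M D k → ℝ)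
    (ab : LTree M D k × LTree M D k) : ℝ :=
  ∑ z, if (rootSideL k z 0, z.2 0) = ab then P z else 0

/-- The law of the unlabelled edge at the root in the direction of the first branch. -/
def edgeTypeLaw {M : Type} [Fintype M] {D k : ℕ} (P : LStar M D k → ℝ)
    (e : UTree M D k × UTree M D k) : ℝ :=
  ∑ z, if edgeU (clStar z) 0 = e then P z else 0

lemma edgeTypeLaw_eq_sum {M : Type} [Fintype M] {D k : ℕ} (P : LStar M D k → ℝ)
    (e : UTree M D k × UTree M D k) :
    edgeTypeLaw P e = ∑ ab ∈ Finset.univ.filter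
      (fun ab : LTree M D k × LTree M D k => (cl k ab.1, cl k ab.2) = e), edgeLaw P ab := by
  unfold edgeTypeLaw edgeLaw
  rw [Finset.sum_comm]
  refine Finset.sum_congr rfl fun z _ => ?_
  rw [Finset.sum_ite_eq]
  simp only [Finset.mem_filter, Finset.mem_univ, true_and, ← rootSideU_clStar]
  rfl

lemma clStar_comp {M : Type} {D k : ℕ} (z : LStar M D k) (ρ : Equiv.Perm (Fin (D + 1))) :
    clStar (k := k) (z.1, z.2 ∘ ρ) = ((clStar z).1, (clStar z).2 ∘ ρ) := rfl

lemma typ_comp {M : Type} {D k : ℕ} (z : LStar M D k) (ρ : Equiv.Perm (Fin (D + 1))) :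
    typ (k := k) (z.1, z.2 ∘ ρ) = typ z := by
  unfold typ
  rw [clStar_comp]
  exact Prod.ext rfl (symOf_comp_perm (clStar z).2 ρ)

/-- Permuting the branches at the root. -/
def permStar {M : Type} {D k : ℕ} (ρ : Equiv.Perm (Fin (D + 1))) : LStar M D k ≃ LStar M D k where
  toFun z := (z.1, z.2 ∘ ρ)
  invFun z := (z.1, z.2 ∘ ρ.symm)
  left_inv z := by ext <;> simp
  right_inv z := by ext <;> simp

lemma sum_edgeCount {M : Type} [Fintype M] {D k : ℕ} {P : LStar M D k → ℝ}
    (hP : ∀ z z', typ z = typ z' → P z = P z') (e : UTree M D k × UTree M D k) :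
    ∑ z, P z * edgeCount (clStar z) e = (D + 1 : ℕ) * edgeTypeLaw P e := by
  have h1 : ∀ i : Fin (D + 1), ∑ z, (if edgeU (clStar z) i = e then P z else 0) =
      edgeTypeLaw P e := by
    intro i
    unfold edgeTypeLaw
    rw [← Equiv.sum_comp (permStar (M := M) (k := k) (Equiv.swap 0 i))
      (fun z => if edgeU (clStar z) 0 = e then P z else 0)]
    refine Finset.sum_congr rfl fun z _ => ?_
    change _ = if edgeU (clStar (k := k) (z.1, z.2 ∘ Equiv.swap 0 i)) 0 = e then
      P (z.1, z.2 ∘ Equiv.swap 0 i) else 0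
    rw [hP _ z (typ_comp z _), clStar_comp, edgeU_comp_perm, Equiv.swap_apply_left]
  have h2 : ∀ z : LStar M D k, P z * edgeCount (clStar z) e =
      ∑ i : Fin (D + 1), if edgeU (clStar z) i = e then P z else 0 := by
    intro z
    rw [edgeCount, ← Finset.sum_filter, Finset.sum_const, nsmul_eq_mul, mul_comm]
  rw [Finset.sum_congr rfl fun z _ => h2 z, Finset.sum_comm, Finset.sum_congr rfl fun i _ => h1 i]
  simp

lemma sum_negMulLog_le {ι : Type*} (s : Finset ι) (hs : s.Nonempty) (p : ι → ℝ)
    (hp : ∀ i, 0 ≤ p i) :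
    ∑ i ∈ s, Real.negMulLog (p i) ≤
      Real.negMulLog (∑ i ∈ s, p i) + (∑ i ∈ s, p i) * Real.log s.card := by
  have hc : (0:ℝ) < s.card := by exact_mod_cast hs.card_pos
  have h := Real.concaveOn_negMulLog.le_map_sum (t := s) (w := fun _ => (s.card : ℝ)⁻¹) (p := p)
    (fun _ _ => by positivity) (by simp [hc.ne']) (fun i _ => hp i)
  simp only [smul_eq_mul, ← Finset.mul_sum] at h
  rw [Real.negMulLog_mul, inv_mul_le_iff₀ hc] at h
  refine h.trans (le_of_eq ?_)
  rw [Real.negMulLog, Real.log_inv]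
  field_simp
  ring

lemma card_fiber_prod_cl {M : Type} [Fintype M] {D k : ℕ} (e : UTree M D k × UTree M D k) :
    (Finset.univ.filter (fun ab : LTree M D k × LTree M D k =>
      (cl k ab.1, cl k ab.2) = e)).card = mult e.1 * mult e.2 := by
  unfold mult
  rw [← Finset.card_product]
  congr 1
  ext ab
  simp [Prod.ext_iff]

lemma entropy_edgeLaw_le {M : Type} [Fintype M] {D k : ℕ} {P : LStar M D k → ℝ}
    (hP0 : ∀ z, 0 ≤ P z) :
    ∑ ab, Real.negMulLog (edgeLaw P ab) ≤ ∑ e, (Real.negMulLog (edgeTypeLaw P e) +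
      edgeTypeLaw P e * (Real.log (mult e.1) + Real.log (mult e.2))) := by
  rw [← Finset.sum_fiberwise Finset.univ
    (fun ab : LTree M D k × LTree M D k => (cl k ab.1, cl k ab.2))]
  refine Finset.sum_le_sum fun e _ => ?_
  have h1 := mult_pos (M := M) e.1
  have h2 := mult_pos (M := M) e.2
  have h := sum_negMulLog_le (Finset.univ.filter (fun ab : LTree M D k × LTree M D k =>
      (cl k ab.1, cl k ab.2) = e))
    (Finset.card_pos.1 (by rw [card_fiber_prod_cl]; positivity)) (edgeLaw P)
    (fun ab => Finset.sum_nonneg fun z _ => by split_ifs; exacts [hP0 z, le_rfl])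
  rw [card_fiber_prod_cl, ← edgeTypeLaw_eq_sum, Nat.cast_mul,
    Real.log_mul (by positivity) (by positivity)] at h
  exact h

/-- Averages of functions of the type are determined by the empirical type frequencies. -/
lemma sum_type_sub_le {T Z : Type*} [Fintype T] [Fintype Z] (ty : Z → T) (P : Z → ℝ)
    (hP1 : ∑ z, P z = 1) {n : ℕ} (t : Fin n → T) {ε : ℝ} (hε : 0 ≤ ε)
    (h : ∀ a, n * ((∑ z, if ty z = a then P z else 0) - ε) ≤
      ((Finset.univ.filter fun v => t v = a).card : ℝ)) (g : T → ℝ) :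
    |∑ v, g (t v) - n * ∑ z, P z * g (ty z)| ≤ n * ε * (Fintype.card T * ∑ a, |g a|) := by
  set N : T → ℝ := fun a => ((Finset.univ.filter fun v => t v = a).card : ℝ) with hN
  set p : T → ℝ := fun a => ∑ z, if ty z = a then P z else 0 with hp
  have hNs : ∑ a, N a = n := by
    have := Finset.card_eq_sum_card_fiberwise (f := t) (s := Finset.univ) (t := Finset.univ)
      (by simp)
    rw [Finset.card_univ, Fintype.card_fin] at this
    rw [this]
    push_cast
    rfl
  have hps : ∑ a, p a = 1 := by
    rw [← hP1, hp, Finset.sum_comm]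
    simp
  have e1 : ∑ v, g (t v) = ∑ a, N a * g a := by
    rw [← Finset.sum_fiberwise Finset.univ t]
    refine Finset.sum_congr rfl fun a _ => ?_
    rw [Finset.sum_congr rfl (g := fun _ => g a)
      (fun v hv => by rw [(Finset.mem_filter.1 hv).2])]
    simp [hN]
  have e2 : ∑ z, P z * g (ty z) = ∑ a, p a * g a := by
    simp only [hp, Finset.sum_mul, ite_mul, zero_mul]
    rw [Finset.sum_comm]
    simp
  have hup : ∀ a, N a - n * p a ≤ n * ε * Fintype.card T := by
    intro a
    have h1 := Finset.add_sum_erase Finset.univ N (Finset.mem_univ a)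
    have h2 := Finset.add_sum_erase Finset.univ p (Finset.mem_univ a)
    have h3 : ∑ b ∈ Finset.univ.erase a, (n * (p b - ε)) ≤ ∑ b ∈ Finset.univ.erase a, N b :=
      Finset.sum_le_sum fun b _ => h b
    rw [← Finset.mul_sum, Finset.sum_sub_distrib, Finset.sum_const, nsmul_eq_mul] at h3
    have h4 : ((Finset.univ.erase a).card : ℝ) ≤ Fintype.card T := by
      exact_mod_cast Finset.card_le_univ _
    have h5 : n * ε * ((Finset.univ.erase a).card : ℝ) ≤ n * ε * Fintype.card T := by gcongr
    have h6 : ∑ b ∈ Finset.univ.erase a, p b = 1 - p a := by linarith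
    rw [h6] at h3
    linarith
  have habs : ∀ a, |N a - n * p a| ≤ n * ε * Fintype.card T := by
    intro a
    refine abs_le.2 ⟨?_, hup a⟩
    have h1 := h a
    have h2 : (1:ℝ) ≤ Fintype.card T := by
      have : Nonempty T := ⟨a⟩
      exact_mod_cast Fintype.card_pos
    have h3 : n * ε * 1 ≤ n * ε * Fintype.card T := by gcongr
    change n * (p a - ε) ≤ N a at h1
    linarith
  rw [e1, e2, Finset.mul_sum, ← Finset.sum_sub_distrib]
  refine (Finset.abs_sum_le_sum_abs _ _).trans ?_
  rw [Finset.mul_sum, Finset.mul_sum]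
  refine Finset.sum_le_sum fun a _ => ?_
  rw [← mul_assoc, ← sub_mul, abs_mul, ← mul_assoc]
  exact mul_le_mul_of_nonneg_right (habs a) (abs_nonneg _)

/-! ### Counting matchings with prescribed types -/

lemma typ_surjective {M : Type} {D k : ℕ} : Function.Surjective (typ (M := M) (D := D) (k := k)) := by
  rintro ⟨m, s⟩
  obtain ⟨g, rfl⟩ := symOf_surjective s
  choose F hF using (cl_surjective k : Function.Surjective (cl (M := M) (D := D) k))
  refine ⟨(m, fun i => F (g i)), ?_⟩
  simp [typ, tyStar, clStar, hF]

/-- The color of a half-edge is the type of the corresponding edge. -/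
def edgeCol {M : Type} {D k n : ℕ} (τ : Fin n → UStar M D k) (h : Fin n × Fin (D + 1)) :
    UTree M D k × UTree M D k := edgeU (τ h.1) h.2

lemma fibCard_edgeCol {M : Type} {D k n : ℕ} (τ : Fin n → UStar M D k)
    (e : UTree M D k × UTree M D k) :
    fibCard (edgeCol τ) Finset.univ e = ∑ v, edgeCount (τ v) e := by
  unfold fibCard edgeCount
  rw [Finset.card_filter, Fintype.sum_prod_type]
  refine Finset.sum_congr rfl fun v _ => ?_
  rw [Finset.card_filter]
  refine Finset.sum_congr rfl fun i _ => ?_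
  simp only [edgeCol]
  congr

/-- The type frequencies of `t` are bounded below by those of `P`, up to `ε`. -/
def TypClose {M : Type} [Fintype M] {D k n : ℕ} (P : LStar M D k → ℝ) (ε : ℝ)
    (t : Fin n → TStar M D k) : Prop :=
  ∀ a, n * ((∑ z, if typ z = a then P z else 0) - ε) ≤
    ((Finset.univ.filter fun v => t v = a).card : ℝ)

lemma TypClose.mono {M : Type} [Fintype M] {D k n : ℕ} {P : LStar M D k → ℝ} {ε ε' : ℝ}
    (h : ε ≤ ε') {t : Fin n → TStar M D k} (ht : TypClose P ε t) : TypClose P ε' t :=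
  fun a => le_trans (by gcongr) (ht a)

lemma exists_abs_edgeCount_sub_le {M : Type} [Fintype M] {D k : ℕ} {P : LStar M D k → ℝ}
    (hP1 : ∑ z, P z = 1) (hP : ∀ z z', typ z = typ z' → P z = P z') :
    ∃ C, 0 ≤ C ∧ ∀ ε, 0 ≤ ε → ∀ (n : ℕ) (τ : Fin n → UStar M D k),
      TypClose P ε (fun v => tyStar (τ v)) → ∀ e,
        |(fibCard (edgeCol τ) Finset.univ e : ℝ) - n * ((D + 1 : ℕ) * edgeTypeLaw P e)| ≤
          n * ε * C := by
  choose rep hrep using (typ_surjective (M := M) (D := D) (k := k))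
  let g : UTree M D k × UTree M D k → TStar M D k → ℝ := fun e a => edgeCount (clStar (rep a)) e
  let K : UTree M D k × UTree M D k → ℝ := fun e => Fintype.card (TStar M D k) * ∑ a, |g e a|
  have hK : ∀ e, 0 ≤ K e := fun e => by positivity
  refine ⟨∑ e, K e, Finset.sum_nonneg fun e _ => hK e, fun ε hε n τ hτ e => ?_⟩
  have h := sum_type_sub_le typ P hP1 (fun v => tyStar (τ v)) hε (fun a => by convert hτ a) (g e)
  have h1 : ∑ v, g e (tyStar (τ v)) = (fibCard (edgeCol τ) Finset.univ e : ℝ) := by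
    rw [fibCard_edgeCol]
    push_cast
    refine Finset.sum_congr rfl fun v _ => ?_
    exact congrArg Nat.cast (edgeCount_eq_of_tyStar_eq (hrep (tyStar (τ v))) e)
  have h2 : ∑ z, P z * g e (typ z) = (D + 1 : ℕ) * edgeTypeLaw P e := by
    rw [← sum_edgeCount hP]
    refine Finset.sum_congr rfl fun z _ => ?_
    congr 1
    exact congrArg Nat.cast (edgeCount_eq_of_tyStar_eq (hrep (typ z)) e)
  rw [h1, h2] at h
  refine h.trans ?_
  have h3 : K e ≤ ∑ e, K e := Finset.single_le_sum (fun e _ => hK e) (Finset.mem_univ e)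
  exact mul_le_mul_of_nonneg_left h3 (by positivity)

lemma exists_abs_sum_negMulLog_sub_lt {E : Type*} [Fintype E] (q : E → ℝ) {δ : ℝ} (hδ : 0 < δ) :
    ∃ ρ, 0 < ρ ∧ ∀ x : E → ℝ, (∀ e, |x e - q e| < ρ) →
      ∑ e, Real.negMulLog (q e) - δ < ∑ e, Real.negMulLog (x e) := by
  have hc : Continuous fun x : E → ℝ => ∑ e, Real.negMulLog (x e) :=
    continuous_finsetSum _ fun e _ => Real.continuous_negMulLog.comp (continuous_apply e)
  obtain ⟨ρ, hρ, h⟩ := Metric.continuousAt_iff.1 (hc.continuousAt (x := q)) δ hδ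
  refine ⟨ρ, hρ, fun x hx => ?_⟩
  have := h ((dist_pi_lt_iff hρ).2 fun e => by rw [Real.dist_eq]; exact hx e)
  rw [Real.dist_eq, abs_lt] at this
  linarith [this.1]

lemma sum_log_mult_edgeCol {M : Type} [Fintype M] {D k n : ℕ} {τ : Fin n → UStar M D k}
    (hI : (matchingsOn (edgeCol τ) Prod.swap Finset.univ).Nonempty) :
    ∑ e, (fibCard (edgeCol τ) Finset.univ e : ℝ) *
      (Real.log (mult e.1) + Real.log (mult e.2)) =
    2 * ∑ v, ∑ i, Real.log (mult ((τ v).2 i)) := by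
  obtain ⟨π, hπ⟩ := hI
  obtain ⟨h1, h2, -⟩ := mem_matchingsOn.1 hπ
  have e1 : ∑ e, (fibCard (edgeCol τ) Finset.univ e : ℝ) *
      (Real.log (mult e.1) + Real.log (mult e.2)) =
      ∑ h, (Real.log (mult (edgeCol τ h).1) + Real.log (mult (edgeCol τ h).2)) := by
    rw [← Finset.sum_fiberwise Finset.univ (edgeCol τ)]
    refine Finset.sum_congr rfl fun e _ => ?_
    rw [Finset.sum_congr rfl (g := fun _ => Real.log (mult e.1) + Real.log (mult e.2))
      (fun h hh => by rw [(Finset.mem_filter.1 hh).2])]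
    rw [Finset.sum_const, nsmul_eq_mul, fibCard]
    congr
  have e2 : ∑ h, Real.log (mult (edgeCol τ h).1) = ∑ h, Real.log (mult (edgeCol τ h).2) := by
    rw [← Equiv.sum_comp (Function.Involutive.toPerm π h1)
      (fun h => Real.log (mult (edgeCol τ h).2))]
    refine Finset.sum_congr rfl fun h _ => ?_
    change _ = Real.log (mult (edgeCol τ (π h)).2)
    rw [(h2 h (Finset.mem_univ h)).2.2, Prod.snd_swap]
  rw [e1, Finset.sum_add_distrib, e2, ← two_mul, Fintype.sum_prod_type]
  rfl

lemma exists_log_card_matchingsOn_edgeCol_le {M : Type} [Fintype M] {D k : ℕ}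
    {P : LStar M D k → ℝ} (hP0 : ∀ z, 0 ≤ P z) (hP1 : ∑ z, P z = 1)
    (hP : ∀ z z', typ z = typ z' → P z = P z') {δ : ℝ} (hδ : 0 < δ) :
    ∃ ε, 0 < ε ∧ ∀ n : ℕ, 1 ≤ n → ∀ τ : Fin n → UStar M D k,
      TypClose P ε (fun v => tyStar (τ v)) →
      (matchingsOn (edgeCol τ) Prod.swap Finset.univ).Nonempty →
      Real.log (matchingsOn (edgeCol τ) Prod.swap Finset.univ).card ≤
        (((n * (D + 1) : ℕ) : ℝ) * Real.log ((n * (D + 1) : ℕ) : ℝ) - ((n * (D + 1) : ℕ) : ℝ)) / 2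
        - ((n * (D + 1) : ℕ) : ℝ) / 2 * ∑ ab, Real.negMulLog (edgeLaw P ab)
        + ∑ v, ∑ i, Real.log (mult ((τ v).2 i)) + ((n * (D + 1) : ℕ) : ℝ) * δ
        + Fintype.card (UTree M D k × UTree M D k) *
          (Real.log ((n * (D + 1) : ℕ) : ℝ) + 1) / 2 := by
  obtain ⟨C, hC, hCb⟩ := exists_abs_edgeCount_sub_le hP1 hP
  obtain ⟨ρ, hρ, hρb⟩ := exists_abs_sum_negMulLog_sub_lt (edgeTypeLaw P) hδ
  set L : UTree M D k × UTree M D k → ℝ := fun e => Real.log (mult e.1) + Real.log (mult e.2)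
    with hL
  have hL0 : ∀ e, 0 ≤ L e := fun e =>
    add_nonneg (Real.log_natCast_nonneg _) (Real.log_natCast_nonneg _)
  set K := ∑ e, L e with hK
  have hK0 : 0 ≤ K := Finset.sum_nonneg fun e _ => hL0 e
  refine ⟨min (ρ / (2 * (C + 1))) (δ / ((C + 1) * (K + 1))), by positivity,
    fun n hn τ hτ hI => ?_⟩
  set ε := min (ρ / (2 * (C + 1))) (δ / ((C + 1) * (K + 1))) with hε
  have hε0 : 0 < ε := by positivity
  have hCε : C * ε < ρ := by
    have : ε ≤ ρ / (2 * (C + 1)) := min_le_left _ _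
    rw [le_div_iff₀ (by positivity)] at this
    nlinarith
  have hCK : C * ε * K ≤ δ := by
    have : ε ≤ δ / ((C + 1) * (K + 1)) := min_le_right _ _
    rw [le_div_iff₀ (by positivity)] at this
    have h1 : C * K ≤ (C + 1) * (K + 1) := by nlinarith
    calc C * ε * K = ε * (C * K) := by ring
      _ ≤ ε * ((C + 1) * (K + 1)) := by gcongr
      _ ≤ δ := this
  set m := n * (D + 1) with hm
  have hm1 : 1 ≤ m := Nat.one_le_iff_ne_zero.2 (by positivity)
  have hm0 : (0:ℝ) < m := by exact_mod_cast hm1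
  have hn0 : (0:ℝ) < n := by exact_mod_cast hn
  have hnm : (n:ℝ) ≤ m := by exact_mod_cast Nat.le_mul_of_pos_right n (Nat.succ_pos D)
  have hN : ∀ e, |(fibCard (edgeCol τ) Finset.univ e : ℝ) - m * edgeTypeLaw P e| ≤
      m * (C * ε) := by
    intro e
    have h := hCb ε hε0.le n τ hτ e
    rw [← mul_assoc, ← Nat.cast_mul, ← hm] at h
    refine h.trans ?_
    rw [mul_assoc, mul_comm ε C]
    gcongr
  have h1 := log_card_matchingsOn_le (edgeCol τ) Prod.swap Prod.swap_swap
    (Finset.card_pos.2 hI) m (by simp [hm]) hm1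
  have h2 := hρb (fun e => (fibCard (edgeCol τ) Finset.univ e : ℝ) / m) (fun e => by
    have : (fibCard (edgeCol τ) Finset.univ e : ℝ) / m - edgeTypeLaw P e =
      ((fibCard (edgeCol τ) Finset.univ e : ℝ) - m * edgeTypeLaw P e) / m := by field_simp
    rw [this, abs_div, abs_of_pos hm0, div_lt_iff₀ hm0]
    exact (hN e).trans_lt (by rw [mul_comm]; gcongr))
  have h3 := entropy_edgeLaw_le hP0
  rw [Finset.sum_add_distrib] at h3
  have h4 := sum_log_mult_edgeCol hI
  have h5 : m * ∑ e, edgeTypeLaw P e * L e ≤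
      2 * ∑ v, ∑ i, Real.log (mult ((τ v).2 i)) + m * δ := by
    rw [← h4]
    calc m * ∑ e, edgeTypeLaw P e * L e = ∑ e, (m * edgeTypeLaw P e) * L e := by
          rw [Finset.mul_sum]; exact Finset.sum_congr rfl fun e _ => by ring
      _ ≤ ∑ e, ((fibCard (edgeCol τ) Finset.univ e : ℝ) + m * (C * ε)) * L e :=
          Finset.sum_le_sum fun e _ => mul_le_mul_of_nonneg_right
            (by linarith [(abs_le.1 (hN e)).1]) (hL0 e)
      _ = ∑ e, (fibCard (edgeCol τ) Finset.univ e : ℝ) * L e + m * (C * ε * K) := by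
          simp only [add_mul, Finset.sum_add_distrib, ← Finset.mul_sum, hK]; ring
      _ ≤ _ := by gcongr
  have h6 : m / 2 * (∑ ab, Real.negMulLog (edgeLaw P ab)) ≤
      m / 2 * ((∑ e, Real.negMulLog (fibCard (edgeCol τ) Finset.univ e / m)) + δ +
        ∑ e, edgeTypeLaw P e * L e) := by
    gcongr
    linarith
  linarith

/-! ### Counting colored configurations -/

lemma card_clStar_fiber {M : Type} [Fintype M] {D k : ℕ} (s : UStar M D k) :
    (Finset.univ.filter fun z : LStar M D k => clStar z = s).card = ∏ i, mult (s.2 i) := by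
  have : (Finset.univ.filter fun z : LStar M D k => clStar z = s) =
      ({s.1} : Finset M) ×ˢ Fintype.piFinset
        fun i => Finset.univ.filter fun t : LTree M D k => cl k t = s.2 i := by
    ext z
    rw [Finset.mem_product, Fintype.mem_piFinset]
    simp [clStar, Prod.ext_iff, funext_iff]
  rw [this, Finset.card_product, Fintype.card_piFinset, Finset.card_singleton, one_mul]
  refine Finset.prod_congr rfl fun i _ => ?_
  unfold mult
  congr

lemma sum_mult_mul {M : Type} [Fintype M] {D k : ℕ} (w : TStar M D k → ℝ) :
    ∑ s : UStar M D k, (∏ i, (mult (s.2 i) : ℝ)) * w (tyStar s) = ∑ z, w (typ z) := by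
  rw [← Finset.sum_fiberwise Finset.univ (clStar (M := M) (D := D) (k := k))]
  refine Finset.sum_congr rfl fun s _ => ?_
  rw [Finset.sum_congr rfl (g := fun _ => w (tyStar s))
    (fun z hz => by rw [typ, (Finset.mem_filter.1 hz).2]), Finset.sum_const, nsmul_eq_mul,
    ← Nat.cast_prod, ← card_clStar_fiber]

lemma exists_pos_weight {M : Type} [Fintype M] {D k : ℕ} {P : LStar M D k → ℝ}
    (hP0 : ∀ z, 0 ≤ P z) (hP1 : ∑ z, P z = 1)
    (hP : ∀ z z', typ z = typ z' → P z = P z') {δ : ℝ} (hδ : 0 < δ) :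
    ∃ w : TStar M D k → ℝ, (∀ t, 0 < w t) ∧ ∑ z, w (typ z) = 1 ∧
      -∑ z, P z * Real.log (w (typ z)) ≤ ∑ z, Real.negMulLog (P z) + δ := by
  choose rep hrep using (typ_surjective (M := M) (D := D) (k := k))
  set L : ℝ := ((Fintype.card (LStar M D k) : ℕ) : ℝ) with hL
  have hL0 : 0 ≤ L := Nat.cast_nonneg _
  set η := δ / (L + 1) with hη
  have hη0 : 0 < η := by positivity
  have hηL : η * L ≤ δ := by
    rw [hη, div_mul_eq_mul_div, div_le_iff₀ (by positivity)]
    nlinarith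
  have hw : ∀ z, P (rep (typ z)) = P z := fun z => hP _ _ (hrep _)
  refine ⟨fun t => (P (rep t) + η) / (1 + η * L), fun t => ?_, ?_, ?_⟩
  · have := hP0 (rep t)
    positivity
  · simp only [hw]
    rw [← Finset.sum_div, Finset.sum_add_distrib, hP1, Finset.sum_const, Finset.card_univ,
      nsmul_eq_mul, mul_comm _ η, ← hL, div_self (by positivity)]
  · simp only [hw]
    have h1 : ∀ z, P z * Real.log ((P z + η) / (1 + η * L)) ≥
        -Real.negMulLog (P z) - P z * δ := by
      intro z
      have hz := hP0 z
      rcases hz.eq_or_lt with h0 | h0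
      · simp [← h0]
      rw [Real.log_div (by positivity) (by positivity), Real.negMulLog]
      have h2 : Real.log (P z) ≤ Real.log (P z + η) := Real.log_le_log h0 (by linarith)
      have h3 : Real.log (1 + η * L) ≤ δ := by
        have := Real.log_le_sub_one_of_pos (show 0 < 1 + η * L by positivity)
        linarith
      have h4 : P z * (Real.log (P z + η) - Real.log (1 + η * L)) ≥
          P z * (Real.log (P z) - δ) := by gcongr
      linarith
    have h2 := Finset.sum_le_sum fun z (_ : z ∈ Finset.univ) => h1 z
    rw [Finset.sum_sub_distrib, Finset.sum_neg_distrib, ← Finset.sum_mul, hP1] at h2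
    linarith

/-- Colored fixed-point free involutions of the half-edges with given type frequencies. -/
def cfgSet {M : Type} [Fintype M] {D k : ℕ} (P : LStar M D k → ℝ) (ε : ℝ) (n : ℕ) :
    Finset ((Fin n × Fin (D + 1) → Fin n × Fin (D + 1)) × (Fin n → M)) :=
  Finset.univ.filter fun q => (∀ h, q.1 (q.1 h) = h) ∧ (∀ h, q.1 h ≠ h) ∧
    TypClose P ε (fun v => typ (cfgStar q.2 q.1 k v))

lemma card_cfgSet_le {M : Type} [Fintype M] {D k : ℕ} (P : LStar M D k → ℝ) (ε : ℝ) (n : ℕ) :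
    (cfgSet P ε n).card ≤ ∑ τ ∈ Finset.univ.filter
      (fun τ : Fin n → UStar M D k => TypClose P ε (fun v => tyStar (τ v))),
      (matchingsOn (edgeCol τ) Prod.swap Finset.univ).card := by
  rw [← Finset.card_sigma]
  refine Finset.card_le_card_of_injOn
    (fun q => ⟨fun v => clStar (cfgStar q.2 q.1 k v), q.1⟩) ?_ ?_
  · intro q hq
    obtain ⟨-, h1, h2, h3⟩ := Finset.mem_filter.1 (Finset.mem_coe.1 hq)
    refine Finset.mem_coe.2 (Finset.mem_sigma.2 ⟨Finset.mem_filter.2 ⟨Finset.mem_univ _, h3⟩,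
      mem_matchingsOn.2 ⟨h1, fun h _ => ⟨Finset.mem_univ _, h2 h, ?_⟩,
        fun h hh => absurd (Finset.mem_univ h) hh⟩⟩)
    simp only [edgeCol, edgeU_cfgStar, h1]
    rfl
  · rintro ⟨π, f⟩ - ⟨π', f'⟩ - h
    simp only [Sigma.mk.injEq, heq_eq_eq] at h
    refine Prod.ext h.2 (funext fun v => ?_)
    exact congrArg Prod.fst (congrFun h.1 v)

lemma exists_card_cfgSet_le {M : Type} [Fintype M] {D k : ℕ}
    {P : LStar M D k → ℝ} (hP0 : ∀ z, 0 ≤ P z) (hP1 : ∑ z, P z = 1)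
    (hP : ∀ z z', typ z = typ z' → P z = P z') {δ : ℝ} (hδ : 0 < δ) :
    ∃ ε, 0 < ε ∧ ∀ n : ℕ, 1 ≤ n → ((cfgSet P ε n).card : ℝ) ≤ Real.exp
      ((((n * (D + 1) : ℕ) : ℝ) * Real.log ((n * (D + 1) : ℕ) : ℝ) - ((n * (D + 1) : ℕ) : ℝ)) / 2
        + n * (∑ z, Real.negMulLog (P z)
          - ((D + 1 : ℕ) : ℝ) / 2 * ∑ ab, Real.negMulLog (edgeLaw P ab) + δ)
        + Fintype.card (UTree M D k × UTree M D k) *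
          (Real.log ((n * (D + 1) : ℕ) : ℝ) + 1) / 2) := by
  obtain ⟨ε₁, hε₁, h₁⟩ := exists_log_card_matchingsOn_edgeCol_le hP0 hP1 hP
    (δ := δ / (3 * (D + 1))) (by positivity)
  obtain ⟨w, hw0, hw1, hw⟩ := exists_pos_weight hP0 hP1 hP (δ := δ / 3) (by positivity)
  set K : ℝ := Fintype.card (TStar M D k) * ∑ a, |Real.log (w a)| with hK
  have hK0 : 0 ≤ K := by positivity
  refine ⟨min ε₁ (δ / (3 * (K + 1))), by positivity, fun n hn => ?_⟩
  set ε := min ε₁ (δ / (3 * (K + 1))) with hε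
  have hε0 : 0 < ε := by positivity
  have hεK : ε * K ≤ δ / 3 := by
    have : ε ≤ δ / (3 * (K + 1)) := min_le_right _ _
    rw [le_div_iff₀ (by positivity)] at this
    nlinarith
  set X := (((n * (D + 1) : ℕ) : ℝ) * Real.log ((n * (D + 1) : ℕ) : ℝ)
    - ((n * (D + 1) : ℕ) : ℝ)) / 2 with hX
  set Y := Fintype.card (UTree M D k × UTree M D k) *
    (Real.log ((n * (D + 1) : ℕ) : ℝ) + 1) / 2 with hY
  set HE := ∑ ab, Real.negMulLog (edgeLaw P ab) with hHE
  set HS := ∑ z, Real.negMulLog (P z) with hHS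
  have key : ∀ τ : Fin n → UStar M D k, TypClose P ε (fun v => tyStar (τ v)) →
      ((matchingsOn (edgeCol τ) Prod.swap Finset.univ).card : ℝ) ≤
      Real.exp (X + n * (HS - ((D + 1 : ℕ) : ℝ) / 2 * HE + δ) + Y) *
        ∏ v, ((∏ i, (mult ((τ v).2 i) : ℝ)) * w (tyStar (τ v))) := by
    intro τ hτ
    have hpos : ∀ v, 0 < (∏ i, (mult ((τ v).2 i) : ℝ)) := fun v =>
      Finset.prod_pos fun i _ => by exact_mod_cast mult_pos _
    have hpos2 : 0 < ∏ v, ((∏ i, (mult ((τ v).2 i) : ℝ)) * w (tyStar (τ v))) :=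
      Finset.prod_pos fun v _ => mul_pos (hpos v) (hw0 _)
    rcases (matchingsOn (edgeCol τ) Prod.swap Finset.univ).eq_empty_or_nonempty with h0 | h0
    · rw [h0, Finset.card_empty, Nat.cast_zero]
      positivity
    have h2 := h₁ n hn τ (hτ.mono (min_le_left _ _)) h0
    rw [← Real.exp_log hpos2, ← Real.exp_add,
      ← Real.exp_log (show (0:ℝ) < (matchingsOn (edgeCol τ) Prod.swap Finset.univ).card by
        exact_mod_cast h0.card_pos), Real.exp_le_exp]
    refine h2.trans ?_
    rw [Real.log_prod (fun v _ => (mul_pos (hpos v) (hw0 _)).ne'),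
      Finset.sum_congr rfl (fun v _ => Real.log_mul (hpos v).ne' (hw0 (tyStar (τ v))).ne'),
      Finset.sum_add_distrib,
      Finset.sum_congr rfl (fun v _ => Real.log_prod (s := Finset.univ)
        (f := fun i => (mult ((τ v).2 i) : ℝ))
        fun i _ => by exact_mod_cast (mult_pos _).ne')]
    have h3 := sum_type_sub_le typ P hP1 (fun v => tyStar (τ v)) hε0.le
      (fun a => by convert hτ a) (fun a => Real.log (w a))
    have h4 := (abs_le.1 h3).1
    have h5 : (n:ℝ) * -∑ z, P z * Real.log (w (typ z)) ≤ n * (HS + δ / 3) := by gcongr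
    have h6 : n * ε * K ≤ n * (δ / 3) := by
      rw [mul_assoc]
      gcongr
    have h7 : ((n * (D + 1) : ℕ) : ℝ) * (δ / (3 * (D + 1))) = n * (δ / 3) := by
      push_cast
      field_simp
    have h8 : ((n * (D + 1) : ℕ) : ℝ) = n * ((D + 1 : ℕ) : ℝ) := by push_cast; ring
    rw [h7, ← hX, ← hY, h8]
    linarith
  calc ((cfgSet P ε n).card : ℝ)
      ≤ ∑ τ ∈ Finset.univ.filter
        (fun τ : Fin n → UStar M D k => TypClose P ε (fun v => tyStar (τ v))),
        ((matchingsOn (edgeCol τ) Prod.swap Finset.univ).card : ℝ) := by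
        exact_mod_cast card_cfgSet_le P ε n
    _ ≤ ∑ τ ∈ Finset.univ.filter
        (fun τ : Fin n → UStar M D k => TypClose P ε (fun v => tyStar (τ v))),
        Real.exp (X + n * (HS - ((D + 1 : ℕ) : ℝ) / 2 * HE + δ) + Y) *
          ∏ v, ((∏ i, (mult ((τ v).2 i) : ℝ)) * w (tyStar (τ v))) :=
        Finset.sum_le_sum fun τ hτ => key τ (Finset.mem_filter.1 hτ).2
    _ ≤ ∑ τ : Fin n → UStar M D k,
        Real.exp (X + n * (HS - ((D + 1 : ℕ) : ℝ) / 2 * HE + δ) + Y) *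
          ∏ v, ((∏ i, (mult ((τ v).2 i) : ℝ)) * w (tyStar (τ v))) :=
        Finset.sum_le_sum_of_subset_of_nonneg (Finset.filter_subset _ _) fun τ _ _ =>
          mul_nonneg (Real.exp_pos _).le (Finset.prod_nonneg fun v _ =>
            mul_nonneg (by positivity) (hw0 _).le)
    _ = Real.exp (X + n * (HS - ((D + 1 : ℕ) : ℝ) / 2 * HE + δ) + Y) := by
        rw [← Finset.mul_sum, ← Fintype.piFinset_univ, ← Finset.prod_univ_sum
          (fun _ : Fin n => (Finset.univ : Finset (UStar M D k)))
          (fun _ s => (∏ i, (mult (s.2 i) : ℝ)) * w (tyStar s)), sum_mult_mul, hw1]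
        simp

/-! ### Balls of colorings as labelled trees -/

lemma validTd_of_suffix {d : ℕ} {l l' : List ℕ} (h : l <:+ l') (hl' : ValidTd d l') :
    ValidTd d l := by
  obtain ⟨p, rfl⟩ := h
  induction p with
  | nil => exact hl'
  | cons i p ih => exact ih (validTd_tail hl')

lemma exists_cons_suffix {l l' : List ℕ} (h : l <:+ l') (hne : l' ≠ l) :
    ∃ i, (i :: l) <:+ l' := by
  obtain ⟨p, rfl⟩ := h
  obtain rfl | ⟨p, i, rfl⟩ := List.eq_nil_or_concat p
  · simp at hne
  · exact ⟨i, p, by simp⟩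

lemma suffix_of_cons_suffix {i : ℕ} {l l' : List ℕ} (h : (i :: l) <:+ l') : l <:+ l' :=
  (List.suffix_cons i l).trans h

lemma cons_suffix_inj {i j : ℕ} {l l' : List ℕ} (h : (i :: l) <:+ l') (h' : (j :: l) <:+ l') :
    i = j := by
  have := (List.suffix_of_suffix_length_le h h' (by simp)).eq_of_length (by simp)
  simpa using this

lemma lab_congr {M : Type} {D : ℕ} : ∀ k {X X' : List ℕ → M} {l : List ℕ},
    (∀ l', l <:+ l' → X l' = X' l') → lab (D := D) k X l = lab k X' l
  | 0, _, _, _, h => h _ (List.suffix_refl _)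
  | (k + 1), _, _, _, h => Prod.ext (h _ (List.suffix_refl _))
      (funext fun _ => lab_congr k fun l' hl' => h l' (suffix_of_cons_suffix hl'))

lemma exists_glue {M : Type} {D k N : ℕ} (m : M) (t : Fin N → LTree M D k)
    (ht : ∀ (i : Fin N) l, ∃ X, lab k X l = t i) (l : List ℕ) :
    ∃ X : List ℕ → M, X l = m ∧ ∀ i : Fin N, lab k X ((i.1 + 1) :: l) = t i := by
  choose X hX using fun i => ht i ((i.1 + 1) :: l)
  refine ⟨fun l' => if h : ∃ i : Fin N, ((i.1 + 1) :: l) <:+ l' then X h.choose l' else m, ?_,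
    fun i => ?_⟩
  · refine dif_neg ?_
    rintro ⟨i, hi⟩
    have := hi.length_le
    simp at this
  · rw [← hX i]
    refine lab_congr k fun l' hl' => ?_
    have h : ∃ i : Fin N, ((i.1 + 1) :: l) <:+ l' := ⟨i, hl'⟩
    refine (dif_pos h).trans ?_
    have h1 := cons_suffix_inj h.choose_spec hl'
    rw [show h.choose = i from Fin.ext (by omega)]

lemma exists_lab_eq {M : Type} {D : ℕ} : ∀ k (t : LTree M D k) l, ∃ X, lab k X l = t
  | 0, m, _ => ⟨fun _ => m, rfl⟩
  | (k + 1), t, l => by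
    obtain ⟨X, h1, h2⟩ := exists_glue t.1 t.2 (fun i => exists_lab_eq k (t.2 i)) l
    exact ⟨X, Prod.ext h1 (funext h2)⟩

lemma exists_labStar_eq {M : Type} {D k : ℕ} (z : LStar M D k) : ∃ X, labStar k X = z := by
  obtain ⟨X, h1, h2⟩ := exists_glue z.1 z.2 (fun i => exists_lab_eq k (z.2 i)) []
  exact ⟨X, Prod.ext h1 (funext h2)⟩

lemma lab_eq_iff {M : Type} {D : ℕ} {X X' : List ℕ → M} : ∀ k {l : List ℕ}, l ≠ [] →
    ValidTd (D + 1) l → (lab (D := D) k X l = lab k X' l ↔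
      ∀ l', ValidTd (D + 1) l' → l <:+ l' → l'.length ≤ l.length + k → X l' = X' l')
  | 0, l, _, hv => by
    constructor
    · intro h l' _ hs hl
      rw [← hs.eq_of_length_le (by simpa using hl)]
      exact h
    · intro h
      exact h l hv (List.suffix_refl l) le_rfl
  | (k + 1), l, hl, hv => by
    have hvi : ∀ i : Fin D, ValidTd (D + 1) ((i.1 + 1) :: l) := fun i =>
      (validTd_cons hl).2 ⟨by have := i.2; omega, hv⟩
    have e : lab (D := D) (k + 1) X l = lab (k + 1) X' l ↔ X l = X' l ∧
        ∀ i : Fin D, lab (D := D) k X ((i.1 + 1) :: l) = lab k X' ((i.1 + 1) :: l) := by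
      exact Prod.ext_iff.trans (and_congr_right fun _ => funext_iff)
    rw [e]
    constructor
    · rintro ⟨h1, h2⟩ l' hv' hs hl'
      by_cases hne : l' = l
      · rw [hne, h1]
      obtain ⟨i, hi⟩ := exists_cons_suffix hs hne
      have hi2 := ((validTd_cons hl).1 (validTd_of_suffix hi hv')).1
      obtain ⟨i, rfl⟩ : ∃ j, i = j + 1 := ⟨i - 1, by omega⟩
      exact (lab_eq_iff k (by simp) (hvi ⟨i, by omega⟩)).1 (h2 ⟨i, by omega⟩) l' hv' hi
        (by simp only [List.length_cons]; omega)
    · intro h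
      refine ⟨h l hv (List.suffix_refl l) (by omega), fun i => ?_⟩
      refine (lab_eq_iff k (by simp) (hvi i)).2 fun l' hv' hs hl' => ?_
      exact h l' hv' (suffix_of_cons_suffix hs)
        (by simp only [List.length_cons] at hl'; omega)

lemma labStar_eq_iff {M : Type} {D k : ℕ} {X X' : List ℕ → M} :
    labStar (D := D) k X = labStar k X' ↔
      ∀ l, ValidTd (D + 1) l → l.length ≤ k + 1 → X l = X' l := by
  have hvi : ∀ i : Fin (D + 1), ValidTd (D + 1) [i.1 + 1] := fun i =>
    validTd_singleton.2 (by have := i.2; omega)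
  have e : labStar (D := D) k X = labStar k X' ↔ X [] = X' [] ∧
      ∀ i : Fin (D + 1), lab (D := D) k X [i.1 + 1] = lab k X' [i.1 + 1] := by
    simp only [labStar]
    rw [Prod.mk.injEq, funext_iff]
  rw [e]
  constructor
  · rintro ⟨h1, h2⟩ l' hv' hl'
    by_cases hne : l' = []
    · rw [hne, h1]
    obtain ⟨i, hi⟩ := exists_cons_suffix (List.nil_suffix (l := l')) hne
    have hi2 := validTd_singleton.1 (validTd_of_suffix hi hv')
    obtain ⟨i, rfl⟩ : ∃ j, i = j + 1 := ⟨i - 1, by omega⟩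
    exact (lab_eq_iff k (by simp) (hvi ⟨i, by omega⟩)).1 (h2 ⟨i, by omega⟩) l' hv' hi
      (by simp only [List.length_cons, List.length_nil]; omega)
  · intro h
    refine ⟨h [] (rootTd (D + 1)).2 (by simp), fun i => ?_⟩
    refine (lab_eq_iff k (by simp) (hvi i)).2 fun l' hv' _ hl' => ?_
    exact h l' hv' (by simp only [List.length_cons, List.length_nil] at hl'; omega)

lemma trL_lab {M : Type} {D : ℕ} {X : List ℕ → M} : ∀ k (l : List ℕ),
    trL k (lab (D := D) (k + 1) X l) = lab k X l
  | 0, _ => rfl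
  | (k + 1), l => Prod.ext rfl (funext fun i => trL_lab k ((i.1 + 1) :: l))

lemma rootSideL_labStar_succ {M : Type} {D k : ℕ} {X : List ℕ → M} :
    rootSideL (k + 1) (labStar (D := D) (k + 1) X) 0 =
      (X [], fun j : Fin D => lab k X [j.1 + 2]) :=
  Prod.ext rfl (funext fun j => by
    change trL k (lab (k + 1) X [((0 : Fin (D + 1)).succAbove j).1 + 1]) = _
    rw [trL_lab]
    simp)

lemma edge_labStar_eq_iff {M : Type} {D k : ℕ} {X X' : List ℕ → M} :
    ((rootSideL k (labStar (D := D) k X) 0, (labStar (D := D) k X).2 0) =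
      (rootSideL k (labStar k X') 0, (labStar k X').2 0)) ↔
      ∀ l, ValidTd (D + 1) l → (l.length + 1 ≤ k + 1 ∨ (l.getLast? = some 1 ∧ l.length ≤ k + 1)) →
        X l = X' l := by
  have h1 : ValidTd (D + 1) [1] := validTd_singleton.2 (by omega)
  have e1 : (labStar (D := D) k X).2 0 = (labStar k X').2 0 ↔
      ∀ l', ValidTd (D + 1) l' → [1] <:+ l' → l'.length ≤ k + 1 → X l' = X' l' := by
    have := lab_eq_iff (X := X) (X' := X') k (by simp) h1
    rw [List.length_singleton, add_comm 1 k] at this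
    exact this
  have e2 : rootSideL k (labStar (D := D) k X) 0 = rootSideL k (labStar k X') 0 ↔
      X [] = X' [] ∧ ∀ i l', i ≠ 1 → ValidTd (D + 1) l' → [i] <:+ l' → l'.length ≤ k →
        X l' = X' l' := by
    cases k with
    | zero =>
      change X [] = X' [] ↔ _
      refine ⟨fun h => ⟨h, fun i l' _ _ hi hl => ?_⟩, fun h => h.1⟩
      have := hi.length_le
      simp only [List.length_singleton] at this
      omega
    | succ k =>
      rw [rootSideL_labStar_succ, rootSideL_labStar_succ]
      refine Prod.ext_iff.trans (and_congr_right fun _ => funext_iff.trans ?_)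
      have hvj : ∀ j : Fin D, ValidTd (D + 1) [j.1 + 2] := fun j =>
        validTd_singleton.2 (by have := j.2; omega)
      constructor
      · intro h i l' hi1 hv hi hl
        have hi2 := validTd_singleton.1 (validTd_of_suffix hi hv)
        obtain ⟨i, rfl⟩ : ∃ j, i = j + 2 := ⟨i - 2, by omega⟩
        exact (lab_eq_iff k (by simp) (hvj ⟨i, by omega⟩)).1 (h ⟨i, by omega⟩) l' hv hi
          (by simp only [List.length_singleton]; omega)
      · intro h j
        refine (lab_eq_iff k (by simp) (hvj j)).2 fun l' hv' hs hl' => ?_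
        exact h _ l' (by omega) hv' hs (by simp only [List.length_singleton] at hl'; omega)
  rw [Prod.mk.injEq, e1, e2]
  constructor
  · rintro ⟨⟨ha, hb⟩, hc⟩ l hv hl
    by_cases hne : l = []
    · rw [hne, ha]
    obtain ⟨i, hi⟩ := exists_cons_suffix (List.nil_suffix (l := l)) hne
    by_cases hi1 : i = 1
    · subst hi1
      exact hc l hv hi (by omega)
    · refine hb i l hi1 hv hi ?_
      rcases hl with hl | ⟨hl, -⟩
      · omega
      · exfalso
        obtain ⟨p, rfl⟩ := hi
        simp at hl
        exact hi1 hl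
  · intro h
    refine ⟨⟨h [] (rootTd (D + 1)).2 (by simp), fun i l' _ hv _ hl => h l' hv (by omega)⟩,
      fun l' hv hs hl => h l' hv (Or.inr ⟨?_, hl⟩)⟩
    obtain ⟨p, rfl⟩ := hs
    simp

/-! ### Automorphisms of the regular tree -/

/-- The map on labels twisting the steps below each vertex by a permutation. -/
def twist (S : List ℕ → List ℕ → Equiv.Perm ℕ) : List ℕ → List ℕ
  | [] => []
  | i :: l => S l (twist S l) i :: twist S l

/-- The inverse of `twist`. -/
def untwist (S : List ℕ → List ℕ → Equiv.Perm ℕ) : List ℕ → List ℕ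
  | [] => []
  | j :: m => (S (untwist S m) m).symm j :: untwist S m

lemma untwist_twist (S : List ℕ → List ℕ → Equiv.Perm ℕ) (l : List ℕ) :
    untwist S (twist S l) = l := by
  induction l with
  | nil => rfl
  | cons i l ih => simp [twist, untwist, ih]

lemma twist_untwist (S : List ℕ → List ℕ → Equiv.Perm ℕ) (l : List ℕ) :
    twist S (untwist S l) = l := by
  induction l with
  | nil => rfl
  | cons i l ih => simp [twist, untwist, ih]

lemma length_twist (S : List ℕ → List ℕ → Equiv.Perm ℕ) (l : List ℕ) :
    (twist S l).length = l.length := by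
  induction l with
  | nil => rfl
  | cons i l ih => simp [twist, ih]

/-- The range of admissible steps below a vertex. -/
def StepRange (D : ℕ) (l : List ℕ) (i : ℕ) : Prop := 1 ≤ i ∧ i ≤ if l = [] then D + 1 else D

lemma validTd_cons_iff {D i : ℕ} {l : List ℕ} :
    ValidTd (D + 1) (i :: l) ↔ StepRange D l i ∧ ValidTd (D + 1) l := by
  by_cases hl : l = []
  · subst hl
    rw [validTd_singleton, StepRange, if_pos rfl]
    exact (and_iff_left (rootTd (D + 1)).2).symm
  · rw [validTd_cons hl, StepRange, if_neg hl, Nat.add_sub_cancel]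

lemma stepRange_twist {D : ℕ} (S : List ℕ → List ℕ → Equiv.Perm ℕ) (l : List ℕ) (i : ℕ) :
    StepRange D (twist S l) i ↔ StepRange D l i := by
  cases l <;> simp [StepRange, twist]

lemma validTd_twist {D : ℕ} {S : List ℕ → List ℕ → Equiv.Perm ℕ}
    (hS : ∀ l m i, StepRange D l (S l m i) ↔ StepRange D l i) (l : List ℕ) :
    ValidTd (D + 1) (twist S l) ↔ ValidTd (D + 1) l := by
  induction l with
  | nil => rfl
  | cons i l ih => rw [twist, validTd_cons_iff, validTd_cons_iff, stepRange_twist, hS, ih]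

/-- The automorphism of the regular tree given by a family of permutations. -/
def twistIso {D : ℕ} (S : List ℕ → List ℕ → Equiv.Perm ℕ)
    (hS : ∀ l m i, StepRange D l (S l m i) ↔ StepRange D l i) :
    TdGraph (D + 1) ≃g TdGraph (D + 1) where
  toFun v := ⟨twist S v.1, (validTd_twist hS v.1).2 v.2⟩
  invFun v := ⟨untwist S v.1, (validTd_twist hS _).1 (by rw [twist_untwist]; exact v.2)⟩
  left_inv v := Subtype.ext (untwist_twist S v.1)
  right_inv v := Subtype.ext (twist_untwist S v.1)
  map_rel_iff' {v w} := by
    have key : ∀ l l' : List ℕ, (∃ i, twist S l' = i :: twist S l) ↔ ∃ i, l' = i :: l := by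
      intro l l'
      constructor
      · rintro ⟨i, h⟩
        have := congrArg (untwist S) h
        rw [untwist_twist, untwist, untwist_twist] at this
        exact ⟨_, this⟩
      · rintro ⟨i, rfl⟩
        exact ⟨_, rfl⟩
    exact or_congr (key v.1 w.1) (key w.1 v.1)

lemma exists_perm_nat {N : ℕ} (σ : Equiv.Perm (Fin N)) : ∃ ρ : Equiv.Perm ℕ,
    (∀ i : Fin N, ρ (i.1 + 1) = (σ i).1 + 1) ∧ ∀ i, (1 ≤ ρ i ∧ ρ i ≤ N) ↔ (1 ≤ i ∧ i ≤ N) := by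
  let e : Fin N ≃ {m : ℕ // 1 ≤ m ∧ m ≤ N} :=
    { toFun := fun i => ⟨i.1 + 1, by have := i.2; omega⟩
      invFun := fun m => ⟨m.1 - 1, by have := m.2; omega⟩
      left_inv := fun i => by simp
      right_inv := fun m => Subtype.ext (by have := m.2; simp only; omega) }
  have h1 : ∀ i : Fin N, σ.extendDomain e (i.1 + 1) = (σ i).1 + 1 := fun i =>
    σ.extendDomain_apply_image e i
  refine ⟨σ.extendDomain e, h1, fun i => ?_⟩
  by_cases hi : 1 ≤ i ∧ i ≤ N
  · obtain ⟨j, rfl⟩ : ∃ j, i = j + 1 := ⟨i - 1, by omega⟩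
    have := h1 ⟨j, by omega⟩
    simp only at this
    rw [this]
    have := (σ ⟨j, by omega⟩).2
    omega
  · rw [σ.extendDomain_apply_not_subtype e hi]

lemma exists_step_perm {D j : ℕ} {M : Type} {X X' : List ℕ → M} {l m : List ℕ} {N : ℕ}
    (hN : ∀ i, StepRange D l i ↔ 1 ≤ i ∧ i ≤ N)
    (h : symOf (fun i : Fin N => cl (D := D) j (lab j X ((i.1 + 1) :: m))) =
      symOf (fun i : Fin N => cl (D := D) j (lab j X' ((i.1 + 1) :: l)))) :
    ∃ ρ : Equiv.Perm ℕ, (∀ i, StepRange D l (ρ i) ↔ StepRange D l i) ∧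
      ∀ i, StepRange D l i → cl (D := D) j (lab j X (ρ i :: m)) = cl j (lab j X' (i :: l)) := by
  obtain ⟨σ, hσ⟩ := exists_perm_of_symOf_eq h
  obtain ⟨ρ, h1, h2⟩ := exists_perm_nat σ
  refine ⟨ρ, fun i => by rw [hN, hN, h2], fun i hi => ?_⟩
  obtain ⟨i, rfl⟩ : ∃ j, i = j + 1 := ⟨i - 1, by have := (hN i).1 hi; omega⟩
  have hi2 := (hN _).1 hi
  have h3 := h1 ⟨i, by omega⟩
  simp only at h3
  rw [h3]
  exact hσ ⟨i, by omega⟩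

lemma eq_of_cl_lab_eq {M : Type} {D : ℕ} {X X' : List ℕ → M} {l l' : List ℕ} : ∀ {j},
    cl (D := D) j (lab j X l) = cl j (lab j X' l') → X l = X' l'
  | 0, h => h
  | (_ + 1), h => congrArg Prod.fst h

lemma exists_iso_of_typ_eq {M : Type} {D k : ℕ} {X X' : List ℕ → M}
    (h : typ (labStar (D := D) k X) = typ (labStar k X')) :
    ∃ φ : TdGraph (D + 1) ≃g TdGraph (D + 1), (∀ v, (φ v).1.length = v.1.length) ∧
      ∀ v, v.1.length ≤ k + 1 → X (φ v).1 = X' v.1 := by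
  let Good : List ℕ → List ℕ → Equiv.Perm ℕ → Prop := fun l m ρ =>
    (∀ i, StepRange D l (ρ i) ↔ StepRange D l i) ∧
    ∀ i, StepRange D l i → cl (D := D) (k - l.length) (lab (k - l.length) X (ρ i :: m)) =
      cl (k - l.length) (lab (k - l.length) X' (i :: l))
  let S : List ℕ → List ℕ → Equiv.Perm ℕ := fun l m =>
    if hρ : ∃ ρ, Good l m ρ then hρ.choose else 1
  have hS : ∀ l m i, StepRange D l (S l m i) ↔ StepRange D l i := by
    intro l m i
    by_cases hρ : ∃ ρ, Good l m ρ
    · simp only [S, dif_pos hρ]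
      exact hρ.choose_spec.1 i
    · simp only [S, dif_neg hρ, Equiv.Perm.one_apply]
  have hgood : ∀ l m, (∃ ρ, Good l m ρ) → ∀ i, StepRange D l i →
      cl (D := D) (k - l.length) (lab (k - l.length) X (S l m i :: m)) =
      cl (k - l.length) (lab (k - l.length) X' (i :: l)) := by
    intro l m hρ i hi
    simp only [S, dif_pos hρ]
    exact hρ.choose_spec.2 i hi
  have hinv : ∀ l, l ≠ [] → ValidTd (D + 1) l → l.length ≤ k + 1 →
      cl (D := D) (k + 1 - l.length) (lab _ X (twist S l)) = cl _ (lab _ X' l) := by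
    intro l
    induction l with
    | nil => exact fun h => absurd rfl h
    | cons i l ih =>
      intro _ hv hl
      rw [List.length_cons] at hl
      rw [List.length_cons, Nat.add_sub_add_right, twist]
      refine hgood l (twist S l) ?_ i (validTd_cons_iff.1 hv).1
      by_cases hne : l = []
      · subst hne
        exact exists_step_perm (N := D + 1) (fun i => by simp [StepRange])
          (congrArg Prod.snd h)
      · have h1 := ih hne (validTd_tail hv) (by omega)
        rw [show k + 1 - l.length = k - l.length + 1 by omega] at h1
        exact exists_step_perm (N := D) (fun i => by simp [StepRange, hne])
          (congrArg Prod.snd h1)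
  refine ⟨twistIso S hS, fun v => length_twist S v.1, fun v hv => ?_⟩
  by_cases hne : v.1 = []
  · change X (twist S v.1) = X' v.1
    rw [hne]
    exact congrArg Prod.fst h
  · exact eq_of_cl_lab_eq (hinv v.1 hne v.2 hv)

/-! ### The annealed entropy as an entropy of labelled balls -/

instance countable_tdVertex (d : ℕ) : Countable (TdVertex d) :=
  inferInstanceAs (Countable {l : List ℕ // ValidTd d l})

/-- The law of the labelled ball of radius `k + 1` around the root. -/
def ballLaw {M : Type} [MeasurableSpace M] {D : ℕ} (k : ℕ) (μ : Measure (TdVertex (D + 1) → M))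
    (z : LStar M D k) : ℝ :=
  μ.real {x | labStar k (extTd x) = z}

lemma shannon_map_eq_sum {Ω β γ : Type*} [MeasurableSpace Ω] [MeasurableSpace β]
    [MeasurableSingletonClass β] [Fintype γ] (μ : Measure Ω) {R : Ω → β} {T : Ω → γ}
    (hR : Measurable R) (hsurj : Function.Surjective R)
    (h : ∀ x x', R x = R x' ↔ T x = T x') :
    shannon (μ.map R) = ∑ c, Real.negMulLog (μ.real {x | T x = c}) := by
  have hs : ∀ b, R (Function.surjInv hsurj b) = b := Function.surjInv_eq hsurj
  set g : β → γ := fun b => T (Function.surjInv hsurj b) with hg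
  have hgR : ∀ x, g (R x) = T x := fun x => (h _ _).1 (hs _)
  have hinj : Function.Injective g := fun b b' hb => by
    have := (h _ _).2 hb
    rwa [hs, hs] at this
  have h1 : ∀ b, Real.negMulLog ((μ.map R) {b}).toReal =
      (fun c => Real.negMulLog (μ.real {x | T x = c})) (g b) := by
    intro b
    rw [Measure.map_apply hR (measurableSet_singleton b)]
    have : R ⁻¹' {b} = {x | T x = g b} := by
      ext x
      rw [Set.mem_preimage, Set.mem_singleton_iff, Set.mem_ofPred_eq, ← hgR]
      exact hinj.eq_iff.symm
    rw [this]
    rfl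
  unfold shannon
  rw [tsum_congr h1]
  refine (hinj.tsum_eq (f := fun c => Real.negMulLog (μ.real {x | T x = c})) ?_).trans
    (tsum_fintype _)
  intro c hc
  by_contra hcr
  apply hc
  have : {x | T x = c} = ∅ := by
    ext x
    simp only [Set.mem_ofPred_eq, Set.mem_empty_iff_false, iff_false]
    intro hx
    exact hcr ⟨R x, by rw [hgR, hx]⟩
  change Real.negMulLog (μ.real {x | T x = c}) = 0
  rw [this]
  simp

lemma extTd_of_valid {M : Type} {d : ℕ} (x : TdVertex d → M) {l : List ℕ} (h : ValidTd d l) :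
    extTd x l = x ⟨l, h⟩ := dif_pos h

lemma measurableSet_labStar_eq {M : Type} [MeasurableSpace M] [DiscreteMeasurableSpace M]
    {D k : ℕ} (z : LStar M D k) :
    MeasurableSet {x : TdVertex (D + 1) → M | labStar k (extTd x) = z} := by
  obtain ⟨X, rfl⟩ := exists_labStar_eq z
  have : {x : TdVertex (D + 1) → M | labStar (D := D) k (extTd x) = labStar k X} =
      ⋂ v : TdVertex (D + 1), {x | v.1.length ≤ k + 1 → x v = X v.1} := by
    ext x
    rw [Set.mem_ofPred_eq, labStar_eq_iff, Set.mem_iInter]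
    constructor
    · intro h v hv
      rw [← h v.1 v.2 hv, extTd_of_valid x v.2]
      rfl
    · intro h l hl hlk
      rw [extTd_of_valid x hl]
      exact h ⟨l, hl⟩ hlk
  rw [this]
  refine MeasurableSet.iInter fun v => ?_
  by_cases hv : v.1.length ≤ k + 1
  · simp only [hv, true_imp_iff]
    exact (measurable_pi_apply (X := fun _ => M) v) (MeasurableSet.of_discrete (s := {X v.1}))
  · simp [hv]

lemma ballLaw_nonneg {M : Type} [MeasurableSpace M] {D k : ℕ}
    (μ : Measure (TdVertex (D + 1) → M)) (z : LStar M D k) : 0 ≤ ballLaw k μ z :=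
  measureReal_nonneg

lemma sum_ballLaw_filter {M : Type} [Fintype M] [MeasurableSpace M] [DiscreteMeasurableSpace M]
    {D k : ℕ} (μ : Measure (TdVertex (D + 1) → M)) [IsProbabilityMeasure μ]
    (p : LStar M D k → Prop) [DecidablePred p] :
    ∑ z, (if p z then ballLaw k μ z else 0) = μ.real {x | p (labStar k (extTd x))} := by
  rw [← Finset.sum_filter]
  unfold ballLaw
  have := sum_measureReal_preimage_singleton (μ := μ) (Finset.univ.filter p)
    (f := fun x => labStar (D := D) k (extTd x)) (fun z _ => measurableSet_labStar_eq z)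
  refine this.trans ?_
  congr 1
  ext x
  simp

lemma sum_ballLaw {M : Type} [Fintype M] [MeasurableSpace M] [DiscreteMeasurableSpace M]
    {D k : ℕ} (μ : Measure (TdVertex (D + 1) → M)) [IsProbabilityMeasure μ] :
    ∑ z : LStar M D k, ballLaw k μ z = 1 := by
  have := sum_ballLaw_filter (k := k) μ (fun _ => True)
  simpa using this

lemma ballLaw_eq_of_typ_eq {M : Type} [MeasurableSpace M] [DiscreteMeasurableSpace M]
    {D k : ℕ} {μ : Measure (TdVertex (D + 1) → M)} (hμ : μ ∈ InvMeas (M := M) (D + 1))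
    {z z' : LStar M D k} (h : typ z = typ z') : ballLaw k μ z = ballLaw k μ z' := by
  obtain ⟨X, rfl⟩ := exists_labStar_eq z
  obtain ⟨X', rfl⟩ := exists_labStar_eq z'
  obtain ⟨φ, hφ, hX⟩ := exists_iso_of_typ_eq h
  have hm : Measurable fun x : TdVertex (D + 1) → M => fun v => x (φ v) :=
    measurable_pi_lambda _ fun v => measurable_pi_apply _
  unfold ballLaw Measure.real
  conv_rhs => rw [← hμ.2 φ]
  rw [Measure.map_apply hm (measurableSet_labStar_eq _)]
  congr 2
  ext x
  rw [Set.mem_preimage, Set.mem_ofPred_eq, Set.mem_ofPred_eq, labStar_eq_iff, labStar_eq_iff]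
  constructor
  · intro hx l hl hlk
    rw [extTd_of_valid _ hl, ← hX ⟨l, hl⟩ hlk]
    have h2 := hx _ (φ ⟨l, hl⟩).2 ((hφ ⟨l, hl⟩).trans_le hlk)
    rw [extTd_of_valid _ (φ ⟨l, hl⟩).2] at h2
    exact h2
  · intro hx l hl hlk
    obtain ⟨w, hw⟩ := φ.surjective ⟨l, hl⟩
    have hlw : w.1.length ≤ k + 1 := by
      rw [← hφ, hw]
      exact hlk
    have h2 := hx _ w.2 hlw
    have h3 := hX w hlw
    rw [extTd_of_valid _ w.2] at h2
    rw [extTd_of_valid _ hl]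
    change x (φ w) = X' w.1 at h2
    rw [hw] at h2 h3
    rw [h2]
    exact h3.symm

lemma shannon_restrictTo {M : Type} [MeasurableSpace M]
    [DiscreteMeasurableSpace M] {d : ℕ} {γ : Type*} [Fintype γ] (μ : Measure (TdVertex d → M))
    {S : Set (TdVertex d)} (hS : rootTd d ∈ S) {T : (TdVertex d → M) → γ}
    (hT : ∀ x x', T x = T x' ↔ ∀ l, ∀ hl : ValidTd d l, (⟨l, hl⟩ : TdVertex d) ∈ S →
      extTd x l = extTd x' l) :
    shannon (restrictTo S μ) = ∑ c, Real.negMulLog (μ.real {x | T x = c}) := by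
  refine shannon_map_eq_sum μ (measurable_pi_lambda _ fun v => measurable_pi_apply _) ?_ ?_
  · intro y
    refine ⟨fun v => if h : v ∈ S then y ⟨v, h⟩ else y ⟨_, hS⟩, ?_⟩
    funext v
    exact dif_pos v.2
  · intro x x'
    rw [hT, funext_iff]
    constructor
    · intro h l hl hlS
      rw [extTd_of_valid _ hl, extTd_of_valid _ hl]
      exact h ⟨_, hlS⟩
    · intro h v
      have := h v.1.1 v.1.2 v.2
      rwa [extTd_of_valid _ v.1.2, extTd_of_valid _ v.1.2] at this

lemma sigmaR_eq {M : Type} [Fintype M] [MeasurableSpace M] [DiscreteMeasurableSpace M]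
    {D : ℕ} (k : ℕ) (μ : Measure (TdVertex (D + 1) → M)) [IsProbabilityMeasure μ] :
    SigmaR (D + 1) (k + 1) μ = ∑ z : LStar M D k, Real.negMulLog (ballLaw k μ z) -
      ((D + 1 : ℕ) : ℝ) / 2 *
        ∑ ab, Real.negMulLog (edgeLaw (ballLaw (M := M) (D := D) k μ) ab) := by
  unfold SigmaR
  congr 1
  · exact shannon_restrictTo μ (Nat.zero_le _) fun x x' => labStar_eq_iff
  · congr 1
    rw [shannon_restrictTo μ (root_mem_Er _ _ (Nat.le_add_left 1 k))
      (T := fun x => (rootSideL k (labStar (D := D) k (extTd x)) 0,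
        (labStar (D := D) k (extTd x)).2 0)) fun x x' => edge_labStar_eq_iff]
    refine Finset.sum_congr rfl fun ab _ => ?_
    congr 1
    refine (sum_ballLaw_filter μ fun z : LStar M D k => (rootSideL k z 0, z.2 0) = ab).symm.trans ?_
    rfl

/-! ### Closeness of local statistics -/

lemma resS_resS_of_le {M : Type} {s r : ℕ} (h : s ≤ r) (g : RCG M) :
    resS s (resS r g) = resS s g := by
  refine RCG.ext ?_ ?_
  · funext l
    simp only [resS]
    split_ifs <;> first | rfl | omega
  · funext p
    simp only [resS]
    by_cases hp : p.1.length ≤ s ∧ p.2.length ≤ s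
    · have : p.1.length ≤ r ∧ p.2.length ≤ r := by omega
      simp [hp, this]
    · simp [hp]

lemma summable_rcgDist {M : Type} (a b : RCG M) : Summable
    (fun r : ℕ => if resS r a = resS r b then (0 : ℝ) else (2 : ℝ)⁻¹ ^ r) := by
  refine Summable.of_nonneg_of_le (fun r => ?_) (fun r => ?_)
    (summable_geometric_of_lt_one (by norm_num) (by norm_num : (2 : ℝ)⁻¹ < 1))
  · split_ifs <;> positivity
  · split_ifs
    · positivity
    · exact le_rfl

lemma resS_eq_of_dist_lt {M : Type} {g g' : RCG M} {r : ℕ} (h : dist g g' < 2⁻¹ ^ r) :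
    resS r g = resS r g' := by
  by_contra hne
  have h1 := (summable_rcgDist g g').le_tsum r fun j _ => by split_ifs <;> positivity
  rw [if_neg hne] at h1
  exact absurd h (not_lt.2 h1)

lemma dist_le_of_resS_eq {M : Type} {g g' : RCG M} {r : ℕ} (h : resS r g = resS r g') :
    dist g g' ≤ 2 * 2⁻¹ ^ r := by
  have h0 : ∀ s ≤ r, resS s g = resS s g' := fun s hs => by
    rw [← resS_resS_of_le hs g, h, resS_resS_of_le hs]
  have hs := summable_rcgDist g g'
  change ∑' r : ℕ, (if resS r g = resS r g' then (0 : ℝ) else (2 : ℝ)⁻¹ ^ r) ≤ _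
  rw [← hs.sum_add_tsum_nat_add r, Finset.sum_eq_zero, zero_add]
  · have hg : Summable fun s : ℕ => (2 : ℝ)⁻¹ ^ s :=
      summable_geometric_of_lt_one (by norm_num) (by norm_num)
    refine (Summable.tsum_le_tsum (g := fun s => (2 : ℝ)⁻¹ ^ s * 2⁻¹ ^ r) (fun s => ?_)
      ((summable_nat_add_iff r).2 hs) (hg.mul_right _)).trans ?_
    · split_ifs
      · positivity
      · rw [pow_add]
    · rw [tsum_mul_right, tsum_geometric_of_lt_one (by norm_num) (by norm_num)]
      norm_num
  · intro s hs
    rw [if_pos (h0 s (Finset.mem_range.1 hs).le)]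

lemma isOpen_resS_mem {M : Type} (r : ℕ) (S : Set (RCG M)) : IsOpen {g | resS r g ∈ S} := by
  rw [Metric.isOpen_iff]
  intro g hg
  refine ⟨2⁻¹ ^ r, by positivity, fun g' hg' => ?_⟩
  rw [Set.mem_ofPred_eq, resS_eq_of_dist_lt hg']
  exact hg

lemma measurable_resS {M : Type} (r : ℕ) : Measurable (resS (M := M) r) :=
  fun S _ => (isOpen_resS_mem r S).measurableSet

lemma resS_iotaTd_eq {M : Type} {D k : ℕ} {x x' : TdVertex (D + 1) → M}
    (h : labStar (D := D) k (extTd x) = labStar k (extTd x')) :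
    resS (k + 1) (iotaTd (D + 1) x) = resS (k + 1) (iotaTd (D + 1) x') := by
  rw [labStar_eq_iff] at h
  refine RCG.ext ?_ rfl
  funext l
  simp only [resS, iotaTd]
  by_cases hk : l.length ≤ k + 1
  · by_cases hl : ValidTd (D + 1) l
    · have := h l hl hk
      rw [extTd_of_valid _ hl, extTd_of_valid _ hl] at this
      simp [hl, this]
    · simp [hl]
  · simp [hk]

lemma measurable_iotaTd {M : Type} [Fintype M] [MeasurableSpace M] [DiscreteMeasurableSpace M]
    (D : ℕ) : Measurable (iotaTd (M := M) (D + 1)) := by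
  refine measurable_of_isOpen fun U hU => ?_
  have : iotaTd (D + 1) ⁻¹' U = ⋃ k : ℕ, ⋃ z : LStar M D k, ⋃ _ : ∃ x' : TdVertex (D + 1) → M,
      labStar k (extTd x') = z ∧ {g | resS (k + 1) g = resS (k + 1) (iotaTd (D + 1) x')} ⊆ U,
      {x : TdVertex (D + 1) → M | labStar (D := D) k (extTd x) = z} := by
    ext x
    simp only [Set.mem_preimage, Set.mem_iUnion, Set.mem_ofPred_eq, exists_prop]
    constructor
    · intro hx
      obtain ⟨ε, hε, hU'⟩ := Metric.isOpen_iff.1 hU _ hx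
      obtain ⟨k, hk⟩ := exists_pow_lt_of_lt_one hε (by norm_num : (2 : ℝ)⁻¹ < 1)
      refine ⟨k, labStar k (extTd x), ⟨x, rfl, fun g hg => hU' ?_⟩, rfl⟩
      refine (dist_le_of_resS_eq hg).trans_lt ?_
      rw [pow_succ]
      linarith
    · rintro ⟨k, z, ⟨x', hx', hU'⟩, hx⟩
      exact hU' (resS_iotaTd_eq (hx.trans hx'.symm))
  rw [this]
  exact MeasurableSet.iUnion fun k => MeasurableSet.iUnion fun z => MeasurableSet.iUnion fun _ =>
    measurableSet_labStar_eq z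

lemma distrAt_le {M : Type} {n : ℕ} {G : SimpleGraph (Fin n)} {f : Fin n → M} {v : Fin n}
    {S : Set (RCG M)} (hS : MeasurableSet S) {p : Prop} [Decidable p] (h : ∀ σ, bfsRCG G f v σ ∈ S → p) :
    distrAt G f v S ≤ if p then 1 else 0 := by
  unfold distrAt
  rw [Measure.smul_apply, Measure.finsetSum_apply, smul_eq_mul]
  have h1 : ∑ σ : Equiv.Perm (Fin n), Measure.dirac (bfsRCG G f v σ) S ≤
      ∑ _σ : Equiv.Perm (Fin n), (if p then 1 else 0 : ℝ≥0∞) := by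
    refine Finset.sum_le_sum fun σ _ => ?_
    rw [Measure.dirac_apply' _ hS, Set.indicator_apply]
    split_ifs with h2 h3 h3
    · exact le_rfl
    · exact absurd (h σ h2) h3
    · exact zero_le_one
    · exact le_rfl
  refine (mul_le_mul_right h1 _).trans ?_
  rw [Finset.sum_const, Finset.card_univ, Fintype.card_perm, Fintype.card_fin, nsmul_eq_mul,
    ← mul_assoc, ENNReal.inv_mul_cancel (by simp [Nat.factorial_ne_zero]) (by simp), one_mul]

lemma distrG_le {M : Type} {n : ℕ} {G : SimpleGraph (Fin n)} {f : Fin n → M}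
    {S : Set (RCG M)} (hS : MeasurableSet S) {p : Fin n → Prop} [DecidablePred p]
    (h : ∀ v σ, bfsRCG G f v σ ∈ S → p v) :
    distrG G f S ≤ (n : ℝ≥0∞)⁻¹ * ((Finset.univ.filter p).card : ℝ≥0∞) := by
  unfold distrG
  rw [Measure.smul_apply, Measure.finsetSum_apply, smul_eq_mul]
  refine mul_le_mul_right ?_ _
  rw [Finset.card_filter, Nat.cast_sum]
  refine Finset.sum_le_sum fun v _ => (distrAt_le hS (h v)).trans ?_
  split_ifs <;> simp

lemma typClose_of_mem_FSet {M : Type} [Fintype M] [MeasurableSpace M] [DiscreteMeasurableSpace M]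
    {D k n : ℕ} {μ : Measure (TdVertex (D + 1) → M)} [IsProbabilityMeasure μ] {ε ε' : ℝ}
    (hε : ε < ε') (hε' : ε' ≤ 2⁻¹ ^ (k + 1)) (hε0 : 0 < ε') (hn : 1 ≤ n)
    {G : SimpleGraph (Fin n)} {f : Fin n → M} (hf : f ∈ FSet (D + 1) μ (k + 1) ε G)
    {π : Fin n × Fin (D + 1) → Fin n × Fin (D + 1)} (hπ : ∀ h, π (π h) = h)
    (hG : ∀ u w, G.Adj u w → ∃ j, (π (u, j)).1 = w) :
    TypClose (ballLaw k μ) ε' fun v => typ (cfgStar f π k v) := by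
  intro a
  have hn0 : (n : ℝ≥0∞) ≠ 0 := by exact_mod_cast (by omega : n ≠ 0)
  have hιm := measurable_iotaTd (M := M) D
  have hrm := measurable_resS (M := M) (k + 1)
  set B : Set (RCG M) := {g | resS (k + 1) g ∈ {c | ∃ x : TdVertex (D + 1) → M,
    typ (labStar (D := D) k (extTd x)) = a ∧ c = resS (k + 1) (iotaTd (D + 1) x)}} with hB
  have hBm : MeasurableSet B := (isOpen_resS_mem _ _).measurableSet
  have hpre : resS (k + 1) ⁻¹' B = B := by
    ext g
    simp only [hB, Set.mem_preimage, Set.mem_ofPred_eq, resS_resS_of_le le_rfl]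
  have : IsFiniteMeasure (distrG G f) := by
    refine ⟨(distrG_le MeasurableSet.univ (p := fun _ => True) fun _ _ _ => trivial).trans_lt ?_⟩
    exact ENNReal.mul_lt_top (ENNReal.inv_lt_top.2 (pos_iff_ne_zero.2 hn0)) (by simp)
  have : IsFiniteMeasure (lawTd (D + 1) μ) := by
    unfold lawTd
    infer_instance
  have hdist : levyProkhorovEDist ((distrG G f).map (resS (k + 1)))
      ((lawTd (D + 1) μ).map (resS (k + 1))) < ENNReal.ofReal ε' := by
    rw [← ENNReal.ofReal_toReal (levyProkhorovEDist_ne_top _ _)]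
    exact (ENNReal.ofReal_lt_ofReal_iff hε0).2 (lt_of_le_of_lt hf hε)
  have key := right_measure_le_of_levyProkhorovEDist_lt hdist hBm
  have hthick : Metric.thickening (ENNReal.ofReal ε').toReal B ⊆ B := by
    intro g hg
    rw [ENNReal.toReal_ofReal hε0.le] at hg
    obtain ⟨b, hb, hgb⟩ := Metric.mem_thickening_iff.1 hg
    rw [hB, Set.mem_ofPred_eq, resS_eq_of_dist_lt (hgb.trans_le hε')]
    exact hb
  have h1 : ENNReal.ofReal (∑ z : LStar M D k, if typ z = a then ballLaw k μ z else 0) ≤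
      (lawTd (D + 1) μ).map (resS (k + 1)) B := by
    rw [Measure.map_apply hrm hBm, hpre, lawTd, Measure.map_apply hιm hBm,
      sum_ballLaw_filter μ fun z => typ z = a, ofReal_measureReal]
    exact measure_mono fun x hx => ⟨x, hx, rfl⟩
  have h2 : (distrG G f).map (resS (k + 1)) B ≤ (n : ℝ≥0∞)⁻¹ *
      ((Finset.univ.filter fun v => typ (cfgStar f π k v) = a).card : ℝ≥0∞) := by
    rw [Measure.map_apply hrm hBm, hpre]
    refine distrG_le hBm ?_
    rintro v σ ⟨x, hx, hr⟩
    exact (tyStar_of_resS_eq hπ hG hr).trans hx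
  have h3 := h1.trans (key.trans (add_le_add_left ((measure_mono hthick).trans h2) _))
  have h4 := ENNReal.toReal_mono (ENNReal.add_ne_top.2 ⟨ENNReal.mul_ne_top
    (ENNReal.inv_ne_top.2 hn0) (ENNReal.natCast_ne_top _), ENNReal.ofReal_ne_top⟩) h3
  rw [ENNReal.toReal_ofReal (Finset.sum_nonneg fun z _ => by
    split_ifs <;> [exact ballLaw_nonneg μ z; exact le_rfl]), ENNReal.toReal_add
    (ENNReal.mul_ne_top (ENNReal.inv_ne_top.2 hn0) (ENNReal.natCast_ne_top _))
    ENNReal.ofReal_ne_top, ENNReal.toReal_ofReal hε0.le, ENNReal.toReal_mul, ENNReal.toReal_inv,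
    ENNReal.toReal_natCast, ENNReal.toReal_natCast] at h4
  have hn1 : (0 : ℝ) < n := by exact_mod_cast hn
  have h5 := mul_le_mul_of_nonneg_left (sub_le_iff_le_add.2 h4) hn1.le
  rw [← mul_assoc, mul_inv_cancel₀ hn1.ne', one_mul] at h5
  exact h5

/-! ### The first moment computation -/

lemma sum_ncard_FSet_le {M : Type} [Fintype M] [MeasurableSpace M] [DiscreteMeasurableSpace M]
    {D k n : ℕ} {μ : Measure (TdVertex (D + 1) → M)} [IsProbabilityMeasure μ] {ε ε' : ℝ}
    (hε : ε < ε') (hε' : ε' ≤ 2⁻¹ ^ (k + 1)) (hε0 : 0 < ε') (hn : 1 ≤ n)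
    {A : Finset (SimpleGraph (Fin n))} (hA : ∀ G ∈ A, G ∈ regularGraphs (D + 1) n) :
    (∑ G ∈ A, (FSet (D + 1) μ (k + 1) ε G).ncard) * (D + 1).factorial ^ n ≤
      (cfgSet (ballLaw k μ) ε' n).card := by
  have h1 : (∑ G ∈ A, (FSet (D + 1) μ (k + 1) ε G).ncard) * (D + 1).factorial ^ n =
      (A.sigma fun G => (Finset.univ : Finset (∀ v, Fin (D + 1) ≃ {w // G.Adj v w})) ×ˢ
        (FSet (D + 1) μ (k + 1) ε G).toFinset).card := by
    rw [Finset.card_sigma, Finset.sum_mul]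
    refine Finset.sum_congr rfl fun G hG => ?_
    rw [Finset.card_product, Finset.card_univ, card_labellings (hA G hG), mul_comm,
      Set.ncard_eq_toFinset_card']
  rw [h1]
  refine Finset.card_le_card_of_injOn (fun q => (cfgOf q.1 q.2.1, q.2.2)) ?_ ?_
  · rintro ⟨G, e, f⟩ hq
    simp only [Finset.coe_sigma, Set.mem_sigma_iff, Finset.mem_coe, Finset.mem_product,
      Finset.mem_univ, true_and, Set.mem_toFinset] at hq
    refine Finset.mem_coe.2 (Finset.mem_filter.2 ⟨Finset.mem_univ _, cfgOf_cfgOf G e,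
      cfgOf_ne G e, ?_⟩)
    exact typClose_of_mem_FSet hε hε' hε0 hn hq.2 (cfgOf_cfgOf G e)
      fun u w => (cfgOf_adj G e u w).1
  · rintro ⟨G, e, f⟩ - ⟨G', e', f'⟩ - h
    have h2 : (⟨G, e⟩ : Σ G : SimpleGraph (Fin n), ∀ v, Fin (D + 1) ≃ {w // G.Adj v w}) =
        ⟨G', e'⟩ := cfgOf_injective (congrArg Prod.fst h)
    have h3 : f = f' := congrArg Prod.snd h
    cases h2
    cases h3
    rfl

lemma eventually_log_error_le (C K d : ℝ) (hd : 0 < d) {δ : ℝ} (hδ : 0 < δ) :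
    ∀ᶠ n : ℕ in atTop, K + K * Real.log n + C * (Real.log (n * d) + 1) / 2 ≤ n * δ := by
  have h1 : Tendsto (fun x : ℝ => Real.log x / x) atTop (𝓝 0) := by
    have := Real.isLittleO_log_id_atTop.tendsto_div_nhds_zero
    exact this
  have h2 : Tendsto (fun x : ℝ => (K + C * (Real.log d + 1) / 2) * x⁻¹ +
      (K + C / 2) * (Real.log x / x)) atTop (𝓝 0) := by
    have := (tendsto_inv_atTop_zero.const_mul (K + C * (Real.log d + 1) / 2)).add
      (h1.const_mul (K + C / 2))
    simpa using this
  have h3 := (h2.comp tendsto_natCast_atTop_atTop).eventually (gt_mem_nhds hδ)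
  filter_upwards [h3, eventually_gt_atTop 0] with n hn hn0
  have hn1 : (0 : ℝ) < n := by exact_mod_cast hn0
  have h4 := mul_le_mul_of_nonneg_left hn.le hn1.le
  rw [Real.log_mul hn1.ne' hd.ne']
  refine le_trans (le_of_eq ?_) h4
  simp only [Function.comp]
  field_simp
  ring

lemma exists_eventually_sum_ncard_FSet_le {M : Type} [Fintype M] [MeasurableSpace M]
    [DiscreteMeasurableSpace M] {D : ℕ} (k : ℕ) {μ : Measure (TdVertex (D + 1) → M)}
    (hμ : μ ∈ InvMeas (D + 1) M) {δ : ℝ} (hδ : 0 < δ) :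
    ∃ ε : ℝ, 0 < ε ∧ ∀ᶠ n in goodFilter (D + 1), 0 < (regularGraphs (D + 1) n).ncard ∧
      ∀ A : Finset (SimpleGraph (Fin n)), (∀ G ∈ A, G ∈ regularGraphs (D + 1) n) →
        ((∑ G ∈ A, (FSet (D + 1) μ (k + 1) ε G).ncard : ℕ) : ℝ) ≤
          (regularGraphs (D + 1) n).ncard *
            Real.exp (n * (SigmaR (D + 1) (k + 1) μ + 2 * δ)) := by
  have : IsProbabilityMeasure μ := hμ.1
  obtain ⟨ε₁, hε₁, h₁⟩ := exists_card_cfgSet_le (ballLaw_nonneg (k := k) μ) (sum_ballLaw μ)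
    (fun z z' => ballLaw_eq_of_typ_eq hμ) hδ
  obtain ⟨K, hK⟩ := log_card_regularGraphs_ge (d := D + 1) (by omega)
  set ε₂ : ℝ := min ε₁ (2⁻¹ ^ (k + 1)) with hε₂
  have hε₂0 : 0 < ε₂ := by positivity
  refine ⟨ε₂ / 2, by positivity, ?_⟩
  have hle : goodFilter (D + 1) ≤ atTop := inf_le_left
  filter_upwards [hK, hle (eventually_ge_atTop 1),
    hle (eventually_log_error_le (Fintype.card (UTree M D k × UTree M D k)) K ((D + 1 : ℕ) : ℝ)
      (by positivity) hδ)] with n hKn hn herr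
  refine ⟨hKn.1, fun A hA => ?_⟩
  have hreg : (0 : ℝ) < (regularGraphs (D + 1) n).ncard := by exact_mod_cast hKn.1
  have hfac : (0 : ℝ) < ((D + 1).factorial : ℝ) ^ n := by positivity
  have h2 : (((∑ G ∈ A, (FSet (D + 1) μ (k + 1) (ε₂ / 2) G).ncard : ℕ) : ℝ)) *
      ((D + 1).factorial : ℝ) ^ n ≤ ((cfgSet (ballLaw k μ) ε₁ n).card : ℝ) := by
    have h3 := sum_ncard_FSet_le (μ := μ) (k := k) (half_lt_self hε₂0) (min_le_right _ _) hε₂0 hn hA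
    have h4 : (cfgSet (ballLaw (M := M) (D := D) k μ) ε₂ n).card ≤
        (cfgSet (ballLaw k μ) ε₁ n).card := by
      refine Finset.card_le_card fun q hq => ?_
      unfold cfgSet at hq ⊢
      rw [Finset.mem_filter] at hq ⊢
      exact ⟨hq.1, hq.2.1, hq.2.2.1, hq.2.2.2.mono (min_le_left _ _)⟩
    exact_mod_cast h3.trans h4
  have h5 := h2.trans (h₁ n hn)
  rw [← sigmaR_eq] at h5
  rw [← mul_le_mul_iff_left₀ hfac]
  refine h5.trans ?_
  have h6 : (((regularGraphs (D + 1) n).ncard : ℝ)) *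
      Real.exp (n * (SigmaR (D + 1) (k + 1) μ + 2 * δ)) * ((D + 1).factorial : ℝ) ^ n =
      Real.exp (Real.log ((regularGraphs (D + 1) n).ncard * ((D + 1).factorial : ℝ) ^ n) +
        n * (SigmaR (D + 1) (k + 1) μ + 2 * δ)) := by
    rw [Real.exp_add, Real.exp_log (by positivity)]
    ring
  rw [h6, Real.exp_le_exp]
  have h7 := hKn.2
  push_cast at h7 herr ⊢
  linarith

lemma exists_eventually_hquant_le {M : Type} [Fintype M] [MeasurableSpace M]
    [DiscreteMeasurableSpace M] {D : ℕ} (k : ℕ) {μ : Measure (TdVertex (D + 1) → M)}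
    (hμ : μ ∈ InvMeas (D + 1) M) {δ : ℝ} (hδ : 0 < δ) :
    ∃ ε : ℝ, 0 < ε ∧ ∀ᶠ n in goodFilter (D + 1),
      hquant (D + 1) μ (k + 1) ε (1 / 2) n ≤
        ((SigmaR (D + 1) (k + 1) μ + 3 * δ : ℝ) : EReal) := by
  obtain ⟨ε, hε, h⟩ := exists_eventually_sum_ncard_FSet_le k hμ hδ
  refine ⟨ε, hε, ?_⟩
  have hle : goodFilter (D + 1) ≤ atTop := inf_le_left
  filter_upwards [h, hle (eventually_gt_atTop 0), hle ((tendsto_natCast_atTop_atTop.atTop_mul_const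
    hδ).eventually (eventually_gt_atTop 1))] with n ⟨hreg, hn⟩ hn0 hnδ
  refine sSup_le fun h hh => ?_
  by_contra! hlt
  have hreg' : (0 : ℝ) < (regularGraphs (D + 1) n).ncard := by exact_mod_cast hreg
  have hn1 : (0 : ℝ) < n := by exact_mod_cast hn0
  set S : Set (SimpleGraph (Fin n)) :=
    regularGraphs (D + 1) n ∩ {G | h ≤ HG (D + 1) μ (k + 1) ε G} with hS
  have h1 : (regularGraphs (D + 1) n).ncard / 2 ≤ (S.ncard : ℝ) := by
    have := hh.2
    rw [PrG, le_div_iff₀ hreg'] at this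
    linarith
  have h2 := hn S.toFinset fun G hG => (Set.mem_toFinset.1 hG).1
  have h3 : (S.ncard : ℝ) * Real.exp (n * (SigmaR (D + 1) (k + 1) μ + 3 * δ)) ≤
      ((∑ G ∈ S.toFinset, (FSet (D + 1) μ (k + 1) ε G).ncard : ℕ) : ℝ) := by
    rw [Set.ncard_eq_toFinset_card', ← nsmul_eq_mul, ← Finset.sum_const, Nat.cast_sum]
    refine Finset.sum_le_sum fun G hG => ?_
    have hG1 := hlt.trans_le (Set.mem_toFinset.1 hG).2
    unfold HG at hG1
    split_ifs at hG1 with hF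
    · exact absurd hG1 not_lt_bot
    · rw [EReal.coe_lt_coe_iff, lt_div_iff₀ hn1] at hG1
      have hpos : 0 < (FSet (D + 1) μ (k + 1) ε G).ncard :=
        (Set.ncard_pos (Set.toFinite _)).2 (Set.nonempty_iff_ne_empty.2 hF)
      rw [← Real.le_log_iff_exp_le (by exact_mod_cast hpos)]
      linarith
  have h4 := (mul_le_mul_of_nonneg_right h1 (Real.exp_pos _).le).trans (h3.trans h2)
  have h5 : Real.exp (n * (SigmaR (D + 1) (k + 1) μ + 3 * δ)) =
      Real.exp (n * (SigmaR (D + 1) (k + 1) μ + 2 * δ)) * Real.exp (n * δ) := by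
    rw [← Real.exp_add]
    ring_nf
  have h6 : 2 < Real.exp (n * δ) := by
    have := Real.add_one_le_exp (n * δ)
    linarith
  have h7 : 0 < (regularGraphs (D + 1) n).ncard *
      Real.exp (n * (SigmaR (D + 1) (k + 1) μ + 2 * δ)) := by positivity
  rw [h5] at h4
  nlinarith

lemma hbarR_le_sigmaR {M : Type} [Fintype M] [MeasurableSpace M]
    [DiscreteMeasurableSpace M] {d r : ℕ} (hd : 1 ≤ d) (hr : 1 ≤ r) {μ : Measure (TdVertex d → M)}
    (hμ : μ ∈ InvMeas d M) : hbarR d μ r ≤ ((SigmaR d r μ : ℝ) : EReal) := by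
  obtain ⟨D, rfl⟩ := Nat.exists_eq_add_of_le' hd
  obtain ⟨k, rfl⟩ := Nat.exists_eq_add_of_le' hr
  refine EReal.le_of_forall_lt_iff_le.1 fun z hz => ?_
  rw [EReal.coe_lt_coe_iff] at hz
  obtain ⟨ε, hε, h⟩ := exists_eventually_hquant_le k hμ (δ := (z - SigmaR (D + 1) (k + 1) μ) / 3)
    (by linarith)
  refine (iInf_le _ (⟨ε, hε⟩ : {e : ℝ // 0 < e})).trans (limsup_le_of_le ?_ ?_)
  · isBoundedDefault
  · filter_upwards [h] with n hn
    refine hn.trans (le_of_eq ?_)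
    congr 1
    ring

/-- First moment bound: for any `μ ∈ I_d(M)` and integer `r ≥ 1`,
`h̄(μ,r) ≤ Σ_r(μ)`, and consequently `h̄(μ) ≤ Σ(μ)`. -/
theorem first_moment_bound
    (d : ℕ) (hd : 3 ≤ d) (M : Type) [Fintype M] [MeasurableSpace M]
    [DiscreteMeasurableSpace M]
    (μ : Measure (TdVertex d → M)) (hμ : μ ∈ InvMeas d M) :
    (∀ r : ℕ, 1 ≤ r → hbarR d μ r ≤ ((SigmaR d r μ : ℝ) : EReal)) ∧
    hbar d μ ≤ SigmaInf d μ := by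
  have h : ∀ r : ℕ, 1 ≤ r → hbarR d μ r ≤ ((SigmaR d r μ : ℝ) : EReal) :=
    fun r hr => hbarR_le_sigmaR (by omega) hr hμ
  exact ⟨h, le_iInf fun r => (iInf_le _ (r + 1)).trans (h _ (Nat.le_add_left 1 r))⟩

end TreeEntropy
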